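/- Let (X, μ) be a σ-finite measure space and 1 < p < ∞. Let T : L^p(X, μ) → L^p(X, μ) be an invertible bounded linear operator with K := sup_{k ∈ ℤ} ‖T^k‖ < ∞ (T is power bounded together with its inverse). Then there exists a constant C, depending only on p and K, such that for every N ∈ ℕ, every strictly increasing finite sequence n_0 < n_1 < ⋯ < n_N of positive integers, and every x ∈ L^p(X, μ), one has ‖ ( ∑_{i=0}^{N-1} |M_{n_i}(T)x − M_{n_{i+1}}(T)x|^2 )^{1/2} ‖_{L^p(X,μ)} ≤ C ‖x‖_{L^p(X,μ)}. (This is the commutative case of Theorem 1.1 for the one-sided ergodic averages; the paper notes the result is new even in the commutative setting.) -/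

import Mathlib

open MeasureTheory Finset ENNReal

/-- One-sided ergodic average `M_n(T) = (1/(n+1)) ∑_{k=0}^{n} T^k`. -/
noncomputable def ergAvg {X : Type*} [MeasurableSpace X] {μ : MeasureTheory.Measure X}
    {p : ℝ≥0∞} [Fact (1 ≤ p)]
    (T : Lp ℂ p μ →L[ℂ] Lp ℂ p μ) (n : ℕ) : Lp ℂ p μ →L[ℂ] Lp ℂ p μ :=
  ((n : ℂ) + 1)⁻¹ • ∑ k ∈ Finset.range (n + 1), T ^ k

namespace QME

/-- block sum -/
noncomputable def blk (k : ℕ) (f : ℕ → ℝ) (q : ℕ) : ℝ := ∑ s ∈ range (2 ^ k), f (q * 2 ^ k + s)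
/-- dyadic conditional expectation -/
noncomputable def dE (k : ℕ) (f : ℕ → ℝ) (x : ℕ) : ℝ := blk k f (x / 2 ^ k) / 2 ^ k
/-- forward averages -/
noncomputable def Mav (n : ℕ) (f : ℕ → ℝ) (x : ℕ) : ℝ :=
  (∑ t ∈ range (n + 1), f (x + t)) / ((n : ℝ) + 1)

lemma sum_blocks (a b : ℕ) (F : ℕ → ℝ) :
    ∑ x ∈ range (a * b), F x = ∑ q ∈ range a, ∑ s ∈ range b, F (q * b + s) := by
  induction a with
  | zero => simp
  | succ a ih => rw [Nat.succ_mul, Finset.sum_range_add, ih, Finset.sum_range_succ]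

lemma div_blk {k q s : ℕ} (hs : s < 2 ^ k) : (q * 2 ^ k + s) / 2 ^ k = q := by
  rw [mul_comm, Nat.mul_add_div (by positivity), Nat.div_eq_of_lt hs, add_zero]

lemma div_div_pow {j k : ℕ} (h : j ≤ k) (x : ℕ) : x / 2 ^ k = (x / 2 ^ j) / 2 ^ (k - j) := by
  rw [Nat.div_div_eq_div_mul, ← pow_add, Nat.add_sub_cancel' h]

lemma dE_congr {k : ℕ} (f : ℕ → ℝ) {x y : ℕ} (h : x / 2 ^ k = y / 2 ^ k) : dE k f x = dE k f y := by
  simp [dE, h]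

lemma dE_congr' {j k : ℕ} (hjk : j ≤ k) (f : ℕ → ℝ) {x y : ℕ} (h : x / 2 ^ j = y / 2 ^ j) :
    dE k f x = dE k f y := by
  apply dE_congr; rw [div_div_pow hjk, h, ← div_div_pow hjk]

lemma dE_zero (f : ℕ → ℝ) : dE 0 f = f := by
  funext x; simp [dE, blk]

lemma sum_dE_self {k J : ℕ} (hk : k ≤ J) (f φ : ℕ → ℝ) :
    ∑ x ∈ range (2 ^ J), φ (x / 2 ^ k) * dE k f x = ∑ x ∈ range (2 ^ J), φ (x / 2 ^ k) * f x := by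
  have : 2 ^ J = 2 ^ (J - k) * 2 ^ k := by rw [← pow_add, Nat.sub_add_cancel hk]
  rw [this, sum_blocks, sum_blocks]
  refine Finset.sum_congr rfl fun q _ => ?_
  have h1 : ∀ s ∈ range (2 ^ k), φ ((q * 2 ^ k + s) / 2 ^ k) * dE k f (q * 2 ^ k + s)
      = φ q * (blk k f q / 2 ^ k) := by
    intro s hs
    rw [dE, div_blk (mem_range.1 hs)]
  have h2 : ∀ s ∈ range (2 ^ k), φ ((q * 2 ^ k + s) / 2 ^ k) * f (q * 2 ^ k + s)
      = φ q * f (q * 2 ^ k + s) := by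
    intro s hs
    rw [div_blk (mem_range.1 hs)]
  rw [Finset.sum_congr rfl h1, Finset.sum_congr rfl h2, ← Finset.mul_sum]
  simp only [blk, Finset.sum_const, card_range, nsmul_eq_mul, Nat.cast_pow, Nat.cast_ofNat]
  rw [← Finset.mul_sum]
  field_simp

lemma sum_dE {j k J : ℕ} (hjk : j ≤ k) (hk : k ≤ J) (f φ : ℕ → ℝ) :
    ∑ x ∈ range (2 ^ J), φ (x / 2 ^ k) * dE j f x = ∑ x ∈ range (2 ^ J), φ (x / 2 ^ k) * f x := by
  have := sum_dE_self (hjk.trans hk) f (fun y => φ (y / 2 ^ (k - j)))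
  simpa [← div_div_pow hjk] using this

lemma blk_dE {j k : ℕ} (hjk : j ≤ k) (f : ℕ → ℝ) (q : ℕ) : blk k (dE j f) q = blk k f q := by
  have h := sum_dE_self (J := k) hjk (fun s => f (q * 2 ^ k + s)) (fun _ => 1)
  simp only [one_mul] at h
  rw [blk, blk, ← h]
  refine Finset.sum_congr rfl fun s _ => ?_
  have e : 2 ^ k = 2 ^ (k - j) * 2 ^ j := by rw [← pow_add, Nat.sub_add_cancel hjk]
  have : (q * 2 ^ k + s) / 2 ^ j = q * 2 ^ (k - j) + s / 2 ^ j := by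
    rw [e, ← mul_assoc, mul_comm _ (2 ^ j), Nat.mul_add_div (by positivity)]
  simp only [dE, blk, this]
  congr 1
  refine Finset.sum_congr rfl fun t _ => ?_
  congr 1
  rw [e]; ring

lemma dE_sub (k : ℕ) (f g : ℕ → ℝ) (x : ℕ) :
    dE k (fun y => f y - g y) x = dE k f x - dE k g x := by
  simp [dE, blk, Finset.sum_sub_distrib, sub_div]

lemma dE_sum {ι : Type*} (s : Finset ι) (k : ℕ) (f : ι → ℕ → ℝ) (x : ℕ) :
    dE k (fun y => ∑ i ∈ s, f i y) x = ∑ i ∈ s, dE k (f i) x := by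
  simp only [dE, blk]
  rw [Finset.sum_comm, Finset.sum_div]

lemma Mav_sum {ι : Type*} (s : Finset ι) (n : ℕ) (f : ι → ℕ → ℝ) (x : ℕ) :
    Mav n (fun y => ∑ i ∈ s, f i y) x = ∑ i ∈ s, Mav n (f i) x := by
  simp only [Mav]
  rw [Finset.sum_comm, Finset.sum_div]

lemma Mav_sub (n : ℕ) (f g : ℕ → ℝ) (x : ℕ) :
    Mav n (fun y => f y - g y) x = Mav n f x - Mav n g x := by
  simp [Mav, Finset.sum_sub_distrib, sub_div]

lemma dE_nonneg {f : ℕ → ℝ} (hf : ∀ x, 0 ≤ f x) (k x : ℕ) : 0 ≤ dE k f x := by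
  unfold dE blk; exact div_nonneg (Finset.sum_nonneg fun _ _ => hf _) (by positivity)

lemma dE_eq_zero {J k : ℕ} (hk : k ≤ J) {f : ℕ → ℝ} (hf : ∀ x, 2 ^ J ≤ x → f x = 0) {x : ℕ}
    (hx : 2 ^ J ≤ x) : dE k f x = 0 := by
  unfold dE blk
  rw [Finset.sum_eq_zero, zero_div]
  intro s _
  apply hf
  have e : 2 ^ J = 2 ^ (J - k) * 2 ^ k := by rw [← pow_add, Nat.sub_add_cancel hk]
  have h1 : 2 ^ (J - k) ≤ x / 2 ^ k := by
    rw [Nat.le_div_iff_mul_le (by positivity), ← e]; exact hx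
  calc 2 ^ J = 2 ^ (J - k) * 2 ^ k := e
    _ ≤ x / 2 ^ k * 2 ^ k := Nat.mul_le_mul_right _ h1
    _ ≤ _ := Nat.le_add_right _ _

/-- the pieces of the martingale decomposition -/
noncomputable def pc (J : ℕ) (f : ℕ → ℝ) (m : ℕ) (x : ℕ) : ℝ :=
  if m < J then dE m f x - dE (m + 1) f x else dE J f x

lemma sum_pc (J : ℕ) (f : ℕ → ℝ) (x : ℕ) : ∑ m ∈ range (J + 1), pc J f m x = f x := by
  rw [Finset.sum_range_succ]
  have : ∀ m ∈ range J, pc J f m x = dE m f x - dE (m + 1) f x := by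
    intro m hm; simp [pc, mem_range.1 hm]
  rw [Finset.sum_congr rfl this, Finset.sum_range_sub']
  simp [pc, dE_zero]

lemma pc_congr {J m : ℕ} (hm : m ≤ J) (f : ℕ → ℝ) {x y : ℕ} (h : x / 2 ^ m = y / 2 ^ m) :
    pc J f m x = pc J f m y := by
  unfold pc
  split_ifs
  · rw [dE_congr f h, dE_congr' (Nat.le_succ m) f h]
  · rw [dE_congr' hm f h]

lemma pc_zero {J m : ℕ} (hm : m ≤ J) {f : ℕ → ℝ} (hf : ∀ x, 2 ^ J ≤ x → f x = 0) {x : ℕ}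
    (hx : 2 ^ J ≤ x) : pc J f m x = 0 := by
  unfold pc
  split_ifs with h
  · rw [dE_eq_zero hm hf hx, dE_eq_zero h hf hx, sub_zero]
  · rw [dE_eq_zero le_rfl hf hx]

lemma blk_pc {J m : ℕ} (hm : m < J) (f : ℕ → ℝ) (q : ℕ) : blk (m + 1) (pc J f m) q = 0 := by
  have : pc J f m = fun x => dE m f x - dE (m + 1) f x := by funext x; simp [pc, hm]
  rw [this]
  have : blk (m + 1) (fun x => dE m f x - dE (m + 1) f x) q
    = blk (m + 1) (dE m f) q - blk (m + 1) (dE (m + 1) f) q := by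
    simp [blk, Finset.sum_sub_distrib]
  rw [this, blk_dE (Nat.le_succ m), blk_dE le_rfl, sub_self]

end QME

namespace QME

/-- discrete A_1 condition on intervals in `[0, Λ)` -/
def A1 (Λ : ℕ) (v : ℕ → ℝ) (C : ℝ) : Prop :=
  ∀ a b x : ℕ, a ≤ x → x < b → b ≤ Λ → ∑ y ∈ Ico a b, v y ≤ C * ((b : ℝ) - a) * v x

/-- bumped A_2 condition, one side -/
def WH1 (Λ : ℕ) (w u : ℕ → ℝ) (C δ : ℝ) : Prop :=
  ∀ a c d b : ℕ, a ≤ c → c ≤ d → d ≤ b → b ≤ Λ → a < b →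
    (∑ y ∈ Ico c d, w y) * (∑ y ∈ Ico a b, u y)
      ≤ C * ((((d : ℝ) - c) / ((b : ℝ) - a)) ^ δ * ((b : ℝ) - a) ^ 2)

/-- bumped A_2 condition -/
def WH (Λ : ℕ) (w : ℕ → ℝ) (C δ : ℝ) : Prop :=
  (∀ x, 0 < w x) ∧ WH1 Λ w (fun x => (w x)⁻¹) C δ ∧ WH1 Λ (fun x => (w x)⁻¹) w C δ

lemma WH.inv {Λ : ℕ} {w : ℕ → ℝ} {C δ : ℝ} (h : WH Λ w C δ) : WH Λ (fun x => (w x)⁻¹) C δ := by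
  refine ⟨fun x => inv_pos.2 (h.1 x), ?_, ?_⟩
  · simpa using h.2.2
  · simpa using h.2.1

lemma sum_rpow_le {v : ℕ → ℝ} (hv : ∀ x, 0 < v x) {a : ℝ} (ha0 : 0 ≤ a) (ha1 : a < 1)
    {E : Finset ℕ} {S : ℝ} (hS : ∑ y ∈ E, v y ≤ S) (hSpos : 0 < S) :
    ∑ y ∈ E, (v y) ^ a ≤ S ^ a * (E.card : ℝ) ^ (1 - a) := by
  rcases E.eq_empty_or_nonempty with rfl | hE
  · simp [Real.zero_rpow (by linarith : (1 - a) ≠ 0)]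
  have hc : (0 : ℝ) < E.card := by exact_mod_cast hE.card_pos
  set l : ℝ := S / E.card with hl
  have hlp : 0 < l := by positivity
  have key : ∀ y ∈ E, (v y) ^ a ≤ l ^ (a - 1) * (a * v y + (1 - a) * l) := by
    intro y _
    have := Real.geom_mean_le_arith_mean2_weighted ha0 (by linarith : 0 ≤ 1 - a) (hv y).le hlp.le
      (by ring)
    calc (v y) ^ a = l ^ (a - 1) * ((v y) ^ a * l ^ (1 - a)) := by
          rw [mul_comm, mul_assoc, ← Real.rpow_add hlp]; simp
      _ ≤ _ := by gcongr
  calc ∑ y ∈ E, (v y) ^ a ≤ ∑ y ∈ E, l ^ (a - 1) * (a * v y + (1 - a) * l) := Finset.sum_le_sum key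
    _ = l ^ (a - 1) * (a * ∑ y ∈ E, v y + (1 - a) * (E.card * l)) := by
        rw [← Finset.mul_sum, Finset.sum_add_distrib, ← Finset.mul_sum]; simp; ring_nf; simp
    _ ≤ l ^ (a - 1) * (a * S + (1 - a) * S) := by
        have : (E.card : ℝ) * l = S := by rw [hl]; field_simp
        rw [this]; gcongr
    _ = l ^ (a - 1) * S := by ring
    _ = S ^ a * (E.card : ℝ) ^ (1 - a) := by
        rw [hl, Real.div_rpow hSpos.le hc.le, Real.rpow_sub_one hSpos.ne']
        rw [show (1 - a) = -(a - 1) by ring, Real.rpow_neg hc.le]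
        field_simp

lemma A1.WH {Λ : ℕ} {v : ℕ → ℝ} {C a : ℝ} (hC : 1 ≤ C) (hv : ∀ x, 0 < v x) (h : A1 Λ v C)
    (ha0 : 0 ≤ a) (ha1 : a < 1) : WH Λ (fun x => v x ^ a) C (1 - a) := by
  have hCa : C ^ a ≤ C := by
    calc C ^ a ≤ C ^ (1 : ℝ) := Real.rpow_le_rpow_of_exponent_le hC ha1.le
      _ = C := Real.rpow_one C
  -- bound on a sub-interval sum of the inverse
  have hinv : ∀ a' c d b : ℕ, a' ≤ c → c ≤ d → d ≤ b → b ≤ Λ → a' < b →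
      ∑ y ∈ Ico c d, (v y ^ a)⁻¹ ≤ ((d : ℝ) - c) * ((C * ((b : ℝ) - a')) ^ a *
        ((∑ y ∈ Ico a' b, v y) ^ a)⁻¹) := by
    intro a' c d b h1 h2 h3 h4 h5
    have hSp : 0 < ∑ y ∈ Ico a' b, v y :=
      Finset.sum_pos (fun y _ => hv y) (by simpa using h5)
    have hb : (0 : ℝ) < (b : ℝ) - a' := by
      have : (a' : ℝ) < b := by exact_mod_cast h5
      linarith
    calc ∑ y ∈ Ico c d, (v y ^ a)⁻¹ ≤ ∑ y ∈ Ico c d, ((C * ((b : ℝ) - a')) ^ a *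
        ((∑ y ∈ Ico a' b, v y) ^ a)⁻¹) := by
          refine Finset.sum_le_sum fun y hy => ?_
          rw [mem_Ico] at hy
          have := h a' b y (h1.trans hy.1) (lt_of_lt_of_le hy.2 h3) h4
          have h6 := Real.rpow_le_rpow hSp.le this ha0
          rw [Real.mul_rpow (by positivity) (hv y).le] at h6
          have h7 : 0 < v y ^ a := Real.rpow_pos_of_pos (hv y) a
          have h8 : 0 < (∑ y ∈ Ico a' b, v y) ^ a := Real.rpow_pos_of_pos hSp a
          rw [← div_eq_mul_inv, le_div_iff₀ h8, inv_mul_le_iff₀ h7]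
          linarith
      _ = _ := by
          rw [Finset.sum_const, Nat.card_Ico, nsmul_eq_mul, Nat.cast_sub h2]
  have hdir : ∀ a' c d b : ℕ, a' ≤ c → c ≤ d → d ≤ b → b ≤ Λ → a' < b →
      ∑ y ∈ Ico c d, v y ^ a ≤ (∑ y ∈ Ico a' b, v y) ^ a * ((d : ℝ) - c) ^ (1 - a) := by
    intro a' c d b h1 h2 h3 h4 h5
    have hSp : 0 < ∑ y ∈ Ico a' b, v y :=
      Finset.sum_pos (fun y _ => hv y) (by simpa using h5)
    have := sum_rpow_le hv ha0 ha1 (E := Ico c d) (S := ∑ y ∈ Ico a' b, v y)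
      (Finset.sum_le_sum_of_subset_of_nonneg (Ico_subset_Ico h1 h3) (fun y _ _ => (hv y).le)) hSp
    rwa [Nat.card_Ico, Nat.cast_sub h2] at this
  refine ⟨fun x => Real.rpow_pos_of_pos (hv x) a, ?_, ?_⟩
  · intro a' c d b h1 h2 h3 h4 h5
    have hSp : 0 < ∑ y ∈ Ico a' b, v y :=
      Finset.sum_pos (fun y _ => hv y) (by simpa using h5)
    have h8 : 0 < (∑ y ∈ Ico a' b, v y) ^ a := Real.rpow_pos_of_pos hSp a
    have hb : (0 : ℝ) < (b : ℝ) - a' := by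
      have : (a' : ℝ) < b := by exact_mod_cast h5
      linarith
    have hd : (0 : ℝ) ≤ (d : ℝ) - c := by
      have : (c : ℝ) ≤ d := by exact_mod_cast h2
      linarith
    have e1 := hdir a' c d b h1 h2 h3 h4 h5
    have e2 := hinv a' a' b b le_rfl h5.le le_rfl h4 h5
    calc _ ≤ ((∑ y ∈ Ico a' b, v y) ^ a * ((d : ℝ) - c) ^ (1 - a)) *
        (((b : ℝ) - a') * ((C * ((b : ℝ) - a')) ^ a * ((∑ y ∈ Ico a' b, v y) ^ a)⁻¹)) := by
          apply mul_le_mul e1 e2 (Finset.sum_nonneg fun y _ => ?_) (by positivity)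
          exact inv_nonneg.2 (Real.rpow_pos_of_pos (hv y) a).le
      _ = C ^ a * (((((d : ℝ) - c) / ((b : ℝ) - a')) ^ (1 - a)) * ((b : ℝ) - a') ^ 2) := by
          rw [Real.mul_rpow (by linarith) hb.le, Real.div_rpow hd hb.le,
            Real.rpow_sub hb, Real.rpow_one]
          have : 0 < ((b : ℝ) - a') ^ a := Real.rpow_pos_of_pos hb a
          field_simp
      _ ≤ _ := by gcongr
  · intro a' c d b h1 h2 h3 h4 h5
    have hSp : 0 < ∑ y ∈ Ico a' b, v y :=
      Finset.sum_pos (fun y _ => hv y) (by simpa using h5)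
    have h8 : 0 < (∑ y ∈ Ico a' b, v y) ^ a := Real.rpow_pos_of_pos hSp a
    have hb : (0 : ℝ) < (b : ℝ) - a' := by
      have : (a' : ℝ) < b := by exact_mod_cast h5
      linarith
    have hd : (0 : ℝ) ≤ (d : ℝ) - c := by
      have : (c : ℝ) ≤ d := by exact_mod_cast h2
      linarith
    have hdb : (d : ℝ) - c ≤ (b : ℝ) - a' := by
      have e1 : (a' : ℝ) ≤ c := by exact_mod_cast h1
      have e2 : (d : ℝ) ≤ b := by exact_mod_cast h3
      linarith
    have e1 := hdir a' a' b b le_rfl h5.le le_rfl h4 h5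
    have e2 := hinv a' c d b h1 h2 h3 h4 h5
    calc _ ≤ (((d : ℝ) - c) * ((C * ((b : ℝ) - a')) ^ a * ((∑ y ∈ Ico a' b, v y) ^ a)⁻¹)) *
          ((∑ y ∈ Ico a' b, v y) ^ a * ((b : ℝ) - a') ^ (1 - a)) := by
          apply mul_le_mul e2 e1 (Finset.sum_nonneg fun y _ => ?_) (by positivity)
          exact (Real.rpow_pos_of_pos (hv y) a).le
      _ = C ^ a * ((((d : ℝ) - c) / ((b : ℝ) - a')) * ((b : ℝ) - a') ^ 2) := by
          rw [Real.mul_rpow (by linarith) hb.le, Real.rpow_sub hb, Real.rpow_one]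
          have : 0 < ((b : ℝ) - a') ^ a := Real.rpow_pos_of_pos hb a
          field_simp
      _ ≤ _ := by
          gcongr
          have h0 : 0 ≤ ((d : ℝ) - c) / ((b : ℝ) - a') := by positivity
          have h1' : ((d : ℝ) - c) / ((b : ℝ) - a') ≤ 1 := by rw [div_le_one hb]; exact hdb
          rcases h0.eq_or_lt with h0 | h0
          · rw [← h0]; exact Real.rpow_nonneg le_rfl _
          · calc _ = (((d : ℝ) - c) / ((b : ℝ) - a')) ^ (1 : ℝ) := (Real.rpow_one _).symm
              _ ≤ _ := Real.rpow_le_rpow_of_exponent_ge h0 h1' (by linarith)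

end QME

namespace QME

lemma blk_eq_Ico (k : ℕ) (f : ℕ → ℝ) (q : ℕ) :
    blk k f q = ∑ y ∈ Ico (q * 2 ^ k) ((q + 1) * 2 ^ k), f y := by
  rw [Finset.sum_Ico_eq_sum_range, blk]
  congr 2
  rw [add_mul, one_mul, Nat.add_sub_cancel_left]

lemma win_eq (k : ℕ) (f : ℕ → ℝ) (q : ℕ) :
    ∑ y ∈ Ico (q * 2 ^ k) ((q + 3) * 2 ^ k), f y = blk k f q + blk k f (q + 1) + blk k f (q + 2) := by
  rw [blk_eq_Ico, blk_eq_Ico, blk_eq_Ico, Finset.sum_Ico_consecutive, Finset.sum_Ico_consecutive]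
  all_goals first | exact Nat.mul_le_mul_right _ (by omega)

lemma sum_blk {J M : ℕ} (hM : M ≤ J) (g : ℕ → ℝ) :
    ∑ q ∈ range (2 ^ (J - M)), blk M g q = ∑ x ∈ range (2 ^ J), g x := by
  have e : 2 ^ J = 2 ^ (J - M) * 2 ^ M := by rw [← pow_add, Nat.sub_add_cancel hM]
  rw [e, sum_blocks]; rfl

lemma sum_windows {J M : ℕ} (hM : M ≤ J) {g : ℕ → ℝ} (hg : ∀ x, 0 ≤ g x)
    (hg0 : ∀ x, 2 ^ J ≤ x → g x = 0) :
    ∑ q ∈ range (2 ^ (J - M)), ∑ y ∈ Ico (q * 2 ^ M) ((q + 3) * 2 ^ M), g y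
      ≤ 3 * ∑ x ∈ range (2 ^ J), g x := by
  have e : 2 ^ J = 2 ^ (J - M) * 2 ^ M := by rw [← pow_add, Nat.sub_add_cancel hM]
  have hb : ∀ q, 0 ≤ blk M g q := fun q => Finset.sum_nonneg fun _ _ => hg _
  have hz : ∀ q, 2 ^ (J - M) ≤ q → blk M g q = 0 := by
    intro q hq
    refine Finset.sum_eq_zero fun s _ => hg0 _ ?_
    rw [e]
    exact (Nat.mul_le_mul_right _ hq).trans (Nat.le_add_right _ _)
  have h1 : ∀ c, ∑ q ∈ range (2 ^ (J - M)), blk M g (q + c) ≤ ∑ x ∈ range (2 ^ J), g x := by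
    intro c
    rw [← sum_blk hM]
    calc ∑ q ∈ range (2 ^ (J - M)), blk M g (q + c)
        ≤ ∑ q ∈ range c, blk M g q + ∑ q ∈ range (2 ^ (J - M)), blk M g (c + q) := by
          simp only [add_comm c]
          have := Finset.sum_nonneg (s := range c) (fun q _ => hb q)
          linarith
      _ = ∑ q ∈ range (c + 2 ^ (J - M)), blk M g q := by rw [Finset.sum_range_add]
      _ = ∑ q ∈ range (2 ^ (J - M) + c), blk M g q := by rw [add_comm]
      _ = _ := by
          rw [Finset.sum_range_add, add_eq_left]
          exact Finset.sum_eq_zero fun q _ => hz _ (Nat.le_add_right _ _)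
  simp only [win_eq, Finset.sum_add_distrib]
  have := h1 0; have := h1 1; have := h1 2
  simp only [add_zero] at *
  linarith

lemma abs_Mav_le {k n : ℕ} (h : ℕ → ℝ) (x : ℕ) (h1 : 2 ^ k ≤ n) (h2 : n < 2 ^ (k + 1)) :
    |Mav n h x| ≤ (∑ t ∈ range (2 ^ (k + 1)), |h (x + t)|) / 2 ^ k := by
  have hn : ((2 : ℝ) ^ k) ≤ n := by exact_mod_cast h1
  rw [Mav, abs_div, abs_of_pos (by positivity : (0 : ℝ) < (n : ℝ) + 1)]
  apply div_le_div₀ (Finset.sum_nonneg fun _ _ => abs_nonneg _) _ (by positivity) (by linarith)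
  refine (Finset.abs_sum_le_sum_abs _ _).trans ?_
  apply Finset.sum_le_sum_of_subset_of_nonneg
  · intro t; simp only [mem_range]; omega
  · intros; exact abs_nonneg _

lemma Mav_succ_sub (h : ℕ → ℝ) (n x : ℕ) :
    Mav n h x - Mav (n + 1) h x = (Mav n h x - h (x + (n + 1))) / ((n : ℝ) + 2) := by
  unfold Mav
  rw [Finset.sum_range_succ _ (n + 1)]
  push_cast
  have : (n : ℝ) + 1 ≠ 0 := by positivity
  have : (n : ℝ) + 2 ≠ 0 := by positivity
  have : (n : ℝ) + 1 + 1 ≠ 0 := by positivity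
  field_simp
  ring

lemma var_le (k : ℕ) (h : ℕ → ℝ) (x : ℕ) :
    ∑ n ∈ Ico (2 ^ k) (2 ^ (k + 1) - 1), |Mav n h x - Mav (n + 1) h x|
      ≤ 2 * ((∑ t ∈ range (2 ^ (k + 1)), |h (x + t)|) / 2 ^ k) := by
  set A := (∑ t ∈ range (2 ^ (k + 1)), |h (x + t)|) / 2 ^ k with hA
  have hA0 : 0 ≤ A := by positivity
  have hp : 0 < 2 ^ k := by positivity
  have e2 : 2 ^ (k + 1) = 2 * 2 ^ k := by ring
  have key : ∀ n ∈ Ico (2 ^ k) (2 ^ (k + 1) - 1), |Mav n h x - Mav (n + 1) h x|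
      ≤ (A + |h (x + (n + 1))|) / 2 ^ k := by
    intro n hn
    rw [mem_Ico] at hn
    have hn' : ((2 : ℝ) ^ k) ≤ n := by exact_mod_cast hn.1
    rw [Mav_succ_sub, abs_div, abs_of_pos (by positivity : (0 : ℝ) < (n : ℝ) + 2)]
    apply div_le_div₀ (by positivity) _ (by positivity) (by linarith)
    refine (abs_sub _ _).trans ?_
    gcongr
    exact abs_Mav_le h x hn.1 (by omega)
  calc _ ≤ ∑ n ∈ Ico (2 ^ k) (2 ^ (k + 1) - 1), (A + |h (x + (n + 1))|) / 2 ^ k :=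
        Finset.sum_le_sum key
    _ = (∑ n ∈ Ico (2 ^ k) (2 ^ (k + 1) - 1), A) / 2 ^ k
        + (∑ n ∈ Ico (2 ^ k) (2 ^ (k + 1) - 1), |h (x + (n + 1))|) / 2 ^ k := by
        rw [← Finset.sum_div, Finset.sum_add_distrib, add_div]
    _ ≤ A + A := by
        gcongr
        · rw [Finset.sum_const, Nat.card_Ico, nsmul_eq_mul, div_le_iff₀ (by positivity), mul_comm]
          gcongr
          have : 2 ^ (k + 1) - 1 - 2 ^ k ≤ 2 ^ k := by omega
          exact_mod_cast this
        · rw [hA]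
          gcongr
          rw [Finset.sum_Ico_add' (fun n => |h (x + n)|) _ _ 1]
          apply Finset.sum_le_sum_of_subset_of_nonneg
          · intro t; simp only [mem_range, mem_Ico]; omega
          · intros; exact abs_nonneg _
    _ = 2 * A := by ring

lemma short_var {n : ℕ → ℕ} (hn : StrictMono n) (N k : ℕ) (h : ℕ → ℝ) (x : ℕ) :
    ∑ i ∈ (range N).filter (fun i => (2 ^ k ≤ n i ∧ n (i + 1) < 2 ^ (k + 1))),
      |Mav (n i) h x - Mav (n (i + 1)) h x|
      ≤ ∑ m ∈ Ico (2 ^ k) (2 ^ (k + 1) - 1), |Mav m h x - Mav (m + 1) h x| := by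
  classical
  set c : ℕ → ℝ := fun m => if m ∈ Ico (2 ^ k) (2 ^ (k + 1) - 1) then
    |Mav m h x - Mav (m + 1) h x| else 0 with hc
  have hc0 : ∀ m, 0 ≤ c m := by intro m; simp only [hc]; split_ifs <;> positivity
  have h1 : ∀ i ∈ range N, (2 ^ k ≤ n i ∧ n (i + 1) < 2 ^ (k + 1)) →
      |Mav (n i) h x - Mav (n (i + 1)) h x| ≤ ∑ m ∈ Ico (n i) (n (i + 1)), c m := by
    intro i _ hi
    have hlt := hn (Nat.lt_add_one i)
    have tel : Mav (n i) h x - Mav (n (i + 1)) h x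
        = ∑ m ∈ Ico (n i) (n (i + 1)), (Mav m h x - Mav (m + 1) h x) := by
      have := Finset.sum_Ico_sub (fun m => Mav m h x) hlt.le
      rw [← neg_inj, ← Finset.sum_neg_distrib]
      simp only [neg_sub]
      exact this.symm
    rw [tel]
    refine (Finset.abs_sum_le_sum_abs _ _).trans (Finset.sum_le_sum fun m hm => ?_)
    rw [mem_Ico] at hm
    simp only [hc]
    rw [if_pos]
    rw [mem_Ico]; omega
  have h2 : ∀ N, ∑ i ∈ range N, ∑ m ∈ Ico (n i) (n (i + 1)), c m = ∑ m ∈ Ico (n 0) (n N), c m := by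
    intro N
    induction N with
    | zero => simp
    | succ N ih =>
      rw [Finset.sum_range_succ, ih, Finset.sum_Ico_consecutive _ (hn.monotone (Nat.zero_le _))
        (hn.monotone (Nat.le_succ _))]
  rw [Finset.sum_filter]
  calc _ ≤ ∑ i ∈ range N, ∑ m ∈ Ico (n i) (n (i + 1)), c m := by
        refine Finset.sum_le_sum fun i hi => ?_
        split_ifs with h3
        · exact h1 i hi h3
        · exact Finset.sum_nonneg fun m _ => hc0 m
    _ = ∑ m ∈ Ico (n 0) (n N), c m := h2 N
    _ ≤ ∑ m ∈ Ico (n 0) (n N) ∪ Ico (2 ^ k) (2 ^ (k + 1) - 1), c m :=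
        Finset.sum_le_sum_of_subset_of_nonneg subset_union_left (fun _ _ _ => hc0 _)
    _ = ∑ m ∈ Ico (2 ^ k) (2 ^ (k + 1) - 1), c m := by
        symm
        apply Finset.sum_subset subset_union_right
        intro m _ hm
        simp only [hc]; rw [if_neg hm]
    _ = _ := Finset.sum_congr rfl fun m hm => by simp only [hc]; rw [if_pos hm]

lemma short_sq {n : ℕ → ℕ} (hn : StrictMono n) (N k : ℕ) (h : ℕ → ℝ) (x : ℕ) {P V e : ℝ}
    (hP : ∀ m, 2 ^ k ≤ m → m < 2 ^ (k + 1) → |Mav m h x - e| ≤ P)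
    (hV : (∑ t ∈ range (2 ^ (k + 1)), |h (x + t)|) / 2 ^ k ≤ V) (hP0 : 0 ≤ P) :
    ∑ i ∈ (range N).filter (fun i => (2 ^ k ≤ n i ∧ n (i + 1) < 2 ^ (k + 1))),
      (Mav (n i) h x - Mav (n (i + 1)) h x) ^ 2 ≤ 4 * P * V := by
  calc _ ≤ ∑ i ∈ (range N).filter (fun i => (2 ^ k ≤ n i ∧ n (i + 1) < 2 ^ (k + 1))),
      2 * P * |Mav (n i) h x - Mav (n (i + 1)) h x| := by
        refine Finset.sum_le_sum fun i hi => ?_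
        rw [mem_filter] at hi
        have hlt := hn (Nat.lt_add_one i)
        have a1 := hP (n i) hi.2.1 (by omega)
        have a2 := hP (n (i + 1)) (by omega) hi.2.2
        have : |Mav (n i) h x - Mav (n (i + 1)) h x| ≤ 2 * P := by
          rw [abs_le] at *
          constructor <;> linarith
        rw [← sq_abs, sq]
        gcongr
    _ ≤ 2 * P * (2 * V) := by
        rw [← Finset.mul_sum]
        gcongr
        refine (short_var hn N k h x).trans ((var_le k h x).trans ?_)
        gcongr
    _ = _ := by ring

lemma initseg_le {j : ℕ} {h : ℕ → ℝ} (h0 : ∀ q, blk j h q = 0) (y : ℕ) :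
    |∑ t ∈ range y, h t| ≤ ∑ t ∈ Ico (y / 2 ^ j * 2 ^ j) ((y / 2 ^ j + 1) * 2 ^ j), |h t| := by
  have hle : y / 2 ^ j * 2 ^ j ≤ y := Nat.div_mul_le_self y _
  have hlt : y < (y / 2 ^ j + 1) * 2 ^ j := by
    have := Nat.lt_div_mul_add (a := y) (b := 2 ^ j) (by positivity)
    rw [add_mul, one_mul]; exact this
  have : ∑ t ∈ range y, h t = ∑ t ∈ Ico (y / 2 ^ j * 2 ^ j) y, h t := by
    rw [range_eq_Ico, ← Finset.sum_Ico_consecutive h (Nat.zero_le _) hle, ← range_eq_Ico, sum_blocks]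
    rw [add_eq_right]
    exact Finset.sum_eq_zero fun q _ => h0 q
  rw [this]
  refine (Finset.abs_sum_le_sum_abs _ _).trans ?_
  exact Finset.sum_le_sum_of_subset_of_nonneg (Ico_subset_Ico le_rfl hlt.le) (fun _ _ _ => abs_nonneg _)

lemma align {j k q y c : ℕ} (hjk : j ≤ k) (h1 : q * 2 ^ k ≤ y) (h2 : y < c * 2 ^ k) :
    q * 2 ^ k ≤ y / 2 ^ j * 2 ^ j ∧ (y / 2 ^ j + 1) * 2 ^ j ≤ c * 2 ^ k := by
  have e : 2 ^ k = 2 ^ (k - j) * 2 ^ j := by rw [← pow_add, Nat.sub_add_cancel hjk]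
  rw [e, ← mul_assoc] at h1 h2 ⊢
  rw [← mul_assoc c]
  constructor
  · exact Nat.mul_le_mul_right _ ((Nat.le_div_iff_mul_le (by positivity)).2 h1)
  · exact Nat.mul_le_mul_right _ ((Nat.div_lt_iff_lt_mul (by positivity)).2 h2)

lemma csw {Λ : ℕ} {w : ℕ → ℝ} {C δ : ℝ} (hw : WH Λ w C δ) (h : ℕ → ℝ) {a c d b : ℕ}
    (h1 : a ≤ c) (h2 : c ≤ d) (h3 : d ≤ b) (h4 : b ≤ Λ) (h5 : a < b) :
    (∑ y ∈ Ico c d, |h y|) ^ 2 * (∑ y ∈ Ico a b, w y) ≤ (∑ y ∈ Ico a b, h y ^ 2 * w y) *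
      (C * ((((d : ℝ) - c) / ((b : ℝ) - a)) ^ δ * ((b : ℝ) - a) ^ 2)) := by
  have hwp := hw.1
  have e1 : (∑ y ∈ Ico c d, |h y|) ^ 2 ≤ (∑ y ∈ Ico c d, h y ^ 2 * w y) *
      (∑ y ∈ Ico c d, (w y)⁻¹) := by
    apply Finset.sum_sq_le_sum_mul_sum_of_sq_le_mul
    · intro i _; have := hwp i; positivity
    · intro i _; have := hwp i; positivity
    · intro i _; rw [sq_abs]; exact le_of_eq (by field_simp [(hwp i).ne'])
  have e2 : ∑ y ∈ Ico c d, h y ^ 2 * w y ≤ ∑ y ∈ Ico a b, h y ^ 2 * w y := by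
    apply Finset.sum_le_sum_of_subset_of_nonneg (Ico_subset_Ico h1 h3)
    intro i _ _; have := hwp i; positivity
  have e3 := hw.2.2 a c d b h1 h2 h3 h4 h5
  have n1 : 0 ≤ ∑ y ∈ Ico a b, w y := Finset.sum_nonneg fun y _ => (hwp y).le
  have n2 : 0 ≤ ∑ y ∈ Ico c d, (w y)⁻¹ := Finset.sum_nonneg fun y _ => (inv_pos.2 (hwp y)).le
  have n3 : 0 ≤ ∑ y ∈ Ico a b, h y ^ 2 * w y :=
    Finset.sum_nonneg fun y _ => by have := hwp y; positivity
  calc _ ≤ ((∑ y ∈ Ico a b, h y ^ 2 * w y) * (∑ y ∈ Ico c d, (w y)⁻¹)) *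
        (∑ y ∈ Ico a b, w y) := by
        gcongr
        exact e1.trans (by gcongr)
    _ = (∑ y ∈ Ico a b, h y ^ 2 * w y) * ((∑ y ∈ Ico c d, (w y)⁻¹) * (∑ y ∈ Ico a b, w y)) := by
        ring
    _ ≤ _ := by gcongr

end QME

namespace QME

/-- decay base -/
noncomputable def th (δ : ℝ) : ℝ := (2 : ℝ) ^ (-(δ / 4))

lemma th_pos (δ : ℝ) : 0 < th δ := Real.rpow_pos_of_pos (by norm_num) _

lemma th_lt_one {δ : ℝ} (h : 0 < δ) : th δ < 1 := by
  unfold th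
  apply Real.rpow_lt_one_of_one_lt_of_neg (by norm_num) (by linarith)

lemma ratio_le {δ r : ℝ} (hδ : 0 < δ) {D : ℕ} (hr0 : 0 ≤ r) (hr : r ≤ (1 / 2) ^ D) :
    r ^ δ ≤ (th δ ^ (2 * D)) ^ 2 := by
  calc r ^ δ ≤ ((1 / 2 : ℝ) ^ D) ^ δ := Real.rpow_le_rpow hr0 hr hδ.le
    _ = (th δ ^ (2 * D)) ^ 2 := by
      unfold th
      rw [← Real.rpow_natCast (1 / 2 : ℝ) D, ← Real.rpow_mul (by norm_num), ← pow_mul,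
        ← Real.rpow_natCast, ← Real.rpow_mul (by norm_num), one_div,
        Real.inv_rpow (by norm_num), ← Real.rpow_neg (by norm_num)]
      congr 1
      push_cast; ring

lemma win_bound {J M q : ℕ} (hM : M ≤ J) (hq : q < 2 ^ (J - M)) : (q + 3) * 2 ^ M ≤ 2 ^ (J + 2) := by
  have e : 2 ^ J = 2 ^ (J - M) * 2 ^ M := by rw [← pow_add, Nat.sub_add_cancel hM]
  have h1 : (q + 1) * 2 ^ M ≤ 2 ^ J := by rw [e]; exact Nat.mul_le_mul_right _ hq
  have h2 : 2 ^ M ≤ 2 ^ J := Nat.pow_le_pow_right (by norm_num) hM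
  have h3 : (q + 3) * 2 ^ M = (q + 1) * 2 ^ M + 2 * 2 ^ M := by ring
  have h4 : 2 ^ (J + 2) = 4 * 2 ^ J := by ring
  omega

lemma win_lt (M q : ℕ) : q * 2 ^ M < (q + 3) * 2 ^ M :=
  Nat.mul_lt_mul_of_pos_right (by omega) (by positivity)

lemma win_len (M q : ℕ) : (((q + 3) * 2 ^ M : ℕ) : ℝ) - ((q * 2 ^ M : ℕ) : ℝ) = 3 * 2 ^ M := by
  push_cast; ring

lemma block_fine {J k m : ℕ} {w : ℕ → ℝ} {C δ : ℝ} (hC : 0 ≤ C) (hδ : 0 < δ)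
    (hw : WH (2 ^ (J + 2)) w C δ) (hk : k < J) (hm : m < k) {h : ℕ → ℝ}
    (h0 : ∀ q, blk (m + 1) h q = 0) (hz : ∀ x, 2 ^ J ≤ x → h x = 0)
    {n : ℕ → ℕ} (hn : StrictMono n) (N : ℕ) :
    ∃ b : ℕ → ℝ, (∀ x, x < 2 ^ J → ∀ i, 2 ^ k ≤ i → i < 2 ^ (k + 1) →
        (Mav i h x - dE k h x) ^ 2 ≤ b x) ∧
      (∀ x, x < 2 ^ J →
        ∑ i ∈ (range N).filter (fun i => (2 ^ k ≤ n i ∧ n (i + 1) < 2 ^ (k + 1))),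
          (Mav (n i) h x - Mav (n (i + 1)) h x) ^ 2 ≤ b x) ∧
      ∑ x ∈ range (2 ^ J), b x * w x
        ≤ 540 * C * th δ ^ (2 * (k - m)) * ∑ x ∈ range (2 ^ J), h x ^ 2 * w x := by
  have hwp := hw.1
  set s := th δ ^ (2 * (k - m)) with hs
  have hs0 : 0 ≤ s := pow_nonneg (th_pos δ).le _
  have hs1 : s ≤ 1 := pow_le_one₀ (th_pos δ).le (th_lt_one hδ).le
  set HW : ℕ → ℝ := fun q => ∑ y ∈ Ico (q * 2 ^ k) ((q + 3) * 2 ^ k), h y ^ 2 * w y with hHW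
  set WW : ℕ → ℝ := fun q => ∑ y ∈ Ico (q * 2 ^ k) ((q + 3) * 2 ^ k), w y with hWW
  have hWWp : ∀ q, 0 < WW q := fun q => Finset.sum_pos (fun y _ => hwp y) (by
    rw [nonempty_Ico]; exact win_lt k q)
  have hHW0 : ∀ q, 0 ≤ HW q := fun q => Finset.sum_nonneg fun y _ => by
    have := hwp y; positivity
  set R : ℕ → ℝ := fun q => HW q / WW q with hR
  have hR0 : ∀ q, 0 ≤ R q := fun q => div_nonneg (hHW0 q) (hWWp q).le
  -- dE vanishes
  have hdE : ∀ x, dE k h x = 0 := by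
    intro x
    have : dE k h x = blk k h (x / 2 ^ k) / 2 ^ k := rfl
    rw [this]
    have e : ∀ q, blk k h q = 0 := by
      intro q
      rw [← blk_dE (Nat.succ_le_of_lt hm : m + 1 ≤ k)]
      refine Finset.sum_eq_zero fun t _ => ?_
      rw [dE, h0, zero_div]
    rw [e, zero_div]
  -- sub-interval bound
  have hsub : ∀ q, q < 2 ^ (J - k) → ∀ c d : ℕ, q * 2 ^ k ≤ c → c ≤ d → d ≤ (q + 3) * 2 ^ k →
      ∀ σ : ℝ, 0 ≤ σ → (((d : ℝ) - c) / (3 * 2 ^ k)) ^ δ ≤ σ ^ 2 →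
      ∑ y ∈ Ico c d, |h y| ≤ 3 * 2 ^ k * (σ * Real.sqrt (C * R q)) := by
    intro q hq c d h1 h2 h3 σ hσ hr
    have e := csw hw h h1 h2 h3 (win_bound hk.le hq) (win_lt k q)
    rw [win_len] at e
    apply le_of_sq_le_sq _ (by positivity)
    have hW := hWWp q
    rw [← mul_le_mul_iff_left₀ hW]
    calc _ ≤ _ := e
      _ ≤ HW q * (C * (σ ^ 2 * (3 * 2 ^ k) ^ 2)) := by
          have := hHW0 q
          gcongr
      _ = _ := by
          rw [mul_pow _ (σ * _), mul_pow σ, Real.sq_sqrt (mul_nonneg hC (hR0 q))]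
          have e9 : R q * WW q = HW q := div_mul_cancel₀ _ hW.ne'
          rw [← e9]; ring
  set b : ℕ → ℝ := fun x => 108 * C * s * R (x / 2 ^ k) with hb
  have hqx : ∀ x, x < 2 ^ J → x / 2 ^ k < 2 ^ (J - k) := by
    intro x hx
    rw [Nat.div_lt_iff_lt_mul (by positivity), ← pow_add, Nat.sub_add_cancel hk.le]; exact hx
  have hxl : ∀ x, x / 2 ^ k * 2 ^ k ≤ x := fun x => Nat.div_mul_le_self x _
  have hxu : ∀ x, x < (x / 2 ^ k) * 2 ^ k + 2 ^ k := fun x =>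
    Nat.lt_div_mul_add (by positivity)
  -- pointwise bound for averages
  have hP : ∀ x, x < 2 ^ J → ∀ i, 2 ^ k ≤ i → i < 2 ^ (k + 1) →
      |Mav i h x - 0| ≤ 6 * s * Real.sqrt (C * R (x / 2 ^ k)) := by
    intro x hx i hi1 hi2
    have hq := hqx x hx
    set q := x / 2 ^ k with hqd
    have hl : q * 2 ^ k ≤ x := hxl x
    have hu : x < q * 2 ^ k + 2 ^ k := hxu x
    have e3 : (q + 3) * 2 ^ k = q * 2 ^ k + 3 * 2 ^ k := by ring
    have e2 : 2 ^ (k + 1) = 2 * 2 ^ k := by ring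
    have pb : ∀ y, q * 2 ^ k ≤ y → y < (q + 3) * 2 ^ k →
        |∑ t ∈ range y, h t| ≤ 3 * 2 ^ k * (s * Real.sqrt (C * R q)) := by
      intro y hy1 hy2
      refine (initseg_le h0 y).trans ?_
      obtain ⟨al1, al2⟩ := align (j := m + 1) (Nat.succ_le_of_lt hm) hy1 hy2
      apply hsub q hq _ _ al1 (Nat.mul_le_mul_right _ (Nat.le_succ _)) al2 s hs0
      apply ratio_le hδ
      · push_cast
        apply div_nonneg _ (by positivity)
        ring_nf; positivity
      · push_cast
        rw [div_le_iff₀ (by positivity)]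
        have : (2 : ℝ) ^ k = 2 ^ (k - m) * 2 ^ m := by
          rw [← pow_add, Nat.sub_add_cancel hm.le]
        rw [this, one_div, inv_pow]
        have h2m : (0 : ℝ) < 2 ^ m := by positivity
        field_simp
        ring_nf
        nlinarith
    have key : ∑ t ∈ range (i + 1), h (x + t)
        = ∑ t ∈ range (x + (i + 1)), h t - ∑ t ∈ range x, h t := by
      have := Finset.sum_range_add h x (i + 1); linarith
    have p1 := pb x hl (by omega)
    have p2 := pb (x + (i + 1)) (by omega) (by omega)
    have hi' : ((2 : ℝ) ^ k) ≤ i := by exact_mod_cast hi1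
    rw [sub_zero, Mav, abs_div, abs_of_pos (by positivity : (0 : ℝ) < (i : ℝ) + 1),
      div_le_iff₀ (by positivity), key]
    have hX : 0 ≤ 6 * s * Real.sqrt (C * R q) := by positivity
    calc _ ≤ _ := abs_sub _ _
      _ ≤ 6 * s * Real.sqrt (C * R q) * 2 ^ k := by linarith
      _ ≤ _ := by gcongr; linarith
  have hV : ∀ x, x < 2 ^ J → (∑ t ∈ range (2 ^ (k + 1)), |h (x + t)|) / 2 ^ k
      ≤ 3 * Real.sqrt (C * R (x / 2 ^ k)) := by
    intro x hx
    have hq := hqx x hx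
    set q := x / 2 ^ k with hqd
    have hl : q * 2 ^ k ≤ x := hxl x
    have hu : x < q * 2 ^ k + 2 ^ k := hxu x
    have e3 : (q + 3) * 2 ^ k = q * 2 ^ k + 3 * 2 ^ k := by ring
    have e2 : 2 ^ (k + 1) = 2 * 2 ^ k := by ring
    have := hsub q hq (q * 2 ^ k) ((q + 3) * 2 ^ k) le_rfl (win_lt k q).le le_rfl 1 zero_le_one (by
      rw [win_len, div_self (by positivity)]; simp)
    rw [div_le_iff₀ (by positivity)]
    calc _ = ∑ y ∈ Ico x (x + 2 ^ (k + 1)), |h y| := by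
          rw [Finset.sum_Ico_eq_sum_range, Nat.add_sub_cancel_left]
      _ ≤ ∑ y ∈ Ico (q * 2 ^ k) ((q + 3) * 2 ^ k), |h y| :=
          Finset.sum_le_sum_of_subset_of_nonneg (Ico_subset_Ico hl (by omega))
            (fun _ _ _ => abs_nonneg _)
      _ ≤ _ := this
      _ = _ := by ring
  refine ⟨b, ?_, ?_, ?_⟩
  · intro x hx i hi1 hi2
    have := hP x hx i hi1 hi2
    rw [hdE, ← sq_abs]
    have hCR : 0 ≤ C * R (x / 2 ^ k) := mul_nonneg hC (hR0 _)
    calc _ ≤ (6 * s * Real.sqrt (C * R (x / 2 ^ k))) ^ 2 := by gcongr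
      _ = 36 * s * s * (C * R (x / 2 ^ k)) := by
          rw [mul_pow, Real.sq_sqrt hCR]; ring
      _ ≤ 36 * s * 1 * (C * R (x / 2 ^ k)) := by gcongr
      _ ≤ b x := by
          simp only [hb]; nlinarith [mul_nonneg hs0 hCR]
  · intro x hx
    have hCR : 0 ≤ C * R (x / 2 ^ k) := mul_nonneg hC (hR0 _)
    have := short_sq hn N k h x (hP x hx) (hV x hx) (by positivity)
    refine this.trans ?_
    have e := Real.mul_self_sqrt hCR
    simp only [hb]
    nlinarith [mul_nonneg hs0 hCR]
  · have e : 2 ^ J = 2 ^ (J - k) * 2 ^ k := by rw [← pow_add, Nat.sub_add_cancel hk.le]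
    have hwin := sum_windows hk.le (g := fun y => h y ^ 2 * w y)
      (fun y => by have := hwp y; positivity) (fun y hy => by simp [hz y hy])
    have : ∑ x ∈ range (2 ^ J), b x * w x ≤ ∑ q ∈ range (2 ^ (J - k)), 108 * C * s * HW q := by
      rw [e, sum_blocks]
      refine Finset.sum_le_sum fun q _ => ?_
      have h1 : ∀ t ∈ range (2 ^ k), b (q * 2 ^ k + t) * w (q * 2 ^ k + t)
          = 108 * C * s * R q * w (q * 2 ^ k + t) := by
        intro t ht
        simp only [hb]
        rw [div_blk (mem_range.1 ht)]
      rw [Finset.sum_congr rfl h1, ← Finset.mul_sum]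
      have h2 : ∑ t ∈ range (2 ^ k), w (q * 2 ^ k + t) ≤ WW q := by
        have b1 : 0 ≤ blk k w (q + 1) := Finset.sum_nonneg fun _ _ => (hwp _).le
        have b2 : 0 ≤ blk k w (q + 2) := Finset.sum_nonneg fun _ _ => (hwp _).le
        have : ∑ t ∈ range (2 ^ k), w (q * 2 ^ k + t) = blk k w q := rfl
        simp only [hWW]
        rw [win_eq, this]; linarith
      have hRq := hR0 q
      calc _ ≤ 108 * C * s * R q * WW q := by gcongr
        _ = _ := by
          simp only [hR]
          have := (hWWp q).ne'
          field_simp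
    refine this.trans ?_
    rw [← Finset.mul_sum]
    calc _ ≤ 108 * C * s * (3 * ∑ x ∈ range (2 ^ J), h x ^ 2 * w x) := by gcongr
      _ ≤ _ := by
        have : 0 ≤ ∑ x ∈ range (2 ^ J), h x ^ 2 * w x :=
          Finset.sum_nonneg fun y _ => by have := hwp y; positivity
        nlinarith [mul_nonneg (mul_nonneg hC hs0) this]

end QME

namespace QME

lemma block_coarse {J k m : ℕ} {w : ℕ → ℝ} {C δ : ℝ} (hC : 0 ≤ C) (hδ : 0 < δ)
    (hw : WH (2 ^ (J + 2)) w C δ) (hm : k ≤ m) (hmJ : m ≤ J) {h : ℕ → ℝ}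
    (hg : ∀ x y, x / 2 ^ m = y / 2 ^ m → h x = h y) (hz : ∀ x, 2 ^ J ≤ x → h x = 0)
    {n : ℕ → ℕ} (hn : StrictMono n) (N : ℕ) :
    ∃ b : ℕ → ℝ, (∀ x, x < 2 ^ J → ∀ i, 2 ^ k ≤ i → i < 2 ^ (k + 1) →
        (Mav i h x - dE k h x) ^ 2 ≤ b x) ∧
      (∀ x, x < 2 ^ J →
        ∑ i ∈ (range N).filter (fun i => (2 ^ k ≤ n i ∧ n (i + 1) < 2 ^ (k + 1))),
          (Mav (n i) h x - Mav (n (i + 1)) h x) ^ 2 ≤ b x) ∧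
      ∑ x ∈ range (2 ^ J), b x * w x
        ≤ 648 * C * th δ ^ (2 * (m - k)) * ∑ x ∈ range (2 ^ J), h x ^ 2 * w x := by
  classical
  have hwp := hw.1
  set s := th δ ^ (2 * (m - k)) with hs
  have hs0 : 0 ≤ s := pow_nonneg (th_pos δ).le _
  have hs1 : s ≤ 1 := pow_le_one₀ (th_pos δ).le (th_lt_one hδ).le
  set HW : ℕ → ℝ := fun q => ∑ y ∈ Ico (q * 2 ^ m) ((q + 3) * 2 ^ m), h y ^ 2 * w y with hHW
  set WI : ℕ → ℝ := fun q => ∑ y ∈ Ico (q * 2 ^ m) ((q + 3) * 2 ^ m), (w y)⁻¹ with hWI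
  set H : ℕ → ℝ := fun q => (∑ y ∈ Ico (q * 2 ^ m) ((q + 3) * 2 ^ m), |h y|) / 2 ^ m with hH
  have hH0 : ∀ q, 0 ≤ H q := fun q => by simp only [hH]; positivity
  have hHW0 : ∀ q, 0 ≤ HW q := fun q => Finset.sum_nonneg fun y _ => by
    have := hwp y; positivity
  have hpos : 0 < 2 ^ m := by positivity
  have hkm : 2 ^ k ≤ 2 ^ m := Nat.pow_le_pow_right (by norm_num) hm
  have e2 : 2 ^ (k + 1) = 2 * 2 ^ k := by ring
  have hH2 : ∀ q, H q ^ 2 * (2 ^ m) ^ 2 ≤ HW q * WI q := by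
    intro q
    have : H q ^ 2 * (2 ^ m) ^ 2 = (∑ y ∈ Ico (q * 2 ^ m) ((q + 3) * 2 ^ m), |h y|) ^ 2 := by
      simp only [hH]; field_simp
    rw [this]
    apply Finset.sum_sq_le_sum_mul_sum_of_sq_le_mul
    · intro i _; have := hwp i; positivity
    · intro i _; have := hwp i; positivity
    · intro i _; rw [sq_abs]; exact le_of_eq (by field_simp [(hwp i).ne'])
  -- pointwise
  have hy : ∀ q y, q * 2 ^ m ≤ y → y < (q + 3) * 2 ^ m → |h y| ≤ H q := by
    intro q y h1 h2
    obtain ⟨a1, a2⟩ := align (j := m) le_rfl h1 h2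
    simp only [hH]
    rw [le_div_iff₀ (by positivity)]
    calc |h y| * 2 ^ m = ∑ z ∈ Ico (y / 2 ^ m * 2 ^ m) ((y / 2 ^ m + 1) * 2 ^ m), |h z| := by
          rw [← blk_eq_Ico m (fun z => |h z|), blk]
          rw [Finset.sum_congr rfl (g := fun _ => |h y|)]
          · simp [mul_comm]
          · intro t ht
            rw [hg _ y (div_blk (mem_range.1 ht))]
      _ ≤ _ := Finset.sum_le_sum_of_subset_of_nonneg (Ico_subset_Ico a1 a2)
            (fun _ _ _ => abs_nonneg _)
  have hdE : ∀ x, dE k h x = h x := by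
    intro x
    rw [dE, blk, Finset.sum_congr rfl (g := fun _ => h x)]
    · simp
    · intro t ht
      apply hg
      rw [div_div_pow hm, div_div_pow hm, div_blk (mem_range.1 ht)]
  have hxl : ∀ x, x / 2 ^ m * 2 ^ m ≤ x := fun x => Nat.div_mul_le_self x _
  have hxu : ∀ x, x < (x / 2 ^ m) * 2 ^ m + 2 ^ m := fun x =>
    Nat.lt_div_mul_add (by positivity)
  have e1 : ∀ q, (q + 1) * 2 ^ m = q * 2 ^ m + 2 ^ m := fun q => by ring
  have e3 : ∀ q, (q + 3) * 2 ^ m = q * 2 ^ m + 3 * 2 ^ m := fun q => by ring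
  set b : ℕ → ℝ := fun x => if x + 2 ^ (k + 1) ≤ (x / 2 ^ m + 1) * 2 ^ m then 0 else
    24 * H (x / 2 ^ m) ^ 2 with hb
  have hb0 : ∀ x, 0 ≤ b x := fun x => by simp only [hb]; split_ifs <;> positivity
  have hV : ∀ x, (∑ t ∈ range (2 ^ (k + 1)), |h (x + t)|) / 2 ^ k ≤ 2 * H (x / 2 ^ m) := by
    intro x
    have := hxl x; have := hxu x; have := e3 (x / 2 ^ m)
    rw [div_le_iff₀ (by positivity)]
    calc _ ≤ ∑ t ∈ range (2 ^ (k + 1)), H (x / 2 ^ m) := by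
          refine Finset.sum_le_sum fun t ht => hy _ _ ?_ ?_
          · omega
          · have := mem_range.1 ht; omega
      _ = _ := by simp; ring
  have hP : ∀ x, ∀ i, 2 ^ k ≤ i → i < 2 ^ (k + 1) →
      |Mav i h x - dE k h x| ≤ 3 * H (x / 2 ^ m) := by
    intro x i hi1 hi2
    have := hxl x; have := hxu x; have := e3 (x / 2 ^ m)
    have a1 := (abs_Mav_le h x hi1 hi2).trans (hV x)
    have a2 := hy (x / 2 ^ m) x (hxl x) (by omega)
    rw [hdE]
    have a3 := abs_sub (Mav i h x) (h x)
    linarith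
  have hne : ∀ x, x + 2 ^ (k + 1) ≤ (x / 2 ^ m + 1) * 2 ^ m → ∀ i, i < 2 ^ (k + 1) →
      Mav i h x = h x := by
    intro x hx i hi
    have := hxl x; have := e1 (x / 2 ^ m)
    rw [Mav, Finset.sum_congr rfl (g := fun _ => h x)]
    · simp
      rw [mul_comm, mul_div_assoc, div_self (by positivity), mul_one]
    · intro t ht
      have := mem_range.1 ht
      apply hg
      rw [Nat.div_eq_iff hpos]
      constructor
      · omega
      · omega
  refine ⟨b, ?_, ?_, ?_⟩
  · intro x hx i hi1 hi2
    by_cases hE : x + 2 ^ (k + 1) ≤ (x / 2 ^ m + 1) * 2 ^ m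
    · rw [hne x hE i hi2, hdE]; simpa using hb0 x
    · simp only [hb, if_neg hE]
      have := hP x i hi1 hi2
      have h0 := hH0 (x / 2 ^ m)
      rw [← sq_abs]
      calc _ ≤ (3 * H (x / 2 ^ m)) ^ 2 := by gcongr
        _ ≤ _ := by nlinarith [sq_nonneg (H (x / 2 ^ m))]
  · intro x hx
    by_cases hE : x + 2 ^ (k + 1) ≤ (x / 2 ^ m + 1) * 2 ^ m
    · refine le_trans (le_of_eq ?_) (hb0 x)
      refine Finset.sum_eq_zero fun i hi => ?_
      rw [mem_filter] at hi
      have hlt := hn (Nat.lt_add_one i)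
      rw [hne x hE _ (by omega), hne x hE _ hi.2.2, sub_self]; norm_num
    · have h0 := hH0 (x / 2 ^ m)
      have := short_sq hn N k h x (hP x) (hV x) (by positivity)
      simp only [hb, if_neg hE]
      refine this.trans (le_of_eq (by ring))
  · have e : 2 ^ J = 2 ^ (J - m) * 2 ^ m := by rw [← pow_add, Nat.sub_add_cancel hmJ]
    have hwin := sum_windows hmJ (g := fun y => h y ^ 2 * w y)
      (fun y => by have := hwp y; positivity) (fun y hy => by simp [hz y hy])
    have : ∑ x ∈ range (2 ^ J), b x * w x ≤ ∑ q ∈ range (2 ^ (J - m)), 216 * C * s * HW q := by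
      rw [e, sum_blocks]
      refine Finset.sum_le_sum fun q hq => ?_
      have hq := mem_range.1 hq
      set c := max (q * 2 ^ m) ((q + 1) * 2 ^ m - 2 ^ (k + 1)) with hc
      have e1q := e1 q
      have e3q := e3 q
      have hcl : q * 2 ^ m ≤ c := le_max_left _ _
      have hcd : c ≤ (q + 1) * 2 ^ m := by omega
      have hlen : (q + 1) * 2 ^ m ≤ c + 2 ^ (k + 1) := by omega
      have h1 : ∑ t ∈ range (2 ^ m), b (q * 2 ^ m + t) * w (q * 2 ^ m + t)
          ≤ 24 * H q ^ 2 * ∑ y ∈ Ico c ((q + 1) * 2 ^ m), w y := by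
        have : ∑ t ∈ range (2 ^ m), b (q * 2 ^ m + t) * w (q * 2 ^ m + t)
          = blk m (fun y => b y * w y) q := rfl
        rw [this, blk_eq_Ico, ← Finset.sum_Ico_consecutive _ hcl hcd, Finset.mul_sum]
        have hdiv : ∀ y, q * 2 ^ m ≤ y → y < (q + 1) * 2 ^ m → y / 2 ^ m = q := by
          intro y ha hb'
          rw [Nat.div_eq_iff hpos]; constructor <;> omega
        rw [Finset.sum_eq_zero, zero_add]
        · refine Finset.sum_le_sum fun y hy => ?_
          rw [mem_Ico] at hy
          have := hdiv y (by omega) (by omega)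
          have := (hwp y).le
          gcongr
          simp only [hb]
          split_ifs
          · positivity
          · rw [hdiv y (by omega) (by omega)]
        · intro y hy
          rw [mem_Ico] at hy
          simp only [hb]
          rw [hdiv y (by omega) (by omega), if_pos (by omega), zero_mul]
      refine h1.trans ?_
      have hwh := hw.2.1 (q * 2 ^ m) c ((q + 1) * 2 ^ m) ((q + 3) * 2 ^ m) hcl hcd (by omega)
        (win_bound hmJ hq) (win_lt m q)
      rw [win_len] at hwh
      have hcd' : (c : ℝ) ≤ (((q + 1) * 2 ^ m : ℕ) : ℝ) := by exact_mod_cast hcd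
      have hlen' : (((q + 1) * 2 ^ m : ℕ) : ℝ) ≤ c + 2 * 2 ^ k := by
        have : (((q + 1) * 2 ^ m : ℕ) : ℝ) ≤ ((c + 2 ^ (k + 1) : ℕ) : ℝ) := by exact_mod_cast hlen
        refine this.trans (le_of_eq ?_)
        push_cast; ring
      have hr : (((((q + 1) * 2 ^ m : ℕ) : ℝ) - c) / (3 * 2 ^ m)) ^ δ ≤ s ^ 2 := by
        apply ratio_le hδ
        · apply div_nonneg (by linarith) (by positivity)
        · rw [div_le_iff₀ (by positivity)]
          have : (2 : ℝ) ^ m = 2 ^ (m - k) * 2 ^ k := by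
            rw [← pow_add, Nat.sub_add_cancel hm]
          rw [this, one_div, inv_pow]
          have h2m : (0 : ℝ) < 2 ^ k := by positivity
          have : ((2 : ℝ) ^ (m - k))⁻¹ * (3 * (2 ^ (m - k) * 2 ^ k)) = 3 * 2 ^ k := by
            field_simp
          rw [this]; linarith
      have hE0 : 0 ≤ ∑ y ∈ Ico c ((q + 1) * 2 ^ m), w y := Finset.sum_nonneg fun y _ => (hwp y).le
      have hmp : (0 : ℝ) < (2 ^ m) ^ 2 := by positivity
      have hHWq := hHW0 q
      rw [← mul_le_mul_iff_left₀ hmp]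
      calc _ = 24 * (H q ^ 2 * (2 ^ m) ^ 2) * ∑ y ∈ Ico c ((q + 1) * 2 ^ m), w y := by ring
        _ ≤ 24 * (HW q * WI q) * ∑ y ∈ Ico c ((q + 1) * 2 ^ m), w y := by
            have := hH2 q
            gcongr
        _ = 24 * HW q * ((∑ y ∈ Ico c ((q + 1) * 2 ^ m), w y) * WI q) := by ring
        _ ≤ 24 * HW q * (C * (s ^ 2 * (3 * 2 ^ m) ^ 2)) := by
            apply mul_le_mul_of_nonneg_left _ (by positivity)
            exact hwh.trans (by gcongr)
        _ = 216 * C * s * HW q * (2 ^ m) ^ 2 * s := by ring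
        _ ≤ 216 * C * s * HW q * (2 ^ m) ^ 2 * 1 := by gcongr
        _ = _ := by ring
    refine this.trans ?_
    rw [← Finset.mul_sum]
    calc _ ≤ 216 * C * s * (3 * ∑ x ∈ range (2 ^ J), h x ^ 2 * w x) := by gcongr
      _ = _ := by ring

end QME

namespace QME

lemma geo_inj {θ : ℝ} (h0 : 0 ≤ θ) (h1 : θ < 1) (S : Finset ℕ) (e : ℕ → ℕ) (he : Set.InjOn e S) :
    ∑ m ∈ S, θ ^ e m ≤ (1 - θ)⁻¹ := by
  rw [← Finset.sum_image (f := fun j => θ ^ j) he, ← tsum_geometric_of_lt_one h0 h1]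
  exact (summable_geometric_of_lt_one h0 h1).sum_le_tsum _ (fun _ _ => by positivity)

/-- distance -/
def nd (k m : ℕ) : ℕ := (k - m) + (m - k)

lemma nd_comm (k m : ℕ) : nd k m = nd m k := by unfold nd; omega

lemma geo_nd {θ : ℝ} (h0 : 0 ≤ θ) (h1 : θ < 1) (M k : ℕ) :
    ∑ m ∈ range M, θ ^ nd k m ≤ 2 * (1 - θ)⁻¹ := by
  rw [← Finset.sum_filter_add_sum_filter_not (range M) (fun m => m ≤ k), two_mul]
  apply add_le_add
  · apply geo_inj h0 h1
    intro a ha b hb hab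
    simp [nd] at *; omega
  · apply geo_inj h0 h1
    intro a ha b hb hab
    simp [nd] at *; omega

lemma block_all {J k m : ℕ} {w : ℕ → ℝ} {C δ : ℝ} (hC : 0 ≤ C) (hδ : 0 < δ)
    (hw : WH (2 ^ (J + 2)) w C δ) (hk : k < J) (hm : m ≤ J) {f : ℕ → ℝ}
    (hz : ∀ x, 2 ^ J ≤ x → f x = 0)
    {n : ℕ → ℕ} (hn : StrictMono n) (N : ℕ) :
    ∃ b : ℕ → ℝ, (∀ x, x < 2 ^ J → ∀ i, 2 ^ k ≤ i → i < 2 ^ (k + 1) →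
        (Mav i (pc J f m) x - dE k (pc J f m) x) ^ 2 ≤ b x) ∧
      (∀ x, x < 2 ^ J →
        ∑ i ∈ (range N).filter (fun i => (2 ^ k ≤ n i ∧ n (i + 1) < 2 ^ (k + 1))),
          (Mav (n i) (pc J f m) x - Mav (n (i + 1)) (pc J f m) x) ^ 2 ≤ b x) ∧
      ∑ x ∈ range (2 ^ J), b x * w x
        ≤ 648 * C * th δ ^ (2 * nd k m) * ∑ x ∈ range (2 ^ J), pc J f m x ^ 2 * w x := by
  have hzz : ∀ x, 2 ^ J ≤ x → pc J f m x = 0 := fun x hx => pc_zero hm hz hx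
  rcases lt_or_ge m k with h | h
  · obtain ⟨b, h1, h2, h3⟩ := block_fine hC hδ hw hk h (fun q => blk_pc (h.trans hk) f q) hzz hn N
    refine ⟨b, h1, h2, h3.trans ?_⟩
    have : nd k m = k - m := by unfold nd; omega
    rw [this]
    have hS : 0 ≤ ∑ x ∈ range (2 ^ J), pc J f m x ^ 2 * w x :=
          Finset.sum_nonneg fun y _ => by have := hw.1 y; positivity
    have := (th_pos δ).le
    gcongr
    norm_num
  · obtain ⟨b, h1, h2, h3⟩ := block_coarse hC hδ hw h hm (fun x y hxy => pc_congr hm f hxy) hzz hn N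
    refine ⟨b, h1, h2, h3.trans ?_⟩
    have : nd k m = m - k := by unfold nd; omega
    rw [this]

lemma cs_geo {θ : ℝ} (h0 : 0 < θ) (h1 : θ < 1) (M k : ℕ) (a : ℕ → ℝ) :
    (∑ m ∈ range M, a m) ^ 2 ≤ 2 * (1 - θ)⁻¹ * ∑ m ∈ range M, (θ ^ nd k m)⁻¹ * a m ^ 2 := by
  have : (∑ m ∈ range M, a m) ^ 2 ≤ (∑ m ∈ range M, θ ^ nd k m) *
      ∑ m ∈ range M, (θ ^ nd k m)⁻¹ * a m ^ 2 := by
    apply Finset.sum_sq_le_sum_mul_sum_of_sq_le_mul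
    · intro i _; positivity
    · intro i _; positivity
    · intro i _; exact le_of_eq (by field_simp)
  refine this.trans ?_
  have := geo_nd h0.le h1 M k
  gcongr

/-- constant -/
noncomputable def cW (_C δ : ℝ) : ℝ := 2 * (1 - th δ)⁻¹

lemma scale_bound {J k : ℕ} {w : ℕ → ℝ} {C δ : ℝ} (hC : 0 ≤ C) (hδ : 0 < δ)
    (hw : WH (2 ^ (J + 2)) w C δ) (hk : k < J) {f : ℕ → ℝ}
    (hz : ∀ x, 2 ^ J ≤ x → f x = 0)
    {n : ℕ → ℕ} (hn : StrictMono n) (N : ℕ) :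
    ∃ B : ℕ → ℝ, (∀ x, x < 2 ^ J → ∀ i, 2 ^ k ≤ i → i < 2 ^ (k + 1) →
        (Mav i f x - dE k f x) ^ 2 ≤ B x) ∧
      (∀ x, x < 2 ^ J →
        ∑ i ∈ (range N).filter (fun i => (2 ^ k ≤ n i ∧ n (i + 1) < 2 ^ (k + 1))),
          (Mav (n i) f x - Mav (n (i + 1)) f x) ^ 2 ≤ B x) ∧
      ∑ x ∈ range (2 ^ J), B x * w x
        ≤ cW C δ * (648 * C) * ∑ m ∈ range (J + 1), th δ ^ nd k m *
          ∑ x ∈ range (2 ^ J), pc J f m x ^ 2 * w x := by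
  have hθ := th_pos δ
  have hθ1 := th_lt_one hδ
  have hcW : 0 ≤ cW C δ := by unfold cW; have : 0 < 1 - th δ := by linarith
                              positivity
  have : ∀ m, ∃ b : ℕ → ℝ, m ≤ J → (∀ x, x < 2 ^ J → ∀ i, 2 ^ k ≤ i → i < 2 ^ (k + 1) →
        (Mav i (pc J f m) x - dE k (pc J f m) x) ^ 2 ≤ b x) ∧
      (∀ x, x < 2 ^ J →
        ∑ i ∈ (range N).filter (fun i => (2 ^ k ≤ n i ∧ n (i + 1) < 2 ^ (k + 1))),
          (Mav (n i) (pc J f m) x - Mav (n (i + 1)) (pc J f m) x) ^ 2 ≤ b x) ∧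
      ∑ x ∈ range (2 ^ J), b x * w x
        ≤ 648 * C * th δ ^ (2 * nd k m) * ∑ x ∈ range (2 ^ J), pc J f m x ^ 2 * w x := by
    intro m
    by_cases hm : m ≤ J
    · obtain ⟨b, hb⟩ := block_all hC hδ hw hk hm hz hn N
      exact ⟨b, fun _ => hb⟩
    · exact ⟨0, fun h => absurd h hm⟩
  choose b hb using this
  have hfe : f = fun x => ∑ m ∈ range (J + 1), pc J f m x := by
    funext x; rw [sum_pc]
  have hM : ∀ i x, Mav i f x = ∑ m ∈ range (J + 1), Mav i (pc J f m) x := by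
    intro i x
    conv_lhs => rw [hfe]
    rw [Mav_sum]
  have hD : ∀ i x, dE i f x = ∑ m ∈ range (J + 1), dE i (pc J f m) x := by
    intro i x
    conv_lhs => rw [hfe]
    rw [dE_sum]
  refine ⟨fun x => cW C δ * ∑ m ∈ range (J + 1), (th δ ^ nd k m)⁻¹ * b m x, ?_, ?_, ?_⟩
  · intro x hx i h1 h2
    rw [hM, hD, ← Finset.sum_sub_distrib]
    refine (cs_geo hθ hθ1 (J + 1) k _).trans ?_
    apply mul_le_mul_of_nonneg_left _ hcW
    refine Finset.sum_le_sum fun m hm => ?_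
    have := (hb m (by have := mem_range.1 hm; omega)).1 x hx i h1 h2
    gcongr
  · intro x hx
    calc _ ≤ ∑ i ∈ (range N).filter (fun i => (2 ^ k ≤ n i ∧ n (i + 1) < 2 ^ (k + 1))),
          cW C δ * ∑ m ∈ range (J + 1), (th δ ^ nd k m)⁻¹ *
            (Mav (n i) (pc J f m) x - Mav (n (i + 1)) (pc J f m) x) ^ 2 := by
          refine Finset.sum_le_sum fun i _ => ?_
          rw [hM, hM, ← Finset.sum_sub_distrib]
          exact cs_geo hθ hθ1 (J + 1) k _
      _ = cW C δ * ∑ m ∈ range (J + 1), (th δ ^ nd k m)⁻¹ *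
          ∑ i ∈ (range N).filter (fun i => (2 ^ k ≤ n i ∧ n (i + 1) < 2 ^ (k + 1))),
            (Mav (n i) (pc J f m) x - Mav (n (i + 1)) (pc J f m) x) ^ 2 := by
          rw [← Finset.mul_sum, Finset.sum_comm]
          simp only [Finset.mul_sum]
      _ ≤ _ := by
          apply mul_le_mul_of_nonneg_left _ hcW
          refine Finset.sum_le_sum fun m hm => ?_
          have := (hb m (by have := mem_range.1 hm; omega)).2.1 x hx
          gcongr
  · calc _ = cW C δ * ∑ m ∈ range (J + 1), (th δ ^ nd k m)⁻¹ *
          ∑ x ∈ range (2 ^ J), b m x * w x := by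
          simp only [Finset.mul_sum, Finset.sum_mul]
          rw [Finset.sum_comm]
          refine Finset.sum_congr rfl fun _ _ => Finset.sum_congr rfl fun _ _ => by ring
      _ ≤ cW C δ * ∑ m ∈ range (J + 1), (th δ ^ nd k m)⁻¹ *
          (648 * C * th δ ^ (2 * nd k m) * ∑ x ∈ range (2 ^ J), pc J f m x ^ 2 * w x) := by
          apply mul_le_mul_of_nonneg_left _ hcW
          refine Finset.sum_le_sum fun m hm => ?_
          have := (hb m (by have := mem_range.1 hm; omega)).2.2
          gcongr
      _ = _ := by
          rw [mul_assoc, Finset.mul_sum (a := 648 * C)]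
          congr 1
          refine Finset.sum_congr rfl fun m _ => ?_
          rw [two_mul, pow_add]
          field_simp

/-- the difference between ergodic and dyadic averages -/
noncomputable def Gd (f : ℕ → ℝ) (n x : ℕ) : ℝ := Mav n f x - dE (Nat.log 2 n) f x

lemma G_bound {J : ℕ} {w : ℕ → ℝ} {C δ : ℝ} (hC : 0 ≤ C) (hδ : 0 < δ)
    (hw : WH (2 ^ (J + 2)) w C δ) {f : ℕ → ℝ}
    (hz : ∀ x, 2 ^ J ≤ x → f x = 0)
    {n : ℕ → ℕ} (hn : StrictMono n) (hn0 : ∀ i, 0 < n i) (N : ℕ) (hN : n N < 2 ^ J) :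
    ∑ x ∈ range (2 ^ J), (∑ i ∈ range N, (Gd f (n i) x - Gd f (n (i + 1)) x) ^ 2) * w x
      ≤ 5 * (cW C δ * (648 * C) * cW C δ) * ∑ m ∈ range (J + 1),
        ∑ x ∈ range (2 ^ J), pc J f m x ^ 2 * w x := by
  classical
  have hθ := th_pos δ
  have hθ1 := th_lt_one hδ
  have hcW : 0 ≤ cW C δ := by unfold cW; have : 0 < 1 - th δ := by linarith
                              positivity
  have : ∀ k, ∃ B : ℕ → ℝ, k < J → (∀ x, x < 2 ^ J → ∀ i, 2 ^ k ≤ i → i < 2 ^ (k + 1) →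
        (Mav i f x - dE k f x) ^ 2 ≤ B x) ∧
      (∀ x, x < 2 ^ J →
        ∑ i ∈ (range N).filter (fun i => (2 ^ k ≤ n i ∧ n (i + 1) < 2 ^ (k + 1))),
          (Mav (n i) f x - Mav (n (i + 1)) f x) ^ 2 ≤ B x) ∧
      ∑ x ∈ range (2 ^ J), B x * w x
        ≤ cW C δ * (648 * C) * ∑ m ∈ range (J + 1), th δ ^ nd k m *
          ∑ x ∈ range (2 ^ J), pc J f m x ^ 2 * w x := by
    intro k
    by_cases hk : k < J
    · obtain ⟨b, hb⟩ := scale_bound hC hδ hw hk hz hn N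
      exact ⟨b, fun _ => hb⟩
    · exact ⟨0, fun h => absurd h hk⟩
  choose B hB using this
  have hlow : ∀ i, 2 ^ Nat.log 2 (n i) ≤ n i := fun i => Nat.pow_log_le_self 2 (hn0 i).ne'
  have hup : ∀ i, n i < 2 ^ (Nat.log 2 (n i) + 1) := fun i => Nat.lt_pow_succ_log_self (by norm_num) _
  have hlogJ : ∀ i, i ≤ N → Nat.log 2 (n i) < J := fun i hi =>
    Nat.log_lt_of_lt_pow (hn0 i).ne' (lt_of_le_of_lt (hn.monotone hi) hN)
  have hmono : ∀ i j, i ≤ j → Nat.log 2 (n i) ≤ Nat.log 2 (n j) := fun i j hij =>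
    Nat.log_mono_right (hn.monotone hij)
  have hG : ∀ x, x < 2 ^ J → ∀ i, i ≤ N → Gd f (n i) x ^ 2 ≤ B (Nat.log 2 (n i)) x := by
    intro x hx i hi
    exact (hB _ (hlogJ i hi)).1 x hx (n i) (hlow i) (hup i)
  have hB0 : ∀ x, x < 2 ^ J → ∀ k, k < J → 0 ≤ B k x := by
    intro x hx k hk
    refine le_trans ?_ ((hB k hk).2.1 x hx)
    exact Finset.sum_nonneg fun _ _ => sq_nonneg _
  have hpt : ∀ x, x < 2 ^ J → ∑ i ∈ range N, (Gd f (n i) x - Gd f (n (i + 1)) x) ^ 2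
      ≤ 5 * ∑ k ∈ range J, B k x := by
    intro x hx
    rw [← Finset.sum_filter_add_sum_filter_not (range N)
      (fun i => Nat.log 2 (n i) = Nat.log 2 (n (i + 1)))]
    have hS : ∑ i ∈ (range N).filter (fun i => Nat.log 2 (n i) = Nat.log 2 (n (i + 1))),
        (Gd f (n i) x - Gd f (n (i + 1)) x) ^ 2 ≤ ∑ k ∈ range J, B k x := by
      rw [← Finset.sum_fiberwise_of_maps_to (t := range J) (g := fun i => Nat.log 2 (n i))]
      · refine Finset.sum_le_sum fun k hk => ?_
        refine le_trans ?_ ((hB k (mem_range.1 hk)).2.1 x hx)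
        rw [Finset.filter_filter]
        calc _ = ∑ i ∈ (range N).filter (fun i => Nat.log 2 (n i) = Nat.log 2 (n (i + 1)) ∧
              Nat.log 2 (n i) = k), (Mav (n i) f x - Mav (n (i + 1)) f x) ^ 2 := by
              refine Finset.sum_congr rfl fun i hi => ?_
              rw [mem_filter] at hi
              simp only [Gd]
              rw [hi.2.1]; ring
          _ ≤ _ := by
              apply Finset.sum_le_sum_of_subset_of_nonneg
              · intro i hi
                rw [mem_filter] at hi ⊢
                obtain ⟨h1, h2, h3⟩ := hi
                refine ⟨h1, ?_, ?_⟩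
                · rw [← h3]; exact hlow i
                · rw [← h3, h2]; exact hup (i + 1)
              · intros; positivity
      · intro i hi
        rw [mem_filter] at hi
        have := mem_range.1 hi.1
        simpa using hlogJ i (by omega)
    have hLinj : ∀ e : ℕ → ℕ, (∀ i, i < N → e i < J) →
        (Set.InjOn e ((range N).filter (fun i => ¬ Nat.log 2 (n i) = Nat.log 2 (n (i + 1))))) →
        ∑ i ∈ (range N).filter (fun i => ¬ Nat.log 2 (n i) = Nat.log 2 (n (i + 1))), B (e i) x
          ≤ ∑ k ∈ range J, B k x := by
      intro e he hinj
      rw [← Finset.sum_image (f := fun k => B k x) hinj]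
      apply Finset.sum_le_sum_of_subset_of_nonneg
      · intro k hk
        rw [mem_image] at hk
        obtain ⟨i, hi, rfl⟩ := hk
        rw [mem_filter, mem_range] at hi
        exact mem_range.2 (he i hi.1)
      · intro k hk _
        exact hB0 x hx k (mem_range.1 hk)
    have hstep : ∀ i j, i < j → Nat.log 2 (n (i + 1)) ≤ Nat.log 2 (n j) := fun i j h =>
      hmono _ _ h
    have hL1 := hLinj (fun i => Nat.log 2 (n i)) (fun i hi => hlogJ i hi.le) (by
      intro i hi j hj hij
      simp only [coe_filter, mem_range, Set.mem_ofPred_eq] at hi hj hij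
      rcases lt_trichotomy i j with h | h | h
      · have := hstep i j h; have := hmono i (i + 1) (by omega); omega
      · exact h
      · have := hstep j i h; have := hmono j (j + 1) (by omega); omega)
    have hL2 := hLinj (fun i => Nat.log 2 (n (i + 1))) (fun i hi => hlogJ (i + 1) hi) (by
      intro i hi j hj hij
      simp only [coe_filter, mem_range, Set.mem_ofPred_eq] at hi hj hij
      rcases lt_trichotomy i j with h | h | h
      · have := hstep i j h; have := hmono j (j + 1) (by omega); omega
      · exact h
      · have := hstep j i h; have := hmono i (i + 1) (by omega); omega)
    have hL : ∑ i ∈ (range N).filter (fun i => ¬ Nat.log 2 (n i) = Nat.log 2 (n (i + 1))),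
        (Gd f (n i) x - Gd f (n (i + 1)) x) ^ 2
        ≤ ∑ i ∈ (range N).filter (fun i => ¬ Nat.log 2 (n i) = Nat.log 2 (n (i + 1))),
          (2 * B (Nat.log 2 (n i)) x + 2 * B (Nat.log 2 (n (i + 1))) x) := by
      refine Finset.sum_le_sum fun i hi => ?_
      rw [mem_filter, mem_range] at hi
      have a1 := hG x hx i hi.1.le
      have a2 := hG x hx (i + 1) hi.1
      nlinarith [sq_nonneg (Gd f (n i) x + Gd f (n (i + 1)) x)]
    rw [Finset.sum_add_distrib, ← Finset.mul_sum, ← Finset.mul_sum] at hL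
    linarith
  have hS0 : ∀ m, 0 ≤ ∑ x ∈ range (2 ^ J), pc J f m x ^ 2 * w x := fun m =>
    Finset.sum_nonneg fun y _ => by have := hw.1 y; positivity
  calc _ ≤ ∑ x ∈ range (2 ^ J), (5 * ∑ k ∈ range J, B k x) * w x := by
        refine Finset.sum_le_sum fun x hx => ?_
        exact mul_le_mul_of_nonneg_right (hpt x (mem_range.1 hx)) (hw.1 x).le
    _ = 5 * ∑ k ∈ range J, ∑ x ∈ range (2 ^ J), B k x * w x := by
        rw [Finset.sum_comm, Finset.mul_sum]
        refine Finset.sum_congr rfl fun x _ => ?_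
        rw [mul_assoc, Finset.sum_mul]
    _ ≤ 5 * ∑ k ∈ range J, (cW C δ * (648 * C) * ∑ m ∈ range (J + 1), th δ ^ nd k m *
          ∑ x ∈ range (2 ^ J), pc J f m x ^ 2 * w x) := by
        gcongr with k hk
        exact (hB k (mem_range.1 hk)).2.2
    _ = 5 * (cW C δ * (648 * C)) * ∑ m ∈ range (J + 1), (∑ k ∈ range J, th δ ^ nd m k) *
          ∑ x ∈ range (2 ^ J), pc J f m x ^ 2 * w x := by
        rw [← Finset.mul_sum, Finset.sum_comm, ← mul_assoc]
        congr 1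
        refine Finset.sum_congr rfl fun m _ => ?_
        rw [Finset.sum_mul]
        refine Finset.sum_congr rfl fun k _ => ?_
        rw [nd_comm]
    _ ≤ 5 * (cW C δ * (648 * C)) * ∑ m ∈ range (J + 1), cW C δ *
          ∑ x ∈ range (2 ^ J), pc J f m x ^ 2 * w x := by
        gcongr with m hm
        · exact hS0 m
        · exact geo_nd hθ.le hθ1 J m
    _ = _ := by rw [← Finset.mul_sum]; ring

end QME

namespace QME

lemma sum_dE_grid {j k J : ℕ} (hjk : j ≤ k) (hk : k ≤ J) (f ψ : ℕ → ℝ)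
    (hψ : ∀ x y, x / 2 ^ k = y / 2 ^ k → ψ x = ψ y) :
    ∑ x ∈ range (2 ^ J), ψ x * dE j f x = ∑ x ∈ range (2 ^ J), ψ x * f x := by
  have h := sum_dE hjk hk f (fun q => ψ (q * 2 ^ k))
  have e : ∀ x, ψ (x / 2 ^ k * 2 ^ k) = ψ x := fun x => hψ _ _ (by
    rw [Nat.mul_div_cancel _ (by positivity)])
  simpa only [e] using h

lemma mart_high {J : ℕ} {f g w : ℕ → ℝ} {C1 : ℝ} (hf : ∀ x, 0 ≤ f x) (hw : ∀ x, 0 < w x)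
    (hg : ∀ x, x < 2 ^ J → ∀ k, k ≤ J → dE k f x ≤ g x)
    (hC : ∀ x, x < 2 ^ J → ∀ k, k ≤ J → dE k w x ≤ C1 * w x) :
    ∀ (N : ℕ) (K : ℕ → ℕ), Monotone K → K N ≤ J → ∃ U : ℕ → ℝ,
      (∀ x y, x / 2 ^ K 0 = y / 2 ^ K 0 → U x = U y) ∧
      (∀ x, x < 2 ^ J → 0 ≤ U x ∧ U x ≤ C1 * w x) ∧
      ∑ i ∈ range N, ∑ x ∈ range (2 ^ J), (dE (K i) f x - dE (K (i + 1)) f x) ^ 2 * dE (K i) w x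
        ≤ ∑ x ∈ range (2 ^ J), (dE (K 0) f x ^ 2 * U x + g x ^ 2 * U x) := by
  intro N
  induction N with
  | zero =>
    intro K hK hKN
    refine ⟨fun x => dE (K 0) w x, fun x y h => dE_congr w h, fun x hx => ⟨?_, ?_⟩, ?_⟩
    · exact dE_nonneg (fun y => (hw y).le) _ _
    · exact hC x hx _ hKN
    · simp only [range_zero, sum_empty]
      refine Finset.sum_nonneg fun x _ => ?_
      have := dE_nonneg (fun y => (hw y).le) (K 0) x
      positivity
  | succ N ih =>
    intro K hK hKN
    obtain ⟨U', hU1, hU2, hU3⟩ := ih (fun i => K (i + 1)) (fun a b h => hK (by omega)) hKN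
    simp only [zero_add] at hU1 hU2 hU3
    have hK01 : K 0 ≤ K 1 := hK (by omega)
    have hK1J : K 1 ≤ J := (hK (by omega)).trans hKN
    refine ⟨fun x => max (U' x) (dE (K 0) w x), ?_, ?_, ?_⟩
    · intro x y h
      have e1 : U' x = U' y := hU1 x y (by rw [div_div_pow hK01, h, ← div_div_pow hK01])
      simp only [e1, dE_congr w h]
    · intro x hx
      exact ⟨le_max_of_le_left (hU2 x hx).1, max_le (hU2 x hx).2 (hC x hx _ (hK01.trans hK1J))⟩
    · rw [Finset.sum_range_succ']
      -- orthogonality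
      have ho : ∑ x ∈ range (2 ^ J), (dE (K 1) f x * U' x) * dE (K 0) f x
          = ∑ x ∈ range (2 ^ J), (dE (K 1) f x * U' x) * dE (K 1) f x := by
        have hψ : ∀ x y, x / 2 ^ K 1 = y / 2 ^ K 1 →
            dE (K 1) f x * U' x = dE (K 1) f y * U' y := by
          intro x y h
          rw [hU1 x y h, dE_congr f h]
        have a1 := sum_dE_grid hK01 hK1J f (fun x => dE (K 1) f x * U' x) hψ
        have a2 := sum_dE_grid le_rfl hK1J f (fun x => dE (K 1) f x * U' x) hψ
        exact a1.trans a2.symm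
      have hp : ∑ x ∈ range (2 ^ J), (dE (K 0) f x - dE (K (0 + 1)) f x) ^ 2 * dE (K 0) w x
          ≤ ∑ x ∈ range (2 ^ J), ((dE (K 0) f x ^ 2 * U' x - dE (K 1) f x ^ 2 * U' x
            - 2 * ((dE (K 1) f x * U' x) * dE (K 0) f x) + 2 * ((dE (K 1) f x * U' x) * dE (K 1) f x))
            + g x ^ 2 * (max (U' x) (dE (K 0) w x) - U' x)) := by
        refine Finset.sum_le_sum fun x hx => ?_
        have hx := mem_range.1 hx
        simp only [zero_add]
        have b1 := hg x hx (K 0) (hK01.trans hK1J)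
        have b2 := hg x hx (K 1) hK1J
        have b3 := dE_nonneg hf (K 0) x
        have b4 := dE_nonneg hf (K 1) x
        have b5 : (dE (K 0) f x - dE (K 1) f x) ^ 2 ≤ g x ^ 2 := by
          apply sq_le_sq'
          · linarith
          · linarith
        have m1 := le_max_left (U' x) (dE (K 0) w x)
        have m2 := le_max_right (U' x) (dE (K 0) w x)
        set Um := max (U' x) (dE (K 0) w x)
        have b6 := mul_le_mul_of_nonneg_left m2 (sq_nonneg (dE (K 0) f x - dE (K 1) f x))
        have b7 := mul_le_mul_of_nonneg_right b5 (sub_nonneg.2 m1)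
        nlinarith
      have hfin : ∑ x ∈ range (2 ^ J), (dE (K 0) f x ^ 2 * U' x + g x ^ 2 * max (U' x) (dE (K 0) w x))
          ≤ ∑ x ∈ range (2 ^ J), (dE (K 0) f x ^ 2 * max (U' x) (dE (K 0) w x)
            + g x ^ 2 * max (U' x) (dE (K 0) w x)) := by
        gcongr with x hx
        exact le_max_left _ _
      have := add_le_add hU3 hp
      refine this.trans (le_trans (le_of_eq ?_) hfin)
      simp only [Finset.sum_add_distrib, Finset.sum_sub_distrib, mul_sub, ← Finset.mul_sum] at ho ⊢
      rw [ho]; ring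

lemma mart_high' {J : ℕ} {f g w : ℕ → ℝ} {C1 : ℝ} (hf : ∀ x, 0 ≤ f x) (hw : ∀ x, 0 < w x)
    (hg : ∀ x, x < 2 ^ J → ∀ k, k ≤ J → dE k f x ≤ g x)
    (hC : ∀ x, x < 2 ^ J → ∀ k, k ≤ J → dE k w x ≤ C1 * w x)
    (N : ℕ) (K : ℕ → ℕ) (hK : Monotone K) (hKN : K N ≤ J) :
    ∑ x ∈ range (2 ^ J), (∑ i ∈ range N, (dE (K i) f x - dE (K (i + 1)) f x) ^ 2) * w x
      ≤ 2 * C1 * ∑ x ∈ range (2 ^ J), g x ^ 2 * w x := by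
  obtain ⟨U, hU1, hU2, hU3⟩ := mart_high hf hw hg hC N K hK hKN
  have h0J : K 0 ≤ J := (hK (by omega)).trans hKN
  calc _ = ∑ i ∈ range N, ∑ x ∈ range (2 ^ J), (dE (K i) f x - dE (K (i + 1)) f x) ^ 2 * w x := by
        rw [Finset.sum_comm]
        exact Finset.sum_congr rfl fun x _ => Finset.sum_mul _ _ _
    _ = ∑ i ∈ range N, ∑ x ∈ range (2 ^ J),
        (dE (K i) f x - dE (K (i + 1)) f x) ^ 2 * dE (K i) w x := by
        refine Finset.sum_congr rfl fun i hi => ?_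
        have hi := mem_range.1 hi
        symm
        apply sum_dE_grid le_rfl ((hK hi.le).trans hKN)
        intro x y h
        rw [dE_congr f h, dE_congr' (hK (Nat.le_succ i)) f h]
    _ ≤ _ := hU3
    _ ≤ _ := by
        rw [Finset.mul_sum]
        refine Finset.sum_le_sum fun x hx => ?_
        have hx := mem_range.1 hx
        obtain ⟨u1, u2⟩ := hU2 x hx
        have b1 := hg x hx (K 0) h0J
        have b3 := dE_nonneg hf (K 0) x
        have b5 : dE (K 0) f x ^ 2 ≤ g x ^ 2 := by gcongr
        have b6 := mul_le_mul_of_nonneg_right b5 u1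
        have b7 := mul_le_mul_of_nonneg_left u2 (sq_nonneg (g x))
        nlinarith

/-- second order Taylor lower bound -/
lemma taylor_rpow {p : ℝ} (hp1 : 1 < p) (hp2 : p ≤ 2) {a b M : ℝ} (ha : 0 ≤ a) (hb : 0 ≤ b)
    (haM : a ≤ M) (hbM : b ≤ M) (hM : 0 < M) :
    p * (p - 1) / 2 * ((a - b) ^ 2 * M ^ (p - 2)) ≤ a ^ p - b ^ p - p * b ^ (p - 1) * (a - b) := by
  set c := p * (p - 1) * M ^ (p - 2) with hc
  set φ : ℝ → ℝ := fun t => t ^ p - c / 2 * t ^ 2 with hφ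
  have hder : ∀ t, HasDerivAt φ (p * t ^ (p - 1) - c * t) t := by
    intro t
    have h1 := Real.hasDerivAt_rpow_const (x := t) (p := p) (Or.inr hp1.le)
    have h2 := (hasDerivAt_pow 2 t).const_mul (c / 2)
    refine (h1.sub h2).congr_deriv ?_
    simp; ring
  have hmono : ∀ s t, 0 ≤ s → s ≤ t → t ≤ M → p * s ^ (p - 1) - c * s ≤ p * t ^ (p - 1) - c * t := by
    intro s t hs hst htM
    rcases (hs.trans hst).eq_or_lt with h0 | h0
    · have : s = t := by linarith
      rw [this]
    have hB := rpow_one_add_le_one_add_mul_self (s := s / t - 1) (p := p - 1)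
      (by have : 0 ≤ s / t := by positivity
          linarith) (by linarith) (by linarith)
    rw [add_sub_cancel, Real.div_rpow hs h0.le, div_le_iff₀ (Real.rpow_pos_of_pos h0 _)] at hB
    have e1 : t ^ (p - 1) = t ^ (p - 2) * t := by
      rw [← Real.rpow_add_one h0.ne']; congr 1; ring
    have e2 : M ^ (p - 2) ≤ t ^ (p - 2) := Real.rpow_le_rpow_of_nonpos h0 htM (by linarith)
    have e3 : (1 + (p - 1) * (s / t - 1)) * t ^ (p - 1)
        = t ^ (p - 1) + (p - 1) * (t ^ (p - 2) * (s - t)) := by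
      rw [e1]; field_simp
    rw [e3] at hB
    have e4 : M ^ (p - 2) * (t - s) ≤ t ^ (p - 2) * (t - s) :=
      mul_le_mul_of_nonneg_right e2 (by linarith)
    have e5 := mul_le_mul_of_nonneg_left e4 (by nlinarith : 0 ≤ p * (p - 1))
    have e6 := mul_le_mul_of_nonneg_left hB (by linarith : 0 ≤ p)
    simp only [hc]
    nlinarith
  have key : φ a ≥ φ b + (p * b ^ (p - 1) - c * b) * (a - b) := by
    rcases lt_trichotomy a b with h | h | h
    · obtain ⟨ξ, hξ, he⟩ := exists_hasDerivAt_eq_slope φ (fun t => p * t ^ (p - 1) - c * t) h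
        (fun t _ => (hder t).continuousAt.continuousWithinAt) (fun t _ => hder t)
      rw [_root_.eq_div_iff (by linarith)] at he
      have := hmono ξ b (by linarith [hξ.1]) hξ.2.le hbM
      have := mul_le_mul_of_nonneg_right this (by linarith : 0 ≤ b - a)
      nlinarith
    · rw [h]; simp
    · obtain ⟨ξ, hξ, he⟩ := exists_hasDerivAt_eq_slope φ (fun t => p * t ^ (p - 1) - c * t) h
        (fun t _ => (hder t).continuousAt.continuousWithinAt) (fun t _ => hder t)
      rw [_root_.eq_div_iff (by linarith)] at he
      have := hmono b ξ hb hξ.1.le (by linarith [hξ.2])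
      have := mul_le_mul_of_nonneg_right this (by linarith : 0 ≤ a - b)
      nlinarith
  simp only [hφ] at key
  have : p * (p - 1) / 2 * ((a - b) ^ 2 * M ^ (p - 2)) = c / 2 * (a - b) ^ 2 := by
    simp only [hc]; ring
  rw [this]
  nlinarith

lemma mart_low_step {J j k : ℕ} {f v : ℕ → ℝ} {C0 p : ℝ} (hp1 : 1 < p) (hp2 : p ≤ 2) (hC0 : 0 < C0)
    (hf : ∀ x, 0 ≤ f x) (hv : ∀ x, 0 < v x)
    (hg : ∀ x, x < 2 ^ J → ∀ k, k ≤ J → dE k f x ≤ C0 * v x) (hjk : j ≤ k) (hk : k ≤ J) :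
    p * (p - 1) / 2 * C0 ^ (p - 2) *
      ∑ x ∈ range (2 ^ J), (dE j f x - dE k f x) ^ 2 * v x ^ (p - 2)
      ≤ ∑ x ∈ range (2 ^ J), dE j f x ^ p - ∑ x ∈ range (2 ^ J), dE k f x ^ p := by
  have ho : ∑ x ∈ range (2 ^ J), (dE k f x ^ (p - 1)) * dE j f x
      = ∑ x ∈ range (2 ^ J), (dE k f x ^ (p - 1)) * dE k f x := by
    have hψ : ∀ x y, x / 2 ^ k = y / 2 ^ k → dE k f x ^ (p - 1) = dE k f y ^ (p - 1) := by
      intro x y h; rw [dE_congr f h]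
    have a1 := sum_dE_grid hjk hk f _ hψ
    have a2 := sum_dE_grid le_rfl hk f _ hψ
    exact a1.trans a2.symm
  calc _ ≤ ∑ x ∈ range (2 ^ J), (dE j f x ^ p - dE k f x ^ p
        - p * (dE k f x ^ (p - 1) * dE j f x) + p * (dE k f x ^ (p - 1) * dE k f x)) := by
        rw [Finset.mul_sum]
        refine Finset.sum_le_sum fun x hx => ?_
        have hx := mem_range.1 hx
        have := taylor_rpow hp1 hp2 (dE_nonneg hf j x) (dE_nonneg hf k x)
          (hg x hx j (hjk.trans hk)) (hg x hx k hk) (mul_pos hC0 (hv x))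
        rw [Real.mul_rpow hC0.le (hv x).le] at this
        linarith
    _ = _ := by
        simp only [Finset.sum_add_distrib, Finset.sum_sub_distrib, ← Finset.mul_sum]
        rw [ho]; ring

lemma mart_low {J : ℕ} {f v : ℕ → ℝ} {C0 p : ℝ} (hp1 : 1 < p) (hp2 : p ≤ 2) (hC0 : 0 < C0)
    (hf : ∀ x, 0 ≤ f x) (hv : ∀ x, 0 < v x)
    (hg : ∀ x, x < 2 ^ J → ∀ k, k ≤ J → dE k f x ≤ C0 * v x)
    (N : ℕ) (K : ℕ → ℕ) (hK : Monotone K) (hKN : K N ≤ J) :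
    p * (p - 1) / 2 * C0 ^ (p - 2) * ∑ x ∈ range (2 ^ J),
      (∑ i ∈ range N, (dE (K i) f x - dE (K (i + 1)) f x) ^ 2) * v x ^ (p - 2)
      ≤ ∑ x ∈ range (2 ^ J), f x ^ p := by
  have hcp : 0 < p * (p - 1) / 2 * C0 ^ (p - 2) := by
    have := Real.rpow_pos_of_pos hC0 (p - 2)
    have : 0 < p - 1 := by linarith
    positivity
  have hs0 : ∀ j k, 0 ≤ ∑ x ∈ range (2 ^ J), (dE j f x - dE k f x) ^ 2 * v x ^ (p - 2) := by
    intro j k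
    refine Finset.sum_nonneg fun x _ => ?_
    have := Real.rpow_pos_of_pos (hv x) (p - 2)
    positivity
  have h0J : K 0 ≤ J := (hK (by omega)).trans hKN
  calc _ = ∑ i ∈ range N, p * (p - 1) / 2 * C0 ^ (p - 2) * ∑ x ∈ range (2 ^ J),
        (dE (K i) f x - dE (K (i + 1)) f x) ^ 2 * v x ^ (p - 2) := by
        rw [← Finset.mul_sum, Finset.sum_comm]
        congr 1
        exact Finset.sum_congr rfl fun x _ => Finset.sum_mul _ _ _
    _ ≤ ∑ i ∈ range N, (∑ x ∈ range (2 ^ J), dE (K i) f x ^ p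
        - ∑ x ∈ range (2 ^ J), dE (K (i + 1)) f x ^ p) := by
        refine Finset.sum_le_sum fun i hi => ?_
        exact mart_low_step hp1 hp2 hC0 hf hv hg (hK (Nat.le_succ i))
          ((hK (mem_range.1 hi)).trans hKN)
    _ = ∑ x ∈ range (2 ^ J), dE (K 0) f x ^ p - ∑ x ∈ range (2 ^ J), dE (K N) f x ^ p :=
        Finset.sum_range_sub' (fun i => ∑ x ∈ range (2 ^ J), dE (K i) f x ^ p) N
    _ ≤ ∑ x ∈ range (2 ^ J), dE (K 0) f x ^ p := by
        have : 0 ≤ ∑ x ∈ range (2 ^ J), dE (K N) f x ^ p :=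
          Finset.sum_nonneg fun x _ => Real.rpow_nonneg (dE_nonneg hf _ _) _
        linarith
    _ ≤ _ := by
        have := mart_low_step hp1 hp2 hC0 hf hv hg (Nat.zero_le (K 0)) h0J
        rw [dE_zero] at this
        have := mul_nonneg hcp.le (hs0 0 (K 0))
        rw [dE_zero] at this
        linarith

lemma mart_low_last {J : ℕ} {f v : ℕ → ℝ} {C0 p : ℝ} (hp1 : 1 < p) (hp2 : p ≤ 2) (hC0 : 0 < C0)
    (hf : ∀ x, 0 ≤ f x) (hv : ∀ x, 0 < v x)
    (hg : ∀ x, x < 2 ^ J → ∀ k, k ≤ J → dE k f x ≤ C0 * v x) :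
    p * (p - 1) / 2 * C0 ^ (p - 2) * ∑ x ∈ range (2 ^ J), dE J f x ^ 2 * v x ^ (p - 2)
      ≤ ∑ x ∈ range (2 ^ J), f x ^ p := by
  have hcp : 0 < p * (p - 1) / 2 * C0 ^ (p - 2) := by
    have := Real.rpow_pos_of_pos hC0 (p - 2)
    have : 0 < p - 1 := by linarith
    positivity
  have h1 := mart_low_step hp1 hp2 hC0 hf hv hg (Nat.zero_le J) le_rfl
  have h2 : 0 ≤ p * (p - 1) / 2 * C0 ^ (p - 2) *
      ∑ x ∈ range (2 ^ J), (dE 0 f x - dE J f x) ^ 2 * v x ^ (p - 2) := by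
    refine mul_nonneg hcp.le (Finset.sum_nonneg fun x _ => ?_)
    have := Real.rpow_pos_of_pos (hv x) (p - 2)
    positivity
  have h3 : p * (p - 1) / 2 * C0 ^ (p - 2) * ∑ x ∈ range (2 ^ J), dE J f x ^ 2 * v x ^ (p - 2)
      ≤ ∑ x ∈ range (2 ^ J), dE J f x ^ p := by
    rw [Finset.mul_sum]
    refine Finset.sum_le_sum fun x hx => ?_
    have hx := mem_range.1 hx
    have := taylor_rpow hp1 hp2 (dE_nonneg hf J x) le_rfl
      (hg x hx J le_rfl) (mul_pos hC0 (hv x)).le (mul_pos hC0 (hv x))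
    rw [Real.mul_rpow hC0.le (hv x).le, Real.zero_rpow (by linarith), Real.zero_rpow (by linarith)] at this
    simp only [sub_zero, mul_zero, zero_mul] at this
    linarith
  rw [dE_zero] at h1 h2
  linarith

/-- combination -/
lemma total_bound {J : ℕ} {w : ℕ → ℝ} {C δ B : ℝ} (hC : 0 ≤ C) (hδ : 0 < δ)
    (hw : WH (2 ^ (J + 2)) w C δ) {f : ℕ → ℝ} (hz : ∀ x, 2 ^ J ≤ x → f x = 0)
    (hB : ∀ (N : ℕ) (K : ℕ → ℕ), Monotone K → K N ≤ J → ∑ x ∈ range (2 ^ J),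
      (∑ i ∈ range N, (dE (K i) f x - dE (K (i + 1)) f x) ^ 2) * w x ≤ B)
    (hBl : ∑ x ∈ range (2 ^ J), dE J f x ^ 2 * w x ≤ B)
    {n : ℕ → ℕ} (hn : StrictMono n) (hn0 : ∀ i, 0 < n i) (N : ℕ) (hN : n N < 2 ^ J) :
    ∑ x ∈ range (2 ^ J), (∑ i ∈ range N, (Mav (n i) f x - Mav (n (i + 1)) f x) ^ 2) * w x
      ≤ (20 * (cW C δ * (648 * C) * cW C δ) + 2) * B := by
  have hcW : 0 ≤ cW C δ := by
    have := th_lt_one hδ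
    have : 0 < 1 - th δ := by linarith
    unfold cW; positivity
  have hG := G_bound hC hδ hw hz hn hn0 N hN
  have hD := hB N (fun i => Nat.log 2 (n i)) (fun i j h => Nat.log_mono_right (hn.monotone h))
    (Nat.log_lt_of_lt_pow (hn0 N).ne' hN).le
  have hpc : ∑ m ∈ range (J + 1), ∑ x ∈ range (2 ^ J), pc J f m x ^ 2 * w x ≤ 2 * B := by
    rw [Finset.sum_range_succ, two_mul]
    apply add_le_add
    · refine le_trans (le_of_eq ?_) (hB J id monotone_id le_rfl)
      rw [Finset.sum_comm]
      refine Finset.sum_congr rfl fun x _ => ?_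
      rw [Finset.sum_mul]
      refine Finset.sum_congr rfl fun m hm => ?_
      simp [pc, mem_range.1 hm]
    · refine le_trans (le_of_eq ?_) hBl
      simp [pc]
  calc _ ≤ ∑ x ∈ range (2 ^ J),
        (2 * ((∑ i ∈ range N, (Gd f (n i) x - Gd f (n (i + 1)) x) ^ 2) * w x)
        + 2 * ((∑ i ∈ range N, (dE (Nat.log 2 (n i)) f x
          - dE (Nat.log 2 (n (i + 1))) f x) ^ 2) * w x)) := by
        refine Finset.sum_le_sum fun x _ => ?_
        rw [← mul_assoc, ← mul_assoc, ← add_mul]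
        apply mul_le_mul_of_nonneg_right _ (hw.1 x).le
        rw [Finset.mul_sum, Finset.mul_sum, ← Finset.sum_add_distrib]
        refine Finset.sum_le_sum fun i _ => ?_
        simp only [Gd]
        set u := Mav (n i) f x
        set u' := Mav (n (i + 1)) f x
        set e := dE (Nat.log 2 (n i)) f x
        set e' := dE (Nat.log 2 (n (i + 1))) f x
        nlinarith [sq_nonneg (u - e - (u' - e') - (e - e'))]
    _ ≤ 2 * (5 * (cW C δ * (648 * C) * cW C δ) * (2 * B)) + 2 * B := by
        rw [Finset.sum_add_distrib, ← Finset.mul_sum, ← Finset.mul_sum]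
        have := hG.trans (mul_le_mul_of_nonneg_left hpc (by positivity))
        linarith
    _ = _ := by ring

end QME

namespace QME

/-- left-sided maximal function -/
noncomputable def mL (f : ℕ → ℝ) (x : ℕ) : ℝ :=
  (range (x + 1)).sup' Finset.nonempty_range_add_one (fun a => (∑ y ∈ Ico a (x + 1), f y) / ((x : ℝ) + 1 - a))

lemma mL_le {f : ℕ → ℝ} {a x : ℕ} (h : a ≤ x) :
    ∑ y ∈ Ico a (x + 1), f y ≤ mL f x * ((x : ℝ) + 1 - a) := by
  have h1 := Finset.le_sup' (s := range (x + 1))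
    (fun a : ℕ => (∑ y ∈ Ico a (x + 1), f y) / ((x : ℝ) + 1 - a)) (mem_range.2 (Nat.lt_succ_of_le h))
  have : (a : ℝ) ≤ x := by exact_mod_cast h
  rw [div_le_iff₀ (by linarith)] at h1
  exact h1

lemma mL_ge {f : ℕ → ℝ} (x : ℕ) : f x ≤ mL f x := by
  have := mL_le (f := f) (le_refl x)
  simp at this; linarith

/-- running positive part -/
noncomputable def Fr (f : ℕ → ℝ) (l : ℝ) : ℕ → ℝ
  | 0 => 0
  | x + 1 => max 0 (Fr f l x + (f x - l))

lemma Fr_nonneg (f : ℕ → ℝ) (l : ℝ) (x : ℕ) : 0 ≤ Fr f l x := by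
  cases x with
  | zero => exact le_rfl
  | succ x => exact le_max_left _ _

lemma Fr_ge (f : ℕ → ℝ) (l : ℝ) (x a : ℕ) (h : a ≤ x) : ∑ y ∈ Ico a x, (f y - l) ≤ Fr f l x := by
  induction x, h using Nat.le_induction with
  | base => simpa using Fr_nonneg f l a
  | succ x h ih =>
    rw [Finset.sum_Ico_succ_top h]
    exact le_max_of_le_right (by linarith)

lemma Fr_ex (f : ℕ → ℝ) (l : ℝ) (x : ℕ) (h : 0 < Fr f l x) :
    ∃ a, a < x ∧ ∑ y ∈ Ico a x, (f y - l) = Fr f l x := by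
  induction x with
  | zero => simp [Fr] at h
  | succ x ih =>
    have e : Fr f l (x + 1) = Fr f l x + (f x - l) := by
      have : Fr f l (x + 1) = max 0 (Fr f l x + (f x - l)) := rfl
      rw [this] at h ⊢
      apply max_eq_right
      by_contra hc
      rw [max_eq_left (by linarith)] at h
      exact lt_irrefl _ h
    rcases (Fr_nonneg f l x).eq_or_lt with h0 | h0
    · refine ⟨x, by omega, ?_⟩
      rw [e, ← h0]; simp
    · obtain ⟨a, ha, he⟩ := ih h0
      refine ⟨a, by omega, ?_⟩
      rw [Finset.sum_Ico_succ_top ha.le, he, e]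

lemma mL_gt_iff (f : ℕ → ℝ) (l : ℝ) (x : ℕ) : l < mL f x ↔ 0 < Fr f l (x + 1) := by
  have key : ∀ a, a ≤ x → (l < (∑ y ∈ Ico a (x + 1), f y) / ((x : ℝ) + 1 - a) ↔
      0 < ∑ y ∈ Ico a (x + 1), (f y - l)) := by
    intro a ha
    have : (a : ℝ) ≤ x := by exact_mod_cast ha
    rw [lt_div_iff₀ (by linarith), Finset.sum_sub_distrib, Finset.sum_const, Nat.card_Ico,
      nsmul_eq_mul, Nat.cast_sub (by omega)]
    push_cast
    constructor <;> intro h <;> linarith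
  unfold mL
  rw [Finset.lt_sup'_iff]
  constructor
  · rintro ⟨a, ha, h⟩
    have ha := mem_range.1 ha
    rw [key a (by omega)] at h
    exact lt_of_lt_of_le h (Fr_ge f l (x + 1) a (by omega))
  · intro h
    obtain ⟨a, ha, he⟩ := Fr_ex f l (x + 1) h
    refine ⟨a, mem_range.2 ha, ?_⟩
    rw [key a (by omega), he]; exact h

lemma weak_mL (f : ℕ → ℝ) (l : ℝ) (Λ : ℕ) :
    0 ≤ ∑ x ∈ range Λ, (if l < mL f x then f x - l else 0) := by
  have : Fr f l Λ ≤ ∑ x ∈ range Λ, (if l < mL f x then f x - l else 0) := by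
    induction Λ with
    | zero => simp [Fr]
    | succ x ih =>
      rw [Finset.sum_range_succ]
      have e : Fr f l (x + 1) = max 0 (Fr f l x + (f x - l)) := rfl
      split_ifs with h
      · rw [mL_gt_iff, e] at h
        rw [e]
        rcases max_cases 0 (Fr f l x + (f x - l)) with h1 | h1
        · rw [h1.1] at h; exact absurd h (lt_irrefl _)
        · rw [h1.1]; linarith
      · rw [mL_gt_iff] at h
        have := Fr_nonneg f l x
        linarith
  exact (Fr_nonneg f l Λ).trans this

lemma strong_mL {f : ℕ → ℝ} (hf : ∀ x, 0 ≤ f x) {P : ℝ} (hP : 1 < P) (Λ : ℕ) :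
    ∑ x ∈ range Λ, mL f x ^ P ≤ P / (P - 1) * ∑ x ∈ range Λ, f x * mL f x ^ (P - 1) := by
  have hg : ∀ x, 0 ≤ mL f x := fun x => (hf x).trans (mL_ge x)
  have hintg : ∀ x ∈ range Λ, IntegrableOn
      (fun l : ℝ => (Set.Ioo 0 (mL f x)).indicator (fun l => l ^ (P - 2) * (f x - l)) l)
      (Set.Ioi 0) := by
    intro x _
    have h1 : IntervalIntegrable (fun l : ℝ => l ^ (P - 2)) volume 0 (mL f x) :=
      intervalIntegral.intervalIntegrable_rpow' (by linarith)
    have h2 := h1.mul_continuousOn (g := fun l => f x - l) (by fun_prop)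
    rw [intervalIntegrable_iff_integrableOn_Ioo_of_le (hg x)] at h2
    exact (h2.integrable_indicator measurableSet_Ioo).integrableOn
  have hval : ∀ x, ∫ l in Set.Ioi (0 : ℝ),
      (Set.Ioo 0 (mL f x)).indicator (fun l => l ^ (P - 2) * (f x - l)) l
      = f x * mL f x ^ (P - 1) / (P - 1) - mL f x ^ P / P := by
    intro x
    have hs : Set.Ioi (0:ℝ) ∩ Set.Ioo 0 (mL f x) = Set.Ioo 0 (mL f x) :=
      Set.inter_eq_right.2 (fun l hl => hl.1)
    rw [setIntegral_indicator measurableSet_Ioo, hs,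
      ← integral_Ioc_eq_integral_Ioo, ← intervalIntegral.integral_of_le (hg x)]
    have e : ∫ l in (0 : ℝ)..mL f x, l ^ (P - 2) * (f x - l)
        = ∫ l in (0 : ℝ)..mL f x, (f x * l ^ (P - 2) - l ^ (P - 1)) := by
      apply intervalIntegral.integral_congr_ae
      refine Filter.Eventually.of_forall fun l hl => ?_
      rw [Set.uIoc_of_le (hg x)] at hl
      have : l ^ (P - 1) = l ^ (P - 2) * l := by
        rw [← Real.rpow_add_one hl.1.ne']; congr 1; ring
      rw [this]; ring
    rw [e, intervalIntegral.integral_sub, intervalIntegral.integral_const_mul,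
      integral_rpow (Or.inl (by linarith)), integral_rpow (Or.inl (by linarith)),
      Real.zero_rpow (by linarith), Real.zero_rpow (by linarith)]
    · rw [show P - 2 + 1 = P - 1 by ring, show P - 1 + 1 = P by ring]; ring
    · exact (intervalIntegral.intervalIntegrable_rpow' (by linarith)).const_mul _
    · exact intervalIntegral.intervalIntegrable_rpow' (by linarith)
  have h0 : 0 ≤ ∫ l in Set.Ioi (0 : ℝ), ∑ x ∈ range Λ,
      (Set.Ioo 0 (mL f x)).indicator (fun l => l ^ (P - 2) * (f x - l)) l := by
    apply setIntegral_nonneg measurableSet_Ioi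
    intro l hl
    have hl' : 0 < l := hl
    have e : ∑ x ∈ range Λ, (Set.Ioo 0 (mL f x)).indicator (fun l => l ^ (P - 2) * (f x - l)) l
        = l ^ (P - 2) * ∑ x ∈ range Λ, (if l < mL f x then f x - l else 0) := by
      rw [Finset.mul_sum]
      refine Finset.sum_congr rfl fun x _ => ?_
      simp [Set.indicator, hl']
    rw [e]
    exact mul_nonneg (Real.rpow_nonneg hl'.le _) (weak_mL f l Λ)
  rw [integral_finsetSum _ hintg] at h0
  simp only [hval] at h0
  rw [Finset.sum_sub_distrib, ← Finset.sum_div, ← Finset.sum_div] at h0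
  have hP1 : 0 < P - 1 := by linarith
  have hP0 : 0 < P := by linarith
  have : (∑ x ∈ range Λ, mL f x ^ P) / P ≤ (∑ x ∈ range Λ, f x * mL f x ^ (P - 1)) / (P - 1) := by
    linarith
  rw [div_le_iff₀ hP0] at this
  refine this.trans (le_of_eq ?_)
  field_simp

lemma lp_mL {f : ℕ → ℝ} (hf : ∀ x, 0 ≤ f x) {P : ℝ} (hP : 1 < P) (Λ : ℕ) :
    ∑ x ∈ range Λ, mL f x ^ P ≤ 2 * (2 * (P / (P - 1))) ^ P * ∑ x ∈ range Λ, f x ^ P := by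
  set c := P / (P - 1) with hc
  have hc0 : 0 < c := div_pos (by linarith) (by linarith)
  have hg : ∀ x, 0 ≤ mL f x := fun x => (hf x).trans (mL_ge x)
  have h := strong_mL hf hP Λ
  have key : ∀ x, c * (f x * mL f x ^ (P - 1)) ≤ mL f x ^ P / 2 + (2 * c) ^ P * f x ^ P := by
    intro x
    have hfx := hf x
    have hgx := hg x
    have e : mL f x ^ P = mL f x ^ (P - 1) * mL f x := by
      rcases hgx.eq_or_lt with h0 | h0
      · rw [← h0, Real.zero_rpow (by linarith), mul_zero]
      · rw [← Real.rpow_add_one h0.ne']; congr 1; ring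
    have hp1 : 0 ≤ mL f x ^ (P - 1) := Real.rpow_nonneg hgx _
    rcases le_total (2 * c * f x) (mL f x) with h1 | h1
    · have := mul_le_mul_of_nonneg_left h1 hp1
      have : 0 ≤ (2 * c) ^ P * f x ^ P := by positivity
      rw [e]; linarith
    · have h2 : mL f x ^ (P - 1) ≤ (2 * c * f x) ^ (P - 1) :=
        Real.rpow_le_rpow hgx h1 (by linarith)
      have e2 : (2 * c * f x) ^ P = (2 * c * f x) ^ (P - 1) * (2 * c * f x) := by
        have h5 : 0 ≤ 2 * c * f x := by positivity
        rcases h5.eq_or_lt with h0 | h0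
        · rw [← h0, Real.zero_rpow (by linarith), mul_zero]
        · rw [← Real.rpow_add_one h0.ne']; congr 1; ring
      rw [← Real.mul_rpow (by positivity) hfx, e2]
      have h3 := mul_le_mul_of_nonneg_right h2 (by positivity : 0 ≤ 2 * c * f x)
      have : 0 ≤ mL f x ^ P := Real.rpow_nonneg hgx _
      have : 0 ≤ c * f x * mL f x ^ (P - 1) := by positivity
      linarith
  have h2 : c * ∑ x ∈ range Λ, f x * mL f x ^ (P - 1)
      ≤ ∑ x ∈ range Λ, (mL f x ^ P / 2 + (2 * c) ^ P * f x ^ P) := by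
    rw [Finset.mul_sum]
    exact Finset.sum_le_sum fun x _ => key x
  rw [Finset.sum_add_distrib, ← Finset.sum_div, ← Finset.mul_sum] at h2
  linarith

/-- two-sided maximal operator on `[0, Λ)` -/
noncomputable def mM (Λ : ℕ) (f : ℕ → ℝ) (x : ℕ) : ℝ :=
  mL f x + mL (fun y => f (Λ - 1 - y)) (Λ - 1 - x)

lemma mM_nonneg {Λ : ℕ} {f : ℕ → ℝ} (hf : ∀ x, 0 ≤ f x) (x : ℕ) : 0 ≤ mM Λ f x :=
  add_nonneg ((hf x).trans (mL_ge x)) ((hf _).trans (mL_ge (f := fun y => f (Λ - 1 - y)) _))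

lemma mM_avg {Λ : ℕ} {f : ℕ → ℝ} (hf : ∀ x, 0 ≤ f x) {a b x : ℕ} (h1 : a ≤ x) (h2 : x < b)
    (h3 : b ≤ Λ) : ∑ y ∈ Ico a b, f y ≤ ((b : ℝ) - a) * mM Λ f x := by
  have e1 := mL_le (f := f) h1
  have e2 := mL_le (f := fun y => f (Λ - 1 - y)) (a := Λ - b) (x := Λ - 1 - x) (by omega)
  have e3 : ∑ y ∈ Ico (Λ - b) (Λ - 1 - x + 1), f (Λ - 1 - y) = ∑ y ∈ Ico x b, f y := by
    refine Finset.sum_bij' (fun y _ => Λ - 1 - y) (fun y _ => Λ - 1 - y) ?_ ?_ ?_ ?_ ?_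
    · intro y hy; rw [mem_Ico] at *; omega
    · intro y hy; rw [mem_Ico] at *; omega
    · intro y hy; rw [mem_Ico] at hy; omega
    · intro y hy; rw [mem_Ico] at hy; omega
    · intro y hy; rfl
  rw [e3] at e2
  have e4 : (((Λ - 1 - x : ℕ) : ℝ) + 1 - ((Λ - b : ℕ) : ℝ)) = (b : ℝ) - x := by
    have h5 : (((Λ - 1 - x : ℕ) : ℝ) + 1 + x) = Λ := by
      have : Λ - 1 - x + 1 + x = Λ := by omega
      exact_mod_cast this
    have h6 : ((Λ - b : ℕ) : ℝ) + b = Λ := by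
      have : Λ - b + b = Λ := by omega
      exact_mod_cast this
    linarith
  rw [e4] at e2
  set A := mL f x
  set B := mL (fun y => f (Λ - 1 - y)) (Λ - 1 - x) with hB
  have hA : 0 ≤ A := (hf x).trans (mL_ge x)
  have hB0 : 0 ≤ B := (hf _).trans (mL_ge (f := fun y => f (Λ - 1 - y)) _)
  have hax : (a : ℝ) ≤ x := by exact_mod_cast h1
  have hxb : (x : ℝ) + 1 ≤ b := by exact_mod_cast h2
  have e5 : ∑ y ∈ Ico a b, f y ≤ ∑ y ∈ Ico a (x + 1), f y + ∑ y ∈ Ico x b, f y := by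
    rw [← Finset.sum_Ico_consecutive f (h1.trans (Nat.le_succ x)) (Nat.succ_le_of_lt h2)]
    have : ∑ y ∈ Ico (x + 1) b, f y ≤ ∑ y ∈ Ico x b, f y :=
      Finset.sum_le_sum_of_subset_of_nonneg (Ico_subset_Ico (Nat.le_succ x) le_rfl)
        (fun _ _ _ => hf _)
    gcongr
  have : mM Λ f x = A + B := rfl
  rw [this]
  nlinarith [mul_nonneg hA (by linarith : (0 : ℝ) ≤ (b : ℝ) - (x + 1)),
    mul_nonneg hB0 (by linarith : (0 : ℝ) ≤ (x : ℝ) - a)]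

lemma mM_lp {P : ℝ} (hP : 1 < P) : ∃ A : ℝ, 1 ≤ A ∧ ∀ (Λ : ℕ) (f : ℕ → ℝ), (∀ x, 0 ≤ f x) →
    ∑ x ∈ range Λ, mM Λ f x ^ P ≤ A * ∑ x ∈ range Λ, f x ^ P := by
  set c := 2 * (2 * (P / (P - 1))) ^ P with hc
  have hc0 : 0 ≤ c := by
    have : 0 < P / (P - 1) := div_pos (by linarith) (by linarith)
    positivity
  refine ⟨2 ^ P * (2 * c) + 1, ?_, ?_⟩
  · have : 0 ≤ (2 : ℝ) ^ P * (2 * c) := by positivity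
    linarith
  intro Λ f hf
  have h1 := lp_mL hf hP Λ
  have h2 := lp_mL (f := fun y => f (Λ - 1 - y)) (fun _ => hf _) hP Λ
  rw [Finset.sum_range_reflect (fun y => f y ^ P) Λ] at h2
  rw [← Finset.sum_range_reflect (fun y => mL (fun y => f (Λ - 1 - y)) y ^ P) Λ] at h2
  have hF : 0 ≤ ∑ x ∈ range Λ, f x ^ P := Finset.sum_nonneg fun x _ => Real.rpow_nonneg (hf x) _
  calc ∑ x ∈ range Λ, mM Λ f x ^ P ≤ ∑ x ∈ range Λ, 2 ^ P * (mL f x ^ P +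
        mL (fun y => f (Λ - 1 - y)) (Λ - 1 - x) ^ P) := by
        refine Finset.sum_le_sum fun x _ => ?_
        have hA : 0 ≤ mL f x := (hf x).trans (mL_ge x)
        have hB0 : 0 ≤ mL (fun y => f (Λ - 1 - y)) (Λ - 1 - x) :=
          (hf _).trans (mL_ge (f := fun y => f (Λ - 1 - y)) _)
        unfold mM
        set A := mL f x
        set B := mL (fun y => f (Λ - 1 - y)) (Λ - 1 - x)
        have hAp := Real.rpow_nonneg hA P
        have hBp := Real.rpow_nonneg hB0 P
        have h2p : 0 ≤ (2 : ℝ) ^ P := by positivity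
        rcases le_total A B with h | h
        · calc (A + B) ^ P ≤ (2 * B) ^ P := Real.rpow_le_rpow (by linarith) (by linarith) (by linarith)
            _ = 2 ^ P * B ^ P := Real.mul_rpow (by norm_num) hB0
            _ ≤ _ := by gcongr; linarith
        · calc (A + B) ^ P ≤ (2 * A) ^ P := Real.rpow_le_rpow (by linarith) (by linarith) (by linarith)
            _ = 2 ^ P * A ^ P := Real.mul_rpow (by norm_num) hA
            _ ≤ _ := by gcongr; linarith
    _ = 2 ^ P * (∑ x ∈ range Λ, mL f x ^ P +
        ∑ x ∈ range Λ, mL (fun y => f (Λ - 1 - y)) (Λ - 1 - x) ^ P) := by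
        rw [← Finset.mul_sum, Finset.sum_add_distrib]
    _ ≤ 2 ^ P * (c * ∑ x ∈ range Λ, f x ^ P + c * ∑ x ∈ range Λ, f x ^ P) := by
        gcongr
    _ ≤ _ := by linarith

theorem rdf {P : ℝ} (hP : 1 < P) : ∃ C : ℝ, 1 ≤ C ∧ ∀ (Λ : ℕ) (f : ℕ → ℝ), (∀ x, 0 ≤ f x) →
    (∃ x, x < Λ ∧ 0 < f x) → ∃ v : ℕ → ℝ, (∀ x, 0 < v x) ∧ (∀ x, x < Λ → f x ≤ v x) ∧ A1 Λ v C ∧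
      ∑ x ∈ range Λ, v x ^ P ≤ C * ∑ x ∈ range Λ, f x ^ P := by
  obtain ⟨A, hA1, hA⟩ := mM_lp hP
  have hA0 : 0 < A := by linarith
  refine ⟨2 * A + 2 ^ P, by have : (0:ℝ) ≤ 2 ^ P := by positivity
                            linarith, ?_⟩
  intro Λ f hf ⟨x0, hx0, hfx0⟩
  set It : ℕ → ℕ → ℝ := fun n => (mM Λ)^[n] f with hIt
  have hIt1 : ∀ n, It (n + 1) = mM Λ (It n) := fun n => Function.iterate_succ_apply' _ _ _
  have hIt0 : ∀ n x, 0 ≤ It n x := by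
    intro n
    induction n with
    | zero => exact hf
    | succ n ih => intro x; rw [hIt1]; exact mM_nonneg ih x
  set F := ∑ x ∈ range Λ, f x ^ P with hF
  have hF0 : 0 ≤ F := Finset.sum_nonneg fun x _ => Real.rpow_nonneg (hf x) _
  have hItP : ∀ n, ∑ x ∈ range Λ, It n x ^ P ≤ A ^ n * F := by
    intro n
    induction n with
    | zero => simp [hIt, hF]
    | succ n ih =>
      rw [hIt1, pow_succ']
      refine (hA Λ _ (hIt0 n)).trans ?_
      rw [mul_assoc]; gcongr
  set h : ℕ → ℕ → ℝ := fun n x => (A ^ n)⁻¹ * It n x with hh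
  have hh0 : ∀ n x, 0 ≤ h n x := fun n x => mul_nonneg (by positivity) (hIt0 n x)
  have hhP : ∀ n, ∑ x ∈ range Λ, h n x ^ P ≤ F := by
    intro n
    have hAn : 1 ≤ A ^ n := one_le_pow₀ hA1
    have e : ∑ x ∈ range Λ, h n x ^ P = ((A ^ n)⁻¹) ^ P * ∑ x ∈ range Λ, It n x ^ P := by
      rw [Finset.mul_sum]
      exact Finset.sum_congr rfl fun x _ => Real.mul_rpow (by positivity) (hIt0 n x)
    have e2 : ((A ^ n)⁻¹) ^ P ≤ (A ^ n)⁻¹ := by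
      calc ((A ^ n)⁻¹) ^ P ≤ ((A ^ n)⁻¹) ^ (1 : ℝ) :=
            Real.rpow_le_rpow_of_exponent_ge (by positivity) (inv_le_one_of_one_le₀ hAn) hP.le
        _ = _ := Real.rpow_one _
    rw [e]
    calc _ ≤ (A ^ n)⁻¹ * (A ^ n * F) := by
          have := hItP n
          have : 0 ≤ ∑ x ∈ range Λ, It n x ^ P :=
            Finset.sum_nonneg fun x _ => Real.rpow_nonneg (hIt0 n x) _
          gcongr
      _ = F := by field_simp
  have hhB : ∀ n x, x < Λ → h n x ≤ F ^ P⁻¹ := by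
    intro n x hx
    have : h n x ^ P ≤ F := (Finset.single_le_sum (f := fun x => h n x ^ P)
      (fun x _ => Real.rpow_nonneg (hh0 n x) _) (mem_range.2 hx)).trans (hhP n)
    exact (Real.le_rpow_inv_iff_of_pos (hh0 n x) hF0 (by linarith)).2 this
  have hgeo : Summable (fun n : ℕ => (1 / 2 : ℝ) ^ n) := summable_geometric_of_lt_one (by norm_num) (by norm_num)
  have hsum : ∀ x, x < Λ → Summable (fun n => (1 / 2 : ℝ) ^ n * h n x) := by
    intro x hx
    refine Summable.of_nonneg_of_le (fun n => mul_nonneg (by positivity) (hh0 n x))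
      (fun n => mul_le_mul_of_nonneg_left (hhB n x hx) (by positivity)) (hgeo.mul_right _)
  set v : ℕ → ℝ := fun x => if x < Λ then ∑' n, (1 / 2 : ℝ) ^ n * h n x else 1 with hv
  have hvx : ∀ x, x < Λ → v x = ∑' n, (1 / 2 : ℝ) ^ n * h n x := fun x hx => if_pos hx
  have hterm : ∀ n x, 0 ≤ (1 / 2 : ℝ) ^ n * h n x := fun n x => mul_nonneg (by positivity) (hh0 n x)
  have hge : ∀ n x, x < Λ → (1 / 2 : ℝ) ^ n * h n x ≤ v x := by
    intro n x hx
    rw [hvx x hx]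
    exact (hsum x hx).le_tsum n (fun m _ => hterm m x)
  refine ⟨v, ?_, ?_, ?_, ?_⟩
  · intro x
    by_cases hx : x < Λ
    · refine lt_of_lt_of_le ?_ (hge 1 x hx)
      have h1 := mM_avg hf (Nat.zero_le x) hx le_rfl
      have h2 : f x0 ≤ ∑ y ∈ Ico 0 Λ, f y :=
        Finset.single_le_sum (f := f) (fun y _ => hf y) (by simp [hx0])
      have hpos : 0 < ((Λ : ℝ) - (0 : ℕ)) * mM Λ f x := lt_of_lt_of_le hfx0 (h2.trans h1)
      have : 0 < mM Λ f x := by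
        by_contra hc
        have : mM Λ f x = 0 := le_antisymm (not_lt.1 hc) (mM_nonneg hf x)
        rw [this] at hpos; simp at hpos
      have e : It 1 x = mM Λ f x := rfl
      simp only [hh]
      rw [e]
      positivity
    · simp [hv, hx]
  · intro x hx
    have := hge 0 x hx
    simpa [hh, hIt] using this
  · intro a b x h1 h2 h3
    have hba : (0 : ℝ) ≤ (b : ℝ) - a := by
      have : (a : ℝ) ≤ b := by exact_mod_cast (h1.trans h2.le)
      linarith
    have hx : x < Λ := by omega
    have e : ∑ y ∈ Ico a b, v y = ∑' n, ∑ y ∈ Ico a b, (1 / 2 : ℝ) ^ n * h n y := by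
      rw [Summable.tsum_finsetSum]
      · refine Finset.sum_congr rfl fun y hy => hvx y ?_
        rw [mem_Ico] at hy; omega
      · intro y hy
        rw [mem_Ico] at hy
        exact hsum y (by omega)
    have key : ∀ n, ∑ y ∈ Ico a b, (1 / 2 : ℝ) ^ n * h n y
        ≤ 2 * A * ((b : ℝ) - a) * ((1 / 2 : ℝ) ^ (n + 1) * h (n + 1) x) := by
      intro n
      simp only [hh]
      rw [hIt1, ← Finset.mul_sum, ← Finset.mul_sum]
      have := mM_avg (hIt0 n) h1 h2 h3
      calc (1 / 2 : ℝ) ^ n * ((A ^ n)⁻¹ * ∑ y ∈ Ico a b, It n y)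
          ≤ (1 / 2 : ℝ) ^ n * ((A ^ n)⁻¹ * (((b : ℝ) - a) * mM Λ (It n) x)) := by gcongr
        _ = _ := by rw [pow_succ, pow_succ]; field_simp
    have hs1 := (summable_nat_add_iff 1).2 (hsum x hx)
    have hs2 := hs1.mul_left (2 * A * ((b : ℝ) - a))
    rw [e]
    have hvx0 : 0 ≤ v x := (hterm 0 x).trans (hge 0 x hx)
    calc _ ≤ ∑' n, 2 * A * ((b : ℝ) - a) * ((1 / 2 : ℝ) ^ (n + 1) * h (n + 1) x) := by
          refine Summable.tsum_le_tsum key ?_ hs2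
          exact Summable.of_nonneg_of_le (fun n => Finset.sum_nonneg fun y _ => hterm n y) key hs2
      _ = 2 * A * ((b : ℝ) - a) * ∑' n, ((1 / 2 : ℝ) ^ (n + 1) * h (n + 1) x) := tsum_mul_left
      _ ≤ 2 * A * ((b : ℝ) - a) * v x := by
          gcongr
          rw [hvx x hx, (hsum x hx).tsum_eq_zero_add]
          have := hterm 0 x
          linarith
      _ ≤ _ := by
          have : (0:ℝ) ≤ 2 ^ P := by positivity
          gcongr
          linarith
  · have hR : ∀ R : ℕ, ∑ x ∈ range Λ, (∑ n ∈ range R, (1 / 2 : ℝ) ^ n * h n x) ^ P ≤ 2 ^ P * F := by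
      intro R
      have hw : ∑ n ∈ range R, (1 / 2 : ℝ) ^ n ≤ 2 :=
        (hgeo.sum_le_tsum _ (fun _ _ => by positivity)).trans (le_of_eq tsum_geometric_two)
      have hw0 : 0 ≤ ∑ n ∈ range R, (1 / 2 : ℝ) ^ n := Finset.sum_nonneg fun _ _ => by positivity
      calc _ ≤ ∑ x ∈ range Λ, 2 ^ (P - 1) * ∑ n ∈ range R, (1 / 2 : ℝ) ^ n * h n x ^ P := by
            refine Finset.sum_le_sum fun x _ => ?_
            have hj := Real.inner_le_weight_mul_Lp_of_nonneg (range R) hP.le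
              (fun n => (1 / 2 : ℝ) ^ n) (fun n => h n x) (fun _ => by positivity) (fun n => hh0 n x)
            have hs0 : 0 ≤ ∑ n ∈ range R, (1 / 2 : ℝ) ^ n * h n x :=
              Finset.sum_nonneg fun n _ => hterm n x
            have hs1 : 0 ≤ ∑ n ∈ range R, (1 / 2 : ℝ) ^ n * h n x ^ P :=
              Finset.sum_nonneg fun n _ => mul_nonneg (by positivity) (Real.rpow_nonneg (hh0 n x) _)
            have := Real.rpow_le_rpow hs0 hj (by linarith : 0 ≤ P)
            refine this.trans ?_
            rw [Real.mul_rpow (Real.rpow_nonneg hw0 _) (Real.rpow_nonneg hs1 _),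
              ← Real.rpow_mul hw0, ← Real.rpow_mul hs1, inv_mul_cancel₀ (by linarith), Real.rpow_one]
            have e : (1 - P⁻¹) * P = P - 1 := by
              have : P ≠ 0 := by linarith
              field_simp
            rw [e]
            gcongr
        _ = 2 ^ (P - 1) * ∑ n ∈ range R, (1 / 2 : ℝ) ^ n * ∑ x ∈ range Λ, h n x ^ P := by
            rw [← Finset.mul_sum, Finset.sum_comm]
            simp only [Finset.mul_sum]
        _ ≤ 2 ^ (P - 1) * ∑ n ∈ range R, (1 / 2 : ℝ) ^ n * F := by
            gcongr with n hn
            exact hhP n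
        _ = 2 ^ (P - 1) * ((∑ n ∈ range R, (1 / 2 : ℝ) ^ n) * F) := by rw [Finset.sum_mul]
        _ ≤ 2 ^ (P - 1) * (2 * F) := by gcongr
        _ = _ := by rw [← mul_assoc, ← Real.rpow_add_one (by norm_num)]; congr 2; ring
    have hlim : Filter.Tendsto (fun R : ℕ => ∑ x ∈ range Λ,
        (∑ n ∈ range R, (1 / 2 : ℝ) ^ n * h n x) ^ P) Filter.atTop
        (nhds (∑ x ∈ range Λ, v x ^ P)) := by
      refine tendsto_finsetSum _ fun x hx => ?_
      rw [hvx x (mem_range.1 hx)]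
      exact ((hsum x (mem_range.1 hx)).hasSum.tendsto_sum_nat).rpow_const (Or.inr (by linarith))
    have := le_of_tendsto' hlim hR
    nlinarith

end QME

namespace QME

lemma A1.dE_le {J : ℕ} {v : ℕ → ℝ} {C : ℝ} (h : A1 (2 ^ (J + 2)) v C) :
    ∀ x < 2 ^ J, ∀ k ≤ J, dE k v x ≤ C * v x := by
  intro x hx k hk
  have e : 2 ^ J = 2 ^ (J - k) * 2 ^ k := by rw [← pow_add, Nat.sub_add_cancel hk]
  have hq : x / 2 ^ k < 2 ^ (J - k) := by
    rw [Nat.div_lt_iff_lt_mul (by positivity), ← e]; exact hx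
  have h1 := h (x / 2 ^ k * 2 ^ k) ((x / 2 ^ k + 1) * 2 ^ k) x (Nat.div_mul_le_self _ _)
    (by rw [mul_comm]; exact Nat.lt_mul_div_succ x (by positivity))
    (by
      calc (x / 2 ^ k + 1) * 2 ^ k ≤ 2 ^ (J - k) * 2 ^ k := Nat.mul_le_mul_right _ hq
        _ = 2 ^ J := e.symm
        _ ≤ _ := Nat.pow_le_pow_right (by norm_num) (by omega))
  rw [← blk_eq_Ico] at h1
  have h2 : ((((x / 2 ^ k + 1) * 2 ^ k : ℕ) : ℝ) - ((x / 2 ^ k * 2 ^ k : ℕ) : ℝ)) = 2 ^ k := by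
    push_cast; ring
  rw [h2] at h1
  rw [dE, div_le_iff₀ (by positivity)]
  linarith

lemma A1.rpow {Λ : ℕ} {v : ℕ → ℝ} {C a : ℝ} (hC : 1 ≤ C) (hv : ∀ x, 0 < v x) (h : A1 Λ v C)
    (ha0 : 0 ≤ a) (ha1 : a < 1) : A1 Λ (fun x => v x ^ a) C := by
  intro c b x hc hb hL
  have hl : (0 : ℝ) < (b : ℝ) - c := by
    have : (c : ℝ) < b := by exact_mod_cast lt_of_le_of_lt hc hb
    linarith
  have hS : 0 < C * ((b : ℝ) - c) * v x := by have := hv x; positivity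
  have h1 := sum_rpow_le hv ha0 ha1 (h c b x hc hb hL) hS
  refine h1.trans ?_
  have hcard : (((Ico c b).card : ℕ) : ℝ) = (b : ℝ) - c := by
    rw [Nat.card_Ico, Nat.cast_sub (by omega)]
  rw [hcard, Real.mul_rpow (by positivity) (hv x).le, Real.mul_rpow (by positivity) hl.le]
  have hCa : C ^ a ≤ C := by
    calc C ^ a ≤ C ^ (1 : ℝ) := Real.rpow_le_rpow_of_exponent_le hC ha1.le
      _ = C := Real.rpow_one C
  have e : ((b : ℝ) - c) ^ a * ((b : ℝ) - c) ^ (1 - a) = (b : ℝ) - c := by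
    rw [← Real.rpow_add hl]; simp
  calc C ^ a * ((b : ℝ) - c) ^ a * v x ^ a * ((b : ℝ) - c) ^ (1 - a)
      = C ^ a * (((b : ℝ) - c) ^ a * ((b : ℝ) - c) ^ (1 - a)) * v x ^ a := by ring
    _ = C ^ a * ((b : ℝ) - c) * v x ^ a := by rw [e]
    _ ≤ _ := by
      have := Real.rpow_nonneg (hv x).le a
      gcongr

/-- squared square function -/
noncomputable def Qs (N : ℕ) (n : ℕ → ℕ) (f : ℕ → ℝ) (x : ℕ) : ℝ :=
  ∑ i ∈ range N, (Mav (n i) f x - Mav (n (i + 1)) f x) ^ 2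

lemma Qs_nonneg (N : ℕ) (n : ℕ → ℕ) (f : ℕ → ℝ) (x : ℕ) : 0 ≤ Qs N n f x :=
  Finset.sum_nonneg fun _ _ => sq_nonneg _

lemma dE_mono {k : ℕ} {f g : ℕ → ℝ} {x J : ℕ} (hx : x < 2 ^ J) (hk : k ≤ J)
    (h : ∀ y < 2 ^ J, f y ≤ g y) : dE k f x ≤ dE k g x := by
  unfold dE blk
  have e : 2 ^ J = 2 ^ (J - k) * 2 ^ k := by rw [← pow_add, Nat.sub_add_cancel hk]
  have hq : x / 2 ^ k < 2 ^ (J - k) := by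
    rw [Nat.div_lt_iff_lt_mul (by positivity), ← e]; exact hx
  gcongr with s hs
  apply h
  have hs := mem_range.1 hs
  calc x / 2 ^ k * 2 ^ k + s < (x / 2 ^ k + 1) * 2 ^ k := by rw [add_mul]; omega
    _ ≤ 2 ^ (J - k) * 2 ^ k := Nat.mul_le_mul_right _ hq
    _ = 2 ^ J := e.symm

lemma sum_ext_zero {J : ℕ} {p : ℝ} (hp : 0 < p) {f : ℕ → ℝ} (hz : ∀ x ≥ 2 ^ J, f x = 0) :
    ∑ x ∈ range (2 ^ (J + 2)), f x ^ p = ∑ x ∈ range (2 ^ J), f x ^ p := by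
  symm
  apply Finset.sum_subset
  · intro x hx
    rw [mem_range] at *
    exact hx.trans_le (Nat.pow_le_pow_right (by norm_num) (by omega))
  · intro x _ hx
    rw [hz x (by simpa using hx), Real.zero_rpow hp.ne']

lemma sum_sub_le {J : ℕ} {p : ℝ} {v : ℕ → ℝ} (hv : ∀ x, 0 < v x) :
    ∑ x ∈ range (2 ^ J), v x ^ p ≤ ∑ x ∈ range (2 ^ (J + 2)), v x ^ p := by
  apply Finset.sum_le_sum_of_subset_of_nonneg
  · intro x hx
    rw [mem_range] at *
    exact hx.trans_le (Nat.pow_le_pow_right (by norm_num) (by omega))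
  · intro x _ _
    exact Real.rpow_nonneg (hv x).le _

lemma Qs_zero {N : ℕ} {n : ℕ → ℕ} {f : ℕ → ℝ} (h : ∀ x, f x = 0) (x : ℕ) : Qs N n f x = 0 := by
  have : f = fun _ => 0 := funext h
  subst this
  simp [Qs, Mav]

lemma exists_pos {J : ℕ} {f : ℕ → ℝ} (hf : ∀ x, 0 ≤ f x) (hz : ∀ x ≥ 2 ^ J, f x = 0)
    (h : ¬ ∀ x, f x = 0) : ∃ x, x < 2 ^ (J + 2) ∧ 0 < f x := by
  push Not at h
  obtain ⟨x, hx⟩ := h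
  refine ⟨x, ?_, lt_of_le_of_ne (hf x) (Ne.symm hx)⟩
  by_contra hc
  apply hx
  apply hz
  have : 2 ^ J ≤ 2 ^ (J + 2) := Nat.pow_le_pow_right (by norm_num) (by omega)
  omega

lemma scalar_low {p : ℝ} (hp1 : 1 < p) (hp2 : p ≤ 2) : ∃ C : ℝ, 0 ≤ C ∧ ∀ (J : ℕ) (f : ℕ → ℝ),
    (∀ x, 0 ≤ f x) → (∀ x ≥ 2 ^ J, f x = 0) → ∀ n : ℕ → ℕ, StrictMono n → (∀ i, 0 < n i) →
    ∀ N, n N < 2 ^ J →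
    ∑ x ∈ range (2 ^ J), Qs N n f x ^ (p / 2) ≤ C * ∑ x ∈ range (2 ^ J), f x ^ p := by
  obtain ⟨C, hC, H⟩ := rdf hp1
  have hC0 : 0 < C := by linarith
  set A := (20 * (cW C (p - 1) * (648 * C) * cW C (p - 1)) + 2) with hA
  have hA0 : 0 ≤ A := by
    have : 0 ≤ cW C (p-1) * cW C (p-1) := mul_self_nonneg _
    have : 0 ≤ cW C (p-1) * cW C (p-1) * C := by positivity
    rw [hA]; nlinarith
  set e := p * (p - 1) / 2 * C ^ (p - 2) with he
  have he0 : 0 < e := by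
    have : 0 < p - 1 := by linarith
    have : 0 < C ^ (p - 2) := Real.rpow_pos_of_pos hC0 _
    positivity
  refine ⟨A * e⁻¹ + C, by positivity, ?_⟩
  intro J f hf hz n hn hn0 N hN
  by_cases h0 : ∀ x, f x = 0
  · have : ∑ x ∈ range (2 ^ J), Qs N n f x ^ (p / 2) = 0 := by
      apply Finset.sum_eq_zero
      intro x _
      rw [Qs_zero h0, Real.zero_rpow (by linarith)]
    rw [this]
    have := Finset.sum_nonneg fun x (_ : x ∈ range (2 ^ J)) => Real.rpow_nonneg (hf x) p
    positivity
  obtain ⟨v, hv, hfv, hA1, hvP⟩ := H (2 ^ (J + 2)) f hf (exists_pos hf hz h0)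
  rw [sum_ext_zero (by linarith) hz] at hvP
  have hJ : 2 ^ J ≤ 2 ^ (J + 2) := Nat.pow_le_pow_right (by norm_num) (by omega)
  have hg : ∀ x < 2 ^ J, ∀ k ≤ J, dE k f x ≤ C * v x := fun x hx k hk =>
    (dE_mono hx hk fun y hy => hfv y (by omega)).trans (hA1.dE_le x hx k hk)
  have hw : WH (2 ^ (J + 2)) (fun x => v x ^ (p - 2)) C (p - 1) := by
    have := (hA1.WH hC hv (a := 2 - p) (by linarith) (by linarith)).inv
    have e1 : (1 - (2 - p)) = p - 1 := by ring
    rw [e1] at this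
    convert this using 2 with x
    rw [← Real.rpow_neg (hv x).le]; congr 1; ring
  have hB : ∀ N K, Monotone K → K N ≤ J →
      ∑ x ∈ range (2 ^ J), (∑ i ∈ range N, (dE (K i) f x - dE (K (i + 1)) f x) ^ 2) * v x ^ (p - 2)
      ≤ e⁻¹ * ∑ x ∈ range (2 ^ J), f x ^ p := by
    intro N K hK hKN
    rw [← div_eq_inv_mul, le_div_iff₀' he0]
    exact mart_low hp1 hp2 hC0 hf hv hg N K hK hKN
  have hBl : ∑ x ∈ range (2 ^ J), dE J f x ^ 2 * v x ^ (p - 2)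
      ≤ e⁻¹ * ∑ x ∈ range (2 ^ J), f x ^ p := by
    rw [← div_eq_inv_mul, le_div_iff₀' he0]
    exact mart_low_last hp1 hp2 hC0 hf hv hg
  have ht := total_bound (n := n) hC0.le (by linarith : 0 < p - 1) hw hz hB hBl hn hn0 N hN
  have hpt : ∀ x, Qs N n f x ^ (p / 2) ≤ Qs N n f x * v x ^ (p - 2) + v x ^ p := by
    intro x
    have hQ := Qs_nonneg N n f x
    have hvx := hv x
    have hvp : v x ^ p = (v x ^ 2) ^ (p / 2) := by
      rw [← Real.rpow_natCast, ← Real.rpow_mul hvx.le]; congr 1; push_cast; ring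
    rcases le_total (Qs N n f x) (v x ^ 2) with h | h
    · have : Qs N n f x ^ (p / 2) ≤ v x ^ p := by
        rw [hvp]; exact Real.rpow_le_rpow hQ h (by linarith)
      have : 0 ≤ Qs N n f x * v x ^ (p - 2) := by positivity
      linarith
    · have hQp : 0 < Qs N n f x := lt_of_lt_of_le (by positivity) h
      have e2 : Qs N n f x ^ (p / 2) = Qs N n f x * Qs N n f x ^ ((p - 2) / 2) := by
        rw [mul_comm, ← Real.rpow_add_one hQp.ne']; congr 1; ring
      have e3 : Qs N n f x ^ ((p - 2) / 2) ≤ v x ^ (p - 2) := by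
        have : v x ^ (p - 2) = (v x ^ 2) ^ ((p - 2) / 2) := by
          rw [← Real.rpow_natCast, ← Real.rpow_mul hvx.le]; congr 1; push_cast; ring
        rw [this]
        exact Real.rpow_le_rpow_of_nonpos (by positivity) h (by linarith)
      rw [e2]
      have := mul_le_mul_of_nonneg_left e3 hQ
      have : 0 ≤ v x ^ p := by positivity
      linarith
  calc ∑ x ∈ range (2 ^ J), Qs N n f x ^ (p / 2)
      ≤ ∑ x ∈ range (2 ^ J), (Qs N n f x * v x ^ (p - 2) + v x ^ p) :=
        Finset.sum_le_sum fun x _ => hpt x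
    _ = ∑ x ∈ range (2 ^ J), Qs N n f x * v x ^ (p - 2) + ∑ x ∈ range (2 ^ J), v x ^ p :=
        Finset.sum_add_distrib
    _ ≤ A * (e⁻¹ * ∑ x ∈ range (2 ^ J), f x ^ p) + C * ∑ x ∈ range (2 ^ J), f x ^ p :=
        add_le_add ht ((sum_sub_le hv).trans hvP)
    _ = _ := by ring

lemma young' {p : ℝ} (hp : 2 < p) {ε : ℝ} (hε : 0 < ε) : ∃ c : ℝ, 0 ≤ c ∧ ∀ g w : ℝ, 0 ≤ g → 0 ≤ w →
    g ^ 2 * w ≤ ε * w ^ (p / (p - 2)) + c * g ^ p := by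
  have h2 : 0 < p - 2 := by linarith
  set t := ε ^ ((p - 2) / p) with ht
  have ht0 : 0 < t := Real.rpow_pos_of_pos hε _
  refine ⟨(t⁻¹) ^ (p / 2), by positivity, fun g w hg hw => ?_⟩
  have hconj : (p / 2).HolderConjugate (p / (p - 2)) := by
    rw [Real.holderConjugate_iff]
    constructor
    · linarith
    · field_simp; ring
  have hy := Real.young_inequality_of_nonneg (a := t⁻¹ * g ^ 2) (b := t * w)
    (by positivity) (by positivity) hconj
  have e1 : t⁻¹ * g ^ 2 * (t * w) = g ^ 2 * w := by field_simp
  have e2 : (t⁻¹ * g ^ 2) ^ (p / 2) = t⁻¹ ^ (p / 2) * g ^ p := by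
    rw [Real.mul_rpow (by positivity) (by positivity), ← Real.rpow_natCast g, ← Real.rpow_mul hg]
    congr 2; push_cast; ring
  have e3 : (t * w) ^ (p / (p - 2)) = ε * w ^ (p / (p - 2)) := by
    rw [Real.mul_rpow ht0.le hw, ht, ← Real.rpow_mul hε.le]
    have : (p - 2) / p * (p / (p - 2)) = 1 := by field_simp
    rw [this, Real.rpow_one]
  rw [e1, e2, e3] at hy
  have h3 : t⁻¹ ^ (p / 2) * g ^ p / (p / 2) ≤ t⁻¹ ^ (p / 2) * g ^ p :=
    div_le_self (by positivity) (by linarith)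
  have h4 : ε * w ^ (p / (p - 2)) / (p / (p - 2)) ≤ ε * w ^ (p / (p - 2)) := by
    apply div_le_self (by positivity)
    rw [le_div_iff₀ h2]; linarith
  linarith

lemma scalar_high {p : ℝ} (hp2 : 2 < p) : ∃ C : ℝ, 0 ≤ C ∧ ∀ (J : ℕ) (f : ℕ → ℝ),
    (∀ x, 0 ≤ f x) → (∀ x ≥ 2 ^ J, f x = 0) → ∀ n : ℕ → ℕ, StrictMono n → (∀ i, 0 < n i) →
    ∀ N, n N < 2 ^ J →
    ∑ x ∈ range (2 ^ J), Qs N n f x ^ (p / 2) ≤ C * ∑ x ∈ range (2 ^ J), f x ^ p := by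
  have h2 : 0 < p - 2 := by linarith
  have hp0 : 0 < p := by linarith
  obtain ⟨C, hC, H⟩ := rdf (by linarith : 1 < p)
  obtain ⟨D, hD, H'⟩ := rdf (P := (p - 1) / (p - 2)) (by rw [lt_div_iff₀ h2]; linarith)
  have hC0 : 0 < C := by linarith
  have hD0 : 0 < D := by linarith
  set a := (p - 1) / p with ha
  have ha0 : 0 < a := by apply div_pos <;> linarith
  have ha1 : a < 1 := by rw [ha, div_lt_one hp0]; linarith
  set A := (20 * (cW D (1 - a) * (648 * D) * cW D (1 - a)) + 2) with hA
  have hA0 : 0 < A := by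
    have : 0 ≤ cW D (1 - a) * cW D (1 - a) := mul_self_nonneg _
    have : 0 ≤ cW D (1 - a) * cW D (1 - a) * D := by positivity
    rw [hA]; nlinarith
  set A' := A * (2 * D + 1) with hA'
  have hA'0 : 0 < A' := by positivity
  obtain ⟨c, hc, hY⟩ := young' hp2 (ε := (2 * A' * D)⁻¹) (by positivity)
  refine ⟨2 * (A' * c * (C ^ p * C)), by positivity, ?_⟩
  intro J f hf hz n hn hn0 N hN
  have hJ : 2 ^ J ≤ 2 ^ (J + 2) := Nat.pow_le_pow_right (by norm_num) (by omega)
  have hF0 : 0 ≤ ∑ x ∈ range (2 ^ J), f x ^ p :=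
    Finset.sum_nonneg fun x (_ : x ∈ range (2 ^ J)) => Real.rpow_nonneg (hf x) p
  by_cases h0 : ∀ x, f x = 0
  · have : ∑ x ∈ range (2 ^ J), Qs N n f x ^ (p / 2) = 0 := by
      apply Finset.sum_eq_zero
      intro x _
      rw [Qs_zero h0, Real.zero_rpow (by linarith)]
    rw [this]
    positivity
  set S : ℕ → ℝ := fun x => if x < 2 ^ J then Qs N n f x ^ ((p - 2) / (2 * a)) else 0 with hS
  have hS0 : ∀ x, 0 ≤ S x := by
    intro x; simp only [hS]; split_ifs
    · exact Real.rpow_nonneg (Qs_nonneg _ _ _ _) _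
    · exact le_rfl
  have hSz : ∀ x ≥ 2 ^ J, S x = 0 := by
    intro x hx; simp only [hS]; rw [if_neg (by omega)]
  have hSP : ∀ x ∈ range (2 ^ J), S x ^ ((p - 1) / (p - 2)) = Qs N n f x ^ (p / 2) := by
    intro x hx
    simp only [hS]; rw [if_pos (mem_range.1 hx), ← Real.rpow_mul (Qs_nonneg _ _ _ _)]
    congr 1
    have : p - 1 ≠ 0 := by linarith
    rw [ha]; field_simp
  by_cases hS1 : ∀ x, S x = 0
  · have : ∑ x ∈ range (2 ^ J), Qs N n f x ^ (p / 2) = 0 := by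
      apply Finset.sum_eq_zero
      intro x hx
      rw [← hSP x hx, hS1, Real.zero_rpow]
      have : 0 < (p - 1) / (p - 2) := by apply div_pos <;> linarith
      exact this.ne'
    rw [this]
    positivity
  obtain ⟨g, hg, hfg, hgA1, hgP⟩ := H (2 ^ (J + 2)) f hf (exists_pos hf hz h0)
  rw [sum_ext_zero (by linarith) hz] at hgP
  obtain ⟨v, hv, hSv, hvA1, hvP⟩ := H' (2 ^ (J + 2)) S hS0 (exists_pos hS0 hSz hS1)
  rw [sum_ext_zero (by apply div_pos <;> linarith) hSz, Finset.sum_congr rfl hSP] at hvP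
  have hw : ∀ x, 0 < v x ^ a := fun x => Real.rpow_pos_of_pos (hv x) _
  have hfg' : ∀ x < 2 ^ J, ∀ k ≤ J, dE k f x ≤ C * g x := fun x hx k hk =>
    (dE_mono hx hk fun y hy => hfg y (by omega)).trans (hgA1.dE_le x hx k hk)
  have hw1 := (hvA1.rpow hD hv ha0.le ha1).dE_le
  have hW := hvA1.WH hD hv ha0.le ha1
  set G := ∑ x ∈ range (2 ^ J), (C * g x) ^ 2 * v x ^ a with hG
  have hG0 : 0 ≤ G := Finset.sum_nonneg fun x _ => by have := hw x; positivity
  have hB : ∀ N K, Monotone K → K N ≤ J →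
      ∑ x ∈ range (2 ^ J), (∑ i ∈ range N, (dE (K i) f x - dE (K (i + 1)) f x) ^ 2) * v x ^ a
      ≤ (2 * D + 1) * G := by
    intro N K hK hKN
    have := mart_high' (g := fun x => C * g x) hf hw hfg' hw1 N K hK hKN
    linarith
  have hBl : ∑ x ∈ range (2 ^ J), dE J f x ^ 2 * v x ^ a ≤ (2 * D + 1) * G := by
    have : ∑ x ∈ range (2 ^ J), dE J f x ^ 2 * v x ^ a ≤ G := by
      refine Finset.sum_le_sum fun x hx => ?_
      have h1 := hfg' x (mem_range.1 hx) J le_rfl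
      have h2 : 0 ≤ dE J f x := dE_nonneg hf J x
      have := hw x
      gcongr
    have : 0 ≤ D * G := by positivity
    linarith
  have ht := total_bound (n := n) hD0.le (by linarith : 0 < 1 - a) hW hz hB hBl hn hn0 N hN
  have hpt : ∀ x ∈ range (2 ^ J), Qs N n f x ^ (p / 2) ≤ Qs N n f x * v x ^ a := by
    intro x hx
    have hQ := Qs_nonneg N n f x
    have h1 : Qs N n f x ^ ((p - 2) / 2) ≤ v x ^ a := by
      have h := Real.rpow_le_rpow (hS0 x) (hSv x (by have := mem_range.1 hx; omega)) ha0.le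
      simp only [hS] at h
      rw [if_pos (mem_range.1 hx), ← Real.rpow_mul hQ] at h
      have e : (p - 2) / (2 * a) * a = (p - 2) / 2 := by field_simp
      rwa [e] at h
    rcases hQ.eq_or_lt with h | h
    · rw [← h, Real.zero_rpow (by linarith)]; simp
    · have e2 : Qs N n f x ^ (p / 2) = Qs N n f x * Qs N n f x ^ ((p - 2) / 2) := by
        rw [mul_comm, ← Real.rpow_add_one h.ne']; congr 1; ring
      rw [e2]
      exact mul_le_mul_of_nonneg_left h1 hQ
  set X := ∑ x ∈ range (2 ^ J), Qs N n f x ^ (p / 2) with hX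
  have h1 : X ≤ A' * G := by
    calc X ≤ ∑ x ∈ range (2 ^ J), Qs N n f x * v x ^ a := Finset.sum_le_sum hpt
      _ ≤ A * ((2 * D + 1) * G) := ht
      _ = A' * G := by rw [hA']; ring
  have h3 : G ≤ (2 * A' * D)⁻¹ * (D * X) + c * (C ^ p * (C * ∑ x ∈ range (2 ^ J), f x ^ p)) := by
    calc G ≤ ∑ x ∈ range (2 ^ J), ((2 * A' * D)⁻¹ * (v x ^ ((p - 1) / (p - 2)))
          + c * (C ^ p * g x ^ p)) := by
          refine Finset.sum_le_sum fun x _ => ?_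
          have := hY (C * g x) (v x ^ a) (by have := hg x; positivity) (hw x).le
          rw [← Real.rpow_mul (hv x).le, Real.mul_rpow hC0.le (hg x).le] at this
          have e : a * (p / (p - 2)) = (p - 1) / (p - 2) := by rw [ha]; field_simp
          rwa [e] at this
      _ = (2 * A' * D)⁻¹ * (∑ x ∈ range (2 ^ J), v x ^ ((p - 1) / (p - 2)))
          + c * (C ^ p * ∑ x ∈ range (2 ^ J), g x ^ p) := by
          rw [Finset.sum_add_distrib, Finset.mul_sum, Finset.mul_sum, Finset.mul_sum]
      _ ≤ _ := by
          gcongr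
          · exact (sum_sub_le hv).trans hvP
          · exact (sum_sub_le hg).trans hgP
  have h4 : A' * ((2 * A' * D)⁻¹ * (D * X)) = X / 2 := by field_simp
  have h5 := mul_le_mul_of_nonneg_left h3 hA'0.le
  rw [mul_add, h4] at h5
  linarith

lemma scalar_pos {p : ℝ} (hp1 : 1 < p) : ∃ C : ℝ, 0 ≤ C ∧ ∀ (J : ℕ) (f : ℕ → ℝ),
    (∀ x, 0 ≤ f x) → (∀ x ≥ 2 ^ J, f x = 0) → ∀ n : ℕ → ℕ, StrictMono n → (∀ i, 0 < n i) →
    ∀ N, n N < 2 ^ J →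
    ∑ x ∈ range (2 ^ J), Qs N n f x ^ (p / 2) ≤ C * ∑ x ∈ range (2 ^ J), f x ^ p := by
  rcases le_or_gt p 2 with h | h
  · exact scalar_low hp1 h
  · exact scalar_high h

lemma add_rpow_le {a b q : ℝ} (ha : 0 ≤ a) (hb : 0 ≤ b) (hq : 0 ≤ q) :
    (a + b) ^ q ≤ 2 ^ q * (a ^ q + b ^ q) := by
  wlog h : a ≤ b generalizing a b
  · have := this hb ha (by linarith)
    rwa [add_comm b a, add_comm (b ^ q)] at this
  calc (a + b) ^ q ≤ (2 * b) ^ q := Real.rpow_le_rpow (by positivity) (by linarith) hq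
    _ = 2 ^ q * b ^ q := Real.mul_rpow (by norm_num) hb
    _ ≤ _ := by
      have := Real.rpow_nonneg ha q
      gcongr; linarith

/-- complex forward averages -/
noncomputable def MavC (n : ℕ) (f : ℕ → ℂ) (x : ℕ) : ℂ :=
  ((n : ℂ) + 1)⁻¹ * (∑ t ∈ range (n + 1), f (x + t))

lemma MavC_re (n : ℕ) (f : ℕ → ℂ) (x : ℕ) : (MavC n f x).re = Mav n (fun y => (f y).re) x := by
  have : ((n : ℂ) + 1)⁻¹ = (((n : ℝ) + 1)⁻¹ : ℝ) := by push_cast; rfl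
  rw [MavC, this, Complex.re_ofReal_mul, Complex.re_sum, Mav, div_eq_inv_mul]

lemma MavC_im (n : ℕ) (f : ℕ → ℂ) (x : ℕ) : (MavC n f x).im = Mav n (fun y => (f y).im) x := by
  have : ((n : ℂ) + 1)⁻¹ = (((n : ℝ) + 1)⁻¹ : ℝ) := by push_cast; rfl
  rw [MavC, this, Complex.im_ofReal_mul, Complex.im_sum, Mav, div_eq_inv_mul]

lemma scalar_real {p : ℝ} (hp1 : 1 < p) : ∃ C : ℝ, 0 ≤ C ∧ ∀ (J : ℕ) (f : ℕ → ℝ),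
    (∀ x ≥ 2 ^ J, f x = 0) → ∀ n : ℕ → ℕ, StrictMono n → (∀ i, 0 < n i) →
    ∀ N, n N < 2 ^ J →
    ∑ x ∈ range (2 ^ J), Qs N n f x ^ (p / 2) ≤ C * ∑ x ∈ range (2 ^ J), |f x| ^ p := by
  obtain ⟨C, hC, H⟩ := scalar_pos hp1
  refine ⟨2 ^ (p / 2) * 2 ^ (p / 2) * (2 * C), by positivity, ?_⟩
  intro J f hz n hn hn0 N hN
  have h1 := H J (fun x => max (f x) 0) (fun x => le_max_right _ _)
    (fun x hx => by simp [hz x hx]) n hn hn0 N hN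
  have h2 := H J (fun x => max (-f x) 0) (fun x => le_max_right _ _)
    (fun x hx => by simp [hz x hx]) n hn hn0 N hN
  have hM : ∀ m x, Mav m f x = Mav m (fun x => max (f x) 0) x - Mav m (fun x => max (-f x) 0) x := by
    intro m x
    unfold Mav
    rw [← sub_div, ← Finset.sum_sub_distrib]
    congr 1
    refine Finset.sum_congr rfl fun t _ => ?_
    change f (x + t) = max (f (x + t)) 0 - max (-f (x + t)) 0
    rcases le_total (f (x + t)) 0 with h | h
    · rw [max_eq_right h, max_eq_left (by linarith)]; ring
    · rw [max_eq_left h, max_eq_right (by linarith)]; ring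
  have hQ : ∀ x, Qs N n f x ≤ 2 * (Qs N n (fun x => max (f x) 0) x
      + Qs N n (fun x => max (-f x) 0) x) := by
    intro x
    unfold Qs
    rw [← Finset.sum_add_distrib, Finset.mul_sum]
    refine Finset.sum_le_sum fun i _ => ?_
    rw [hM (n i), hM (n (i + 1))]
    nlinarith [sq_nonneg (Mav (n i) (fun x => max (f x) 0) x - Mav (n (i + 1)) (fun x => max (f x) 0) x +
      (Mav (n i) (fun x => max (-f x) 0) x - Mav (n (i + 1)) (fun x => max (-f x) 0) x))]
  have hl : ∀ g : ℕ → ℝ, (∀ x, 0 ≤ g x) → (∀ x, g x ≤ |f x|) →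
      ∑ x ∈ range (2 ^ J), g x ^ p ≤ ∑ x ∈ range (2 ^ J), |f x| ^ p := fun g h0 h =>
    Finset.sum_le_sum fun x _ => Real.rpow_le_rpow (h0 x) (h x) (by linarith)
  have h1' := h1.trans (mul_le_mul_of_nonneg_left
    (hl _ (fun x => le_max_right _ _) (fun x => max_le (le_abs_self _) (abs_nonneg _))) hC)
  have h2' := h2.trans (mul_le_mul_of_nonneg_left
    (hl _ (fun x => le_max_right _ _) (fun x => max_le (neg_le_abs _) (abs_nonneg _))) hC)
  calc ∑ x ∈ range (2 ^ J), Qs N n f x ^ (p / 2)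
      ≤ ∑ x ∈ range (2 ^ J), 2 ^ (p / 2) * (2 ^ (p / 2) * (Qs N n (fun x => max (f x) 0) x ^ (p / 2)
      + Qs N n (fun x => max (-f x) 0) x ^ (p / 2))) := by
        refine Finset.sum_le_sum fun x _ => ?_
        have a1 := Qs_nonneg N n (fun x => max (f x) 0) x
        have a2 := Qs_nonneg N n (fun x => max (-f x) 0) x
        refine (Real.rpow_le_rpow (Qs_nonneg _ _ _ _) (hQ x) (by linarith)).trans ?_
        rw [Real.mul_rpow (by norm_num) (by positivity)]
        gcongr
        exact add_rpow_le a1 a2 (by linarith)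
    _ = 2 ^ (p / 2) * (2 ^ (p / 2) * (∑ x ∈ range (2 ^ J), Qs N n (fun x => max (f x) 0) x ^ (p / 2)
      + ∑ x ∈ range (2 ^ J), Qs N n (fun x => max (-f x) 0) x ^ (p / 2))) := by
        rw [← Finset.mul_sum, ← Finset.mul_sum, Finset.sum_add_distrib]
    _ ≤ 2 ^ (p / 2) * (2 ^ (p / 2) * (C * ∑ x ∈ range (2 ^ J), |f x| ^ p
        + C * ∑ x ∈ range (2 ^ J), |f x| ^ p)) := by gcongr
    _ = _ := by ring

theorem scalar_complex {p : ℝ} (hp1 : 1 < p) : ∃ C : ℝ, 0 ≤ C ∧ ∀ (J : ℕ) (f : ℕ → ℂ),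
    (∀ x ≥ 2 ^ J, f x = 0) → ∀ n : ℕ → ℕ, StrictMono n → (∀ i, 0 < n i) →
    ∀ N, n N < 2 ^ J →
    ∑ x ∈ range (2 ^ J), (∑ i ∈ range N, ‖MavC (n i) f x - MavC (n (i + 1)) f x‖ ^ 2) ^ (p / 2)
      ≤ C * ∑ x ∈ range (2 ^ J), ‖f x‖ ^ p := by
  obtain ⟨C, hC, H⟩ := scalar_real hp1
  refine ⟨2 ^ (p / 2) * (2 * C), by positivity, ?_⟩
  intro J f hz n hn hn0 N hN
  have h1 := H J (fun x => (f x).re) (fun x hx => by simp [hz x hx]) n hn hn0 N hN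
  have h2 := H J (fun x => (f x).im) (fun x hx => by simp [hz x hx]) n hn hn0 N hN
  have hQ : ∀ x, ∑ i ∈ range N, ‖MavC (n i) f x - MavC (n (i + 1)) f x‖ ^ 2
      = Qs N n (fun x => (f x).re) x + Qs N n (fun x => (f x).im) x := by
    intro x
    unfold Qs
    rw [← Finset.sum_add_distrib]
    refine Finset.sum_congr rfl fun i _ => ?_
    rw [Complex.sq_norm, Complex.normSq_apply, Complex.sub_re, Complex.sub_im, MavC_re, MavC_im,
      MavC_re, MavC_im]
    ring
  have h1' := h1.trans (mul_le_mul_of_nonneg_left (Finset.sum_le_sum fun x (_ : x ∈ range (2 ^ J)) =>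
    Real.rpow_le_rpow (abs_nonneg _) (Complex.abs_re_le_norm (f x)) (by linarith : 0 ≤ p)) hC)
  have h2' := h2.trans (mul_le_mul_of_nonneg_left (Finset.sum_le_sum fun x (_ : x ∈ range (2 ^ J)) =>
    Real.rpow_le_rpow (abs_nonneg _) (Complex.abs_im_le_norm (f x)) (by linarith : 0 ≤ p)) hC)
  calc _ ≤ ∑ x ∈ range (2 ^ J), 2 ^ (p / 2) * (Qs N n (fun x => (f x).re) x ^ (p / 2)
        + Qs N n (fun x => (f x).im) x ^ (p / 2)) := by
        refine Finset.sum_le_sum fun x _ => ?_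
        rw [hQ x]
        exact add_rpow_le (Qs_nonneg _ _ _ _) (Qs_nonneg _ _ _ _) (by linarith)
    _ = 2 ^ (p / 2) * (∑ x ∈ range (2 ^ J), Qs N n (fun x => (f x).re) x ^ (p / 2)
        + ∑ x ∈ range (2 ^ J), Qs N n (fun x => (f x).im) x ^ (p / 2)) := by
        rw [← Finset.mul_sum, Finset.sum_add_distrib]
    _ ≤ 2 ^ (p / 2) * (C * ∑ x ∈ range (2 ^ J), ‖f x‖ ^ p
        + C * ∑ x ∈ range (2 ^ J), ‖f x‖ ^ p) := by gcongr
    _ = _ := by ring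

end QME

namespace QME
open ProbabilityTheory

/-- Gaussian moment -/
noncomputable def Gm (p : ℝ) : ℝ≥0∞ := ∫⁻ t, ‖t‖ₑ ^ p ∂(gaussianReal 0 1)

lemma Gm_ne_top {p : ℝ} (hp : 0 < p) : Gm p ≠ ∞ := by
  have h := (memLp_id_gaussianReal' (μ := 0) (v := 1) (ENNReal.ofReal p) (by simp)).2
  have := lintegral_rpow_enorm_lt_top_of_eLpNorm_lt_top (by simpa using hp) (by simp) h
  rw [ENNReal.toReal_ofReal hp.le] at this
  simpa [Gm] using this.ne

lemma Gm_ne_zero {p : ℝ} (hp : 0 < p) : Gm p ≠ 0 := by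
  intro h
  unfold Gm at h
  rw [lintegral_eq_zero_iff (by fun_prop)] at h
  have h2 : ∀ᵐ t ∂(gaussianReal 0 1), t ∈ ({0} : Set ℝ) := by
    filter_upwards [h] with t ht
    simpa [hp, hp.le, ENNReal.rpow_eq_zero_iff, not_lt_of_gt hp] using ht
  have h3 : (gaussianReal 0 1) ({0} : Set ℝ) = 0 :=
    gaussianReal_absolutelyContinuous 0 one_ne_zero (by simp)
  have h4 := prob_compl_eq_zero_iff (μ := gaussianReal 0 1) (MeasurableSet.singleton (0:ℝ))
  rw [ae_iff] at h2
  have h5 : {a : ℝ | ¬ a ∈ ({0} : Set ℝ)} = ({0} : Set ℝ)ᶜ := rfl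
  rw [h5, h4, h3] at h2
  simp at h2

/-- standard Gaussian product measure -/
noncomputable abbrev gP (N : ℕ) : Measure (Fin N → ℝ) := Measure.pi fun _ => gaussianReal 0 1

lemma gauss_map (N : ℕ) (a : Fin N → ℝ) :
    (gP N).map (fun g => ∑ i, a i * g i)
      = (gaussianReal 0 1).map (fun t => Real.sqrt (∑ i, a i ^ 2) * t) := by
  apply Measure.ext_of_charFun
  ext t
  rw [gaussianReal_map_const_mul, charFun_gaussianReal, charFun_apply_real,
    integral_map (Measurable.aemeasurable (by fun_prop)) (by fun_prop)]
  have h1 : ∀ g : Fin N → ℝ, Complex.exp (t * ((∑ i, a i * g i : ℝ) : ℂ) * Complex.I)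
      = ∏ i, Complex.exp ((t * a i : ℝ) * (g i) * Complex.I) := by
    intro g
    rw [← Complex.exp_sum]
    congr 1
    push_cast
    rw [Finset.mul_sum, Finset.sum_mul]
    exact Finset.sum_congr rfl fun i _ => by ring
  simp_rw [h1]
  rw [integral_fintype_prod_eq_prod (𝕜 := ℂ)
    (fun i (s : ℝ) => Complex.exp ((t * a i : ℝ) * s * Complex.I))]
  have h2 : ∀ i, ∫ s, Complex.exp ((t * a i : ℝ) * s * Complex.I) ∂(gaussianReal 0 1)
      = Complex.exp (-((t * a i : ℝ) : ℂ) ^ 2 / 2) := by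
    intro i
    rw [← charFun_apply_real, charFun_gaussianReal]
    congr 1
    push_cast; ring
  simp_rw [h2]
  rw [← Complex.exp_sum]
  congr 1
  simp only [mul_zero, Complex.ofReal_zero, zero_mul, zero_sub]
  have h3 : ((Real.sqrt (∑ i, a i ^ 2)) ^ 2) = ∑ i, a i ^ 2 :=
    Real.sq_sqrt (Finset.sum_nonneg fun i _ => sq_nonneg _)
  have h4 : (((NNReal.mk ((Real.sqrt (∑ i, a i ^ 2)) ^ 2) (sq_nonneg _) * 1 : NNReal) : ℝ) : ℂ)
      = ∑ i, (a i : ℂ) ^ 2 := by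
    rw [mul_one, NNReal.coe_mk, h3]; push_cast; rfl
  rw [h4, Finset.sum_mul, Finset.sum_div, ← Finset.sum_neg_distrib]
  refine Finset.sum_congr rfl fun i _ => ?_
  push_cast; ring

lemma gauss_moment {p : ℝ} (hp : 0 < p) (N : ℕ) (a : Fin N → ℝ) :
    ∫⁻ g, ‖∑ i, a i * g i‖ₑ ^ p ∂(gP N) = ENNReal.ofReal ((∑ i, a i ^ 2) ^ (p / 2)) * Gm p := by
  have h0 : 0 ≤ ∑ i, a i ^ 2 := Finset.sum_nonneg fun i _ => sq_nonneg _
  have h := lintegral_map (μ := gP N) (f := fun s : ℝ => ‖s‖ₑ ^ p) (g := fun g => ∑ i, a i * g i)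
    (by fun_prop) (by fun_prop)
  rw [← h, gauss_map, lintegral_map (by fun_prop) (by fun_prop), Gm, ← lintegral_const_mul _ (by fun_prop)]
  refine lintegral_congr fun t => ?_
  rw [enorm_mul, ENNReal.mul_rpow_of_nonneg _ _ hp.le, Real.enorm_of_nonneg (Real.sqrt_nonneg _),
    ENNReal.ofReal_rpow_of_nonneg (Real.sqrt_nonneg _) hp.le, Real.sqrt_eq_rpow,
    ← Real.rpow_mul h0]
  have e : 1 / 2 * p = p / 2 := by ring
  rw [e]

lemma gauss_complex_upper {p : ℝ} (hp : 0 < p) (N : ℕ) (z : Fin N → ℂ) :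
    ∫⁻ g, ‖∑ i, z i * (g i : ℂ)‖ₑ ^ p ∂(gP N)
      ≤ (2 ^ p * (2 * Gm p)) * ENNReal.ofReal ((∑ i, ‖z i‖ ^ 2) ^ (p / 2)) := by
  have hpt : ∀ g : Fin N → ℝ, ‖∑ i, z i * (g i : ℂ)‖ₑ ^ p
      ≤ 2 ^ p * (‖∑ i, (z i).re * g i‖ₑ ^ p + ‖∑ i, (z i).im * g i‖ₑ ^ p) := by
    intro g
    have e : ∑ i, z i * (g i : ℂ) = ((∑ i, (z i).re * g i : ℝ) : ℂ)
        + ((∑ i, (z i).im * g i : ℝ) : ℂ) * Complex.I := by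
      apply Complex.ext <;> simp
    have h1 : ‖∑ i, z i * (g i : ℂ)‖ ≤ |∑ i, (z i).re * g i| + |∑ i, (z i).im * g i| := by
      rw [e]
      refine (norm_add_le _ _).trans ?_
      simp [-Complex.ofReal_sum, -Complex.ofReal_mul]
    rw [← ofReal_norm, ← ofReal_norm, ← ofReal_norm, ENNReal.ofReal_rpow_of_nonneg (norm_nonneg _) hp.le,
      ENNReal.ofReal_rpow_of_nonneg (norm_nonneg _) hp.le,
      ENNReal.ofReal_rpow_of_nonneg (norm_nonneg _) hp.le,
      ← ENNReal.ofReal_add (by positivity) (by positivity)]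
    have h2 : (2 : ℝ≥0∞) ^ p = ENNReal.ofReal (2 ^ p) := by
      rw [← ENNReal.ofReal_rpow_of_nonneg (by norm_num) hp.le]; simp
    rw [h2, ← ENNReal.ofReal_mul (by positivity)]
    apply ENNReal.ofReal_le_ofReal
    refine (Real.rpow_le_rpow (norm_nonneg _) h1 hp.le).trans ?_
    exact add_rpow_le (abs_nonneg _) (abs_nonneg _) hp.le
  refine (lintegral_mono hpt).trans ?_
  rw [lintegral_const_mul _ (by fun_prop), lintegral_add_left (by fun_prop), gauss_moment hp,
    gauss_moment hp, ← add_mul]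
  have hm : ∀ f : Fin N → ℝ, (∀ i, f i ^ 2 ≤ ‖z i‖ ^ 2) →
      ENNReal.ofReal ((∑ i, f i ^ 2) ^ (p / 2)) ≤ ENNReal.ofReal ((∑ i, ‖z i‖ ^ 2) ^ (p / 2)) := by
    intro f hf
    apply ENNReal.ofReal_le_ofReal
    exact Real.rpow_le_rpow (Finset.sum_nonneg fun i _ => sq_nonneg _)
      (Finset.sum_le_sum fun i _ => hf i) (by linarith)
  have hr := hm (fun i => (z i).re) (fun i => by
    rw [Complex.sq_norm, Complex.normSq_apply]; nlinarith [sq_nonneg (z i).im])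
  have hi := hm (fun i => (z i).im) (fun i => by
    rw [Complex.sq_norm, Complex.normSq_apply]; nlinarith [sq_nonneg (z i).re])
  calc _ ≤ 2 ^ p * ((ENNReal.ofReal ((∑ i, ‖z i‖ ^ 2) ^ (p / 2))
        + ENNReal.ofReal ((∑ i, ‖z i‖ ^ 2) ^ (p / 2))) * Gm p) := by gcongr
    _ = _ := by ring

lemma gauss_complex_lower {p : ℝ} (hp : 0 < p) (N : ℕ) (z : Fin N → ℂ) :
    Gm p * ENNReal.ofReal ((∑ i, ‖z i‖ ^ 2) ^ (p / 2)) ≤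
      (2 ^ (p / 2) * 2) * ∫⁻ g, ‖∑ i, z i * (g i : ℂ)‖ₑ ^ p ∂(gP N) := by
  have hre : ∀ g : Fin N → ℝ, ‖∑ i, (z i).re * g i‖ₑ ^ p ≤ ‖∑ i, z i * (g i : ℂ)‖ₑ ^ p := by
    intro g
    gcongr
    rw [enorm_le_iff_norm_le]
    have := Complex.abs_re_le_norm (∑ i, z i * (g i : ℂ))
    simpa using this
  have him : ∀ g : Fin N → ℝ, ‖∑ i, (z i).im * g i‖ₑ ^ p ≤ ‖∑ i, z i * (g i : ℂ)‖ₑ ^ p := by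
    intro g
    gcongr
    rw [enorm_le_iff_norm_le]
    have := Complex.abs_im_le_norm (∑ i, z i * (g i : ℂ))
    simpa using this
  have h1 := lintegral_mono (μ := gP N) hre
  have h2 := lintegral_mono (μ := gP N) him
  rw [gauss_moment hp] at h1 h2
  have hs : (∑ i, ‖z i‖ ^ 2) = (∑ i, (z i).re ^ 2) + ∑ i, (z i).im ^ 2 := by
    rw [← Finset.sum_add_distrib]
    refine Finset.sum_congr rfl fun i _ => ?_
    rw [Complex.sq_norm, Complex.normSq_apply]; ring
  have h3 : ENNReal.ofReal ((∑ i, ‖z i‖ ^ 2) ^ (p / 2)) ≤ 2 ^ (p / 2) *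
      (ENNReal.ofReal ((∑ i, (z i).re ^ 2) ^ (p / 2)) + ENNReal.ofReal ((∑ i, (z i).im ^ 2) ^ (p / 2))) := by
    have h2 : (2 : ℝ≥0∞) ^ (p / 2) = ENNReal.ofReal (2 ^ (p / 2)) := by
      rw [← ENNReal.ofReal_rpow_of_nonneg (by norm_num) (by linarith)]; simp
    rw [hs, h2, ← ENNReal.ofReal_add, ← ENNReal.ofReal_mul (by positivity)]
    · apply ENNReal.ofReal_le_ofReal
      exact add_rpow_le (Finset.sum_nonneg fun i _ => sq_nonneg _)
        (Finset.sum_nonneg fun i _ => sq_nonneg _) (by linarith)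
    · exact Real.rpow_nonneg (Finset.sum_nonneg fun i _ => sq_nonneg _) _
    · exact Real.rpow_nonneg (Finset.sum_nonneg fun i _ => sq_nonneg _) _
  calc _ ≤ Gm p * (2 ^ (p / 2) * (ENNReal.ofReal ((∑ i, (z i).re ^ 2) ^ (p / 2))
          + ENNReal.ofReal ((∑ i, (z i).im ^ 2) ^ (p / 2)))) := by gcongr
    _ = 2 ^ (p / 2) * (ENNReal.ofReal ((∑ i, (z i).re ^ 2) ^ (p / 2)) * Gm p
          + ENNReal.ofReal ((∑ i, (z i).im ^ 2) ^ (p / 2)) * Gm p) := by ring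
    _ ≤ 2 ^ (p / 2) * (∫⁻ g, ‖∑ i, z i * (g i : ℂ)‖ₑ ^ p ∂(gP N)
          + ∫⁻ g, ‖∑ i, z i * (g i : ℂ)‖ₑ ^ p ∂(gP N)) := by gcongr
    _ = _ := by ring

/-- `L^p` power integral of the square function -/
noncomputable def sqI {X : Type} [MeasurableSpace X] (μ : Measure X) (p : ℝ) (N : ℕ)
    (u : Fin N → X → ℂ) : ℝ≥0∞ := ∫⁻ ω, ENNReal.ofReal ((∑ i, ‖u i ω‖ ^ 2) ^ (p / 2)) ∂μ

lemma Lp_enorm_rpow {X : Type} [MeasurableSpace X] {μ : Measure X} {p : ℝ≥0∞} [Fact (1 ≤ p)]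
    (hp' : p ≠ ∞) (u : Lp ℂ p μ) : ∫⁻ ω, ‖u ω‖ₑ ^ p.toReal ∂μ = ‖u‖ₑ ^ p.toReal := by
  have h1 : (1 : ℝ≥0∞) ≤ p := Fact.out
  have h0 : p ≠ 0 := by rintro rfl; simp at h1
  rw [Lp.enorm_def, eLpNorm_eq_lintegral_rpow_enorm_toReal h0 hp', ← ENNReal.rpow_mul]
  rw [one_div, inv_mul_cancel₀ (ENNReal.toReal_pos h0 hp').ne', ENNReal.rpow_one]

lemma Lp_comb {X : Type} [MeasurableSpace X] {μ : Measure X} {p : ℝ≥0∞} [Fact (1 ≤ p)]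
    (hp' : p ≠ ∞) {N : ℕ} (u : Fin N → Lp ℂ p μ) (g : Fin N → ℝ) :
    ∫⁻ ω, ‖∑ i, u i ω * (g i : ℂ)‖ₑ ^ p.toReal ∂μ = ‖∑ i, (g i : ℂ) • u i‖ₑ ^ p.toReal := by
  rw [← Lp_enorm_rpow hp']
  apply lintegral_congr_ae
  have h1 := Lp.coeFn_finsetSum (p := p) (μ := μ) Finset.univ (fun i => (g i : ℂ) • u i)
  have h2 : ∀ᵐ ω ∂μ, ∀ i, ((g i : ℂ) • u i : Lp ℂ p μ) ω = (g i : ℂ) * u i ω := by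
    rw [ae_all_iff]
    intro i
    filter_upwards [Lp.coeFn_smul (g i : ℂ) (u i)] with ω h
    rw [h]; rfl
  filter_upwards [h1, h2] with ω h1 h2
  rw [h1, Finset.sum_apply]
  congr 2
  exact Finset.sum_congr rfl fun i _ => by rw [h2, mul_comm]

lemma Lp_fubini {X : Type} [MeasurableSpace X] {μ : Measure X} [SigmaFinite μ] {p : ℝ≥0∞} [Fact (1 ≤ p)]
    (hp' : p ≠ ∞) {N : ℕ} (u : Fin N → Lp ℂ p μ) :
    ∫⁻ ω, ∫⁻ g, ‖∑ i, u i ω * (g i : ℂ)‖ₑ ^ p.toReal ∂(gP N) ∂μ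
      = ∫⁻ g, ‖∑ i, ((g i : ℝ) : ℂ) • u i‖ₑ ^ p.toReal ∂(gP N) := by
  rw [lintegral_lintegral_swap]
  · exact lintegral_congr fun g => Lp_comb hp' u g
  · have hu : ∀ i, Measurable (fun ω => u i ω) := fun i => (Lp.stronglyMeasurable (u i)).measurable
    apply Measurable.aemeasurable
    unfold Function.uncurry
    fun_prop

theorem MZ {p : ℝ≥0∞} [Fact (1 ≤ p)] (hp' : p ≠ ∞) : ∃ c : ℝ≥0∞, c ≠ ∞ ∧
    ∀ (X : Type) [MeasurableSpace X] (μ : Measure X) [SigmaFinite μ] (R : Lp ℂ p μ →L[ℂ] Lp ℂ p μ)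
    (K : ℝ), ‖R‖ ≤ K → ∀ (N : ℕ) (u : Fin N → Lp ℂ p μ),
    sqI μ p.toReal N (fun i ω => R (u i) ω) ≤ c * ENNReal.ofReal K ^ p.toReal *
      sqI μ p.toReal N (fun i ω => u i ω) := by
  have h1 : (1 : ℝ≥0∞) ≤ p := Fact.out
  have h0 : p ≠ 0 := by rintro rfl; simp at h1
  set q := p.toReal with hq
  have hq0 : 0 < q := ENNReal.toReal_pos h0 hp'
  have hG := Gm_ne_zero hq0
  have hG' := Gm_ne_top hq0
  have h2t : ∀ s : ℝ, 0 ≤ s → (2 : ℝ≥0∞) ^ s ≠ ∞ := fun s hs => by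
    apply ENNReal.rpow_ne_top_of_nonneg hs (by simp)
  refine ⟨(Gm q)⁻¹ * ((2 ^ (q / 2) * 2) * (2 ^ q * (2 * Gm q))), ?_, ?_⟩
  · have a1 := h2t (q / 2) (by linarith)
    have a2 := h2t q (by linarith)
    refine ENNReal.mul_ne_top (by simpa using hG) (ENNReal.mul_ne_top (ENNReal.mul_ne_top a1 (by simp))
      (ENNReal.mul_ne_top a2 (ENNReal.mul_ne_top (by simp) hG')))
  intro X _ μ _ R K hR N u
  have hmu : ∀ (u : Fin N → Lp ℂ p μ) i, Measurable (fun ω => u i ω) := fun u i =>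
    (Lp.stronglyMeasurable (u i)).measurable
  have a1 : Gm q * sqI μ q N (fun i ω => R (u i) ω) ≤
      (2 ^ (q / 2) * 2) * ∫⁻ g, ‖∑ i, ((g i : ℝ) : ℂ) • R (u i)‖ₑ ^ q ∂(gP N) := by
    rw [← Lp_fubini hp', sqI, ← lintegral_const_mul' _ _ hG',
      ← lintegral_const_mul' _ _ (ENNReal.mul_ne_top (h2t _ (by linarith)) (by simp))]
    exact lintegral_mono fun ω => gauss_complex_lower hq0 N _
  have a2 : ∫⁻ g, ‖∑ i, ((g i : ℝ) : ℂ) • u i‖ₑ ^ q ∂(gP N) ≤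
      (2 ^ q * (2 * Gm q)) * sqI μ q N (fun i ω => u i ω) := by
    rw [← Lp_fubini hp', sqI, ← lintegral_const_mul' _ _ (ENNReal.mul_ne_top (h2t _ (by linarith))
      (ENNReal.mul_ne_top (by simp) hG'))]
    exact lintegral_mono fun ω => gauss_complex_upper hq0 N _
  have a3 : ∫⁻ g, ‖∑ i, ((g i : ℝ) : ℂ) • R (u i)‖ₑ ^ q ∂(gP N) ≤
      ENNReal.ofReal K ^ q * ∫⁻ g, ‖∑ i, ((g i : ℝ) : ℂ) • u i‖ₑ ^ q ∂(gP N) := by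
    rw [← lintegral_const_mul' _ _ (ENNReal.rpow_ne_top_of_nonneg hq0.le (by simp))]
    refine lintegral_mono fun g => ?_
    rw [← ENNReal.mul_rpow_of_nonneg _ _ hq0.le]
    gcongr
    have e : ∑ i, ((g i : ℝ) : ℂ) • R (u i) = R (∑ i, ((g i : ℝ) : ℂ) • u i) := by
      rw [map_sum]
      exact Finset.sum_congr rfl fun i _ => (map_smul R _ _).symm
    rw [e, ← ofReal_norm, ← ofReal_norm, ← ENNReal.ofReal_mul ((norm_nonneg _).trans hR)]
    apply ENNReal.ofReal_le_ofReal
    exact (R.le_opNorm _).trans (by gcongr)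
  calc sqI μ q N (fun i ω => R (u i) ω)
      = (Gm q)⁻¹ * (Gm q * sqI μ q N (fun i ω => R (u i) ω)) := by
        rw [← mul_assoc, ENNReal.inv_mul_cancel hG hG', one_mul]
    _ ≤ (Gm q)⁻¹ * ((2 ^ (q / 2) * 2) * (ENNReal.ofReal K ^ q *
        ((2 ^ q * (2 * Gm q)) * sqI μ q N (fun i ω => u i ω)))) := by
        refine mul_le_mul_right (a1.trans (mul_le_mul_right (a3.trans (mul_le_mul_right a2 _)) _)) _
    _ = _ := by ring

end QME

namespace QME

section transfer
variable {X : Type} [MeasurableSpace X] {μ : Measure X} {p : ℝ≥0∞} [Fact (1 ≤ p)]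

lemma clm_pow (T : Lp ℂ p μ ≃L[ℂ] Lp ℂ p μ) (m : ℕ) :
    ((T ^ (m : ℤ) : Lp ℂ p μ ≃L[ℂ] Lp ℂ p μ) : Lp ℂ p μ →L[ℂ] Lp ℂ p μ)
      = (T : Lp ℂ p μ →L[ℂ] Lp ℂ p μ) ^ m := by
  rw [zpow_natCast]
  induction m with
  | zero => rfl
  | succ m ih => rw [pow_succ, pow_succ, ← ih]; rfl

lemma clm_pow_neg (T : Lp ℂ p μ ≃L[ℂ] Lp ℂ p μ) (m : ℕ) (z : Lp ℂ p μ) :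
    ((T ^ (-(m : ℤ)) : Lp ℂ p μ ≃L[ℂ] Lp ℂ p μ) : Lp ℂ p μ →L[ℂ] Lp ℂ p μ)
      (((T : Lp ℂ p μ →L[ℂ] Lp ℂ p μ) ^ m) z) = z := by
  rw [← clm_pow]
  have h : (T ^ (-(m : ℤ))) * (T ^ (m : ℤ)) = 1 := by rw [zpow_neg, inv_mul_cancel]
  have h2 := congrArg (fun (S : Lp ℂ p μ ≃L[ℂ] Lp ℂ p μ) => S z) h
  exact h2

/-- averages along the orbit -/
noncomputable def vav (T : Lp ℂ p μ →L[ℂ] Lp ℂ p μ) (x : Lp ℂ p μ) (n m : ℕ) : Lp ℂ p μ :=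
  ((n : ℂ) + 1)⁻¹ • ∑ t ∈ range (n + 1), (T ^ (m + t)) x

lemma vav_zero (T : Lp ℂ p μ →L[ℂ] Lp ℂ p μ) (x : Lp ℂ p μ) (n : ℕ) :
    ergAvg T n x = vav T x n 0 := by
  simp [ergAvg, vav]

lemma vav_pow (T : Lp ℂ p μ →L[ℂ] Lp ℂ p μ) (x : Lp ℂ p μ) (n m : ℕ) :
    (T ^ m) (vav T x n 0) = vav T x n m := by
  unfold vav
  rw [map_smul, map_sum]
  congr 1
  refine Finset.sum_congr rfl fun t _ => ?_
  rw [zero_add, pow_add]; rfl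

lemma vav_ae (T : Lp ℂ p μ →L[ℂ] Lp ℂ p μ) (x : Lp ℂ p μ) :
    ∀ᵐ ω ∂μ, ∀ n m, vav T x n m ω = MavC n (fun k => ((T ^ k) x) ω) m := by
  rw [ae_all_iff]; intro n
  rw [ae_all_iff]; intro m
  have h1 := Lp.coeFn_smul (((n : ℂ) + 1)⁻¹) (∑ t ∈ range (n + 1), (T ^ (m + t)) x)
  have h2 := Lp.coeFn_finsetSum (p := p) (μ := μ) (range (n + 1)) (fun t => (T ^ (m + t)) x)
  filter_upwards [h1, h2] with ω h1 h2
  unfold vav MavC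
  rw [h1, Pi.smul_apply, h2, Finset.sum_apply, smul_eq_mul]

lemma transfer [SigmaFinite μ] (hp' : p ≠ ∞) {c : ℝ≥0∞}
    (hMZ : ∀ (R : Lp ℂ p μ →L[ℂ] Lp ℂ p μ)
      (K : ℝ), ‖R‖ ≤ K → ∀ (N : ℕ) (u : Fin N → Lp ℂ p μ),
      sqI μ p.toReal N (fun i ω => R (u i) ω) ≤ c * ENNReal.ofReal K ^ p.toReal *
        sqI μ p.toReal N (fun i ω => u i ω))
    {C : ℝ} (hC : 0 ≤ C)
    (hS : ∀ (J : ℕ) (f : ℕ → ℂ),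
      (∀ x ≥ 2 ^ J, f x = 0) → ∀ n : ℕ → ℕ, StrictMono n → (∀ i, 0 < n i) →
      ∀ N, n N < 2 ^ J →
      ∑ x ∈ range (2 ^ J), (∑ i ∈ range N, ‖MavC (n i) f x - MavC (n (i + 1)) f x‖ ^ 2) ^ (p.toReal / 2)
        ≤ C * ∑ x ∈ range (2 ^ J), ‖f x‖ ^ p.toReal)
    (K : ℝ) (T : Lp ℂ p μ ≃L[ℂ] Lp ℂ p μ)
    (hT : ∀ k : ℤ, ‖((T ^ k : Lp ℂ p μ ≃L[ℂ] Lp ℂ p μ) : Lp ℂ p μ →L[ℂ] Lp ℂ p μ)‖ ≤ K)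
    (N : ℕ) (n : ℕ → ℕ) (hn : StrictMono n) (hn0 : ∀ i, 0 < n i) (x : Lp ℂ p μ) :
    ∫⁻ ω, ENNReal.ofReal ((∑ i ∈ range N, ‖(ergAvg (T : Lp ℂ p μ →L[ℂ] Lp ℂ p μ) (n i) x) ω -
                  (ergAvg (T : Lp ℂ p μ →L[ℂ] Lp ℂ p μ) (n (i + 1)) x) ω‖ ^ 2) ^ (p.toReal / 2)) ∂μ
      ≤ c * ENNReal.ofReal K ^ p.toReal * (ENNReal.ofReal C * (2 * (ENNReal.ofReal (K * ‖x‖)) ^ p.toReal)) := by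
  set S : Lp ℂ p μ →L[ℂ] Lp ℂ p μ := (T : Lp ℂ p μ →L[ℂ] Lp ℂ p μ) with hSdef
  have h1 : (1 : ℝ≥0∞) ≤ p := Fact.out
  have h0 : p ≠ 0 := by rintro rfl; simp at h1
  set q := p.toReal with hq
  have hq0 : 0 < q := ENNReal.toReal_pos h0 hp'
  set L := n N + 1 with hL
  set u : ℕ → Fin N → Lp ℂ p μ := fun m i => vav S x (n i) m - vav S x (n (i + 1)) m with hu
  have hum : ∀ m i, Measurable (fun ω => u m i ω) := fun m i =>
    (Lp.stronglyMeasurable (u m i)).measurable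
  have hae := vav_ae S x
  have hsub : ∀ᵐ ω ∂μ, ∀ m i, u m i ω = vav S x (n i) m ω - vav S x (n (i + 1)) m ω := by
    rw [ae_all_iff]; intro m
    rw [ae_all_iff]; intro i
    filter_upwards [Lp.coeFn_sub (vav S x (n i) m) (vav S x (n (i + 1)) m)] with ω h
    exact h
  have hL0 : ∫⁻ ω, ENNReal.ofReal ((∑ i ∈ range N, ‖(ergAvg S (n i) x) ω -
      (ergAvg S (n (i + 1)) x) ω‖ ^ 2) ^ (q / 2)) ∂μ = sqI μ q N (fun i ω => u 0 i ω) := by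
    unfold sqI
    apply lintegral_congr_ae
    filter_upwards [hsub] with ω h
    rw [Finset.sum_range]
    congr 3
    funext i
    rw [h, vav_zero, vav_zero]
  rw [hL0]
  have hstep : ∀ m, sqI μ q N (fun i ω => u 0 i ω) ≤ c * ENNReal.ofReal K ^ q *
      sqI μ q N (fun i ω => u m i ω) := by
    intro m
    have := hMZ _ K (hT (-(m : ℤ))) N (u m)
    convert this using 4 with i ω
    have e : u m i = (S ^ m) (u 0 i) := by
      simp only [hu]; rw [map_sub, vav_pow, vav_pow]
    rw [e, clm_pow_neg]
  have hsum : ∑ m ∈ range L, sqI μ q N (fun i ω => u m i ω)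
      ≤ ENNReal.ofReal C * ∑ m ∈ range (2 * L), ‖(S ^ m) x‖ₑ ^ q := by
    have e1 : ∀ m, ‖(S ^ m) x‖ₑ ^ q = ∫⁻ ω, ‖((S ^ m) x) ω‖ₑ ^ q ∂μ := fun m =>
      (Lp_enorm_rpow hp' _).symm
    simp_rw [e1]
    have hm1 : ∀ m, Measurable (fun ω => ‖((S ^ m) x) ω‖ₑ ^ q) := fun m =>
      ((Lp.stronglyMeasurable ((S ^ m) x)).measurable.enorm).pow_const q
    rw [← lintegral_finsetSum _ (fun m _ => hm1 m), ← lintegral_const_mul' _ _ (by simp)]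
    unfold sqI
    rw [← lintegral_finsetSum _ (fun m _ => by
      have := hum m
      fun_prop)]
    apply lintegral_mono_ae
    filter_upwards [hae, hsub] with ω hv hs
    set F : ℕ → ℂ := fun k => if k < 2 * L then ((S ^ k) x) ω else 0 with hF
    have hJ : 2 * L < 2 ^ (2 * L) := Nat.lt_two_pow_self
    have key := hS (2 * L) F (fun k hk => by simp only [hF]; rw [if_neg (by omega)]) n hn hn0 N
      (by omega)
    have e2 : ∀ m < L, ∀ j ≤ n N, MavC j (fun k => ((S ^ k) x) ω) m = MavC j F m := by
      intro m hm j hj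
      unfold MavC
      congr 1
      refine Finset.sum_congr rfl fun t ht => ?_
      have := mem_range.1 ht
      simp only [hF]; rw [if_pos (by omega)]
    have e3 : ∑ k ∈ range (2 ^ (2 * L)), ‖F k‖ ^ q = ∑ k ∈ range (2 * L), ‖((S ^ k) x) ω‖ ^ q := by
      symm
      rw [← Finset.sum_subset (Finset.range_subset_range.2 hJ.le)]
      · refine Finset.sum_congr rfl fun k hk => ?_
        simp only [hF]; rw [if_pos (mem_range.1 hk)]
      · intro k _ hk
        simp only [hF]; rw [if_neg (by simpa using hk), norm_zero, Real.zero_rpow hq0.ne']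
    rw [e3] at key
    have e4 : ∀ m ∈ range L, ENNReal.ofReal ((∑ i, ‖u m i ω‖ ^ 2) ^ (q / 2))
        = ENNReal.ofReal ((∑ i ∈ range N, ‖MavC (n i) F m - MavC (n (i + 1)) F m‖ ^ 2) ^ (q / 2)) := by
      intro m hm
      rw [Finset.sum_range]
      congr 3
      funext i
      rw [hs, hv, hv, e2 m (mem_range.1 hm) _ (hn.monotone i.2.le),
        e2 m (mem_range.1 hm) _ (hn.monotone i.2)]
    have hnn : ∀ m, 0 ≤ (∑ i ∈ range N, ‖MavC (n i) F m - MavC (n (i + 1)) F m‖ ^ 2) ^ (q / 2) :=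
      fun m => Real.rpow_nonneg (Finset.sum_nonneg fun _ _ => sq_nonneg _) _
    rw [Finset.sum_congr rfl e4, ← ENNReal.ofReal_sum_of_nonneg (fun m _ => hnn m)]
    have e5 : ∀ k, ‖((S ^ k) x) ω‖ₑ ^ q = ENNReal.ofReal (‖((S ^ k) x) ω‖ ^ q) := by
      intro k
      rw [← ofReal_norm, ENNReal.ofReal_rpow_of_nonneg (norm_nonneg _) hq0.le]
    simp_rw [e5]
    rw [← ENNReal.ofReal_sum_of_nonneg (fun k _ => by positivity), ← ENNReal.ofReal_mul hC]
    apply ENNReal.ofReal_le_ofReal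
    refine le_trans ?_ key
    apply Finset.sum_le_sum_of_subset_of_nonneg
    · exact Finset.range_subset_range.2 (by omega)
    · intro m _ _; exact hnn m
  have hx : ∀ m, ‖(S ^ m) x‖ₑ ^ q ≤ ENNReal.ofReal (K * ‖x‖) ^ q := by
    intro m
    gcongr
    rw [← ofReal_norm]
    apply ENNReal.ofReal_le_ofReal
    have := hT m
    rw [clm_pow] at this
    exact ((S ^ m).le_opNorm x).trans (by gcongr)
  have htot : (L : ℝ≥0∞) * sqI μ q N (fun i ω => u 0 i ω) ≤ (L : ℝ≥0∞) *
      (c * ENNReal.ofReal K ^ q * (ENNReal.ofReal C * (2 * (ENNReal.ofReal (K * ‖x‖)) ^ q))) := by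
    calc (L : ℝ≥0∞) * sqI μ q N (fun i ω => u 0 i ω)
        = ∑ m ∈ range L, sqI μ q N (fun i ω => u 0 i ω) := by simp
      _ ≤ ∑ m ∈ range L, c * ENNReal.ofReal K ^ q * sqI μ q N (fun i ω => u m i ω) :=
          Finset.sum_le_sum fun m _ => hstep m
      _ = c * ENNReal.ofReal K ^ q * ∑ m ∈ range L, sqI μ q N (fun i ω => u m i ω) := by
          rw [Finset.mul_sum]
      _ ≤ c * ENNReal.ofReal K ^ q * (ENNReal.ofReal C * ∑ m ∈ range (2 * L), ‖(S ^ m) x‖ₑ ^ q) :=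
          mul_le_mul_right hsum _
      _ ≤ c * ENNReal.ofReal K ^ q * (ENNReal.ofReal C * ∑ m ∈ range (2 * L),
          ENNReal.ofReal (K * ‖x‖) ^ q) :=
          mul_le_mul_right (mul_le_mul_right (Finset.sum_le_sum fun m _ => hx m) _) _
      _ = _ := by
          simp only [Finset.sum_const, card_range, nsmul_eq_mul]
          push_cast; ring
  exact (ENNReal.mul_le_mul_iff_right (by simp [hL]) (by simp)).1 htot

end transfer
end QME

/-- Quantitative mean ergodic inequality for invertible power bounded operators on
`L^p`, one-sided averages (commutative case of Theorem 1.1). -/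
theorem quantitative_mean_ergodic_power_bounded
    (p : ℝ≥0∞) [Fact (1 ≤ p)] (hp : 1 < p) (hp' : p ≠ ∞) (K : ℝ) :
    ∃ C : ℝ, 0 < C ∧
      ∀ (X : Type) [MeasurableSpace X] (μ : Measure X) [SigmaFinite μ]
        (T : Lp ℂ p μ ≃L[ℂ] Lp ℂ p μ),
        (∀ k : ℤ, ‖((T ^ k : Lp ℂ p μ ≃L[ℂ] Lp ℂ p μ) : Lp ℂ p μ →L[ℂ] Lp ℂ p μ)‖ ≤ K) →
        ∀ (N : ℕ) (n : ℕ → ℕ), StrictMono n → (∀ i, 0 < n i) →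
        ∀ x : Lp ℂ p μ,
          eLpNorm
            (fun ω => (∑ i ∈ Finset.range N,
                ‖(ergAvg (T : Lp ℂ p μ →L[ℂ] Lp ℂ p μ) (n i) x) ω -
                  (ergAvg (T : Lp ℂ p μ →L[ℂ] Lp ℂ p μ) (n (i + 1)) x) ω‖ ^ 2 : ℝ)
              ^ (1 / 2 : ℝ)) p μ
          ≤ ENNReal.ofReal (C * ‖x‖) := by
  obtain ⟨c, hc, hMZ⟩ := QME.MZ (p := p) hp'
  have h0 : p ≠ 0 := by rintro rfl; simp at hp
  have hq1 : 1 < p.toReal := by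
    rw [← ENNReal.toReal_one]; exact (ENNReal.toReal_lt_toReal (by simp) hp').2 hp
  have hq0 : 0 < p.toReal := by linarith
  obtain ⟨C, hC, hS⟩ := QME.scalar_complex hq1
  set q := p.toReal with hq
  set A : ℝ≥0∞ := c * ENNReal.ofReal K ^ q * (ENNReal.ofReal C * (2 * (ENNReal.ofReal K) ^ q)) with hA
  have hAt : A ≠ ∞ := by
    have hK : (ENNReal.ofReal K) ^ q ≠ ∞ := ENNReal.rpow_ne_top_of_nonneg hq0.le (by simp)
    exact ENNReal.mul_ne_top (ENNReal.mul_ne_top hc hK)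
      (ENNReal.mul_ne_top (by simp) (ENNReal.mul_ne_top (by simp) hK))
  have hAt' : A ^ (1 / q) ≠ ∞ := ENNReal.rpow_ne_top_of_nonneg (by positivity) hAt
  refine ⟨(A ^ (1 / q)).toReal + 1, by positivity, ?_⟩
  intro X _ μ _ T hT N n hn hn0 x
  have hK0 : 0 ≤ K := (norm_nonneg _).trans (hT 0)
  have h := QME.transfer hp' (hMZ X μ) hC hS K T hT N n hn hn0 x
  rw [eLpNorm_eq_lintegral_rpow_enorm_toReal h0 hp', ← hq]
  have e1 : ∀ s : ℝ, 0 ≤ s → ‖s ^ (1 / 2 : ℝ)‖ₑ ^ q = ENNReal.ofReal (s ^ (q / 2)) := by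
    intro s hs
    rw [Real.enorm_of_nonneg (by positivity), ENNReal.ofReal_rpow_of_nonneg (by positivity) hq0.le,
      ← Real.rpow_mul hs]
    have : 1 / 2 * q = q / 2 := by ring
    rw [this]
  have e2 := lintegral_congr (μ := μ) (fun ω => e1 (∑ i ∈ Finset.range N,
                ‖(ergAvg (T : Lp ℂ p μ →L[ℂ] Lp ℂ p μ) (n i) x) ω -
                  (ergAvg (T : Lp ℂ p μ →L[ℂ] Lp ℂ p μ) (n (i + 1)) x) ω‖ ^ 2 : ℝ)
                  (Finset.sum_nonneg fun _ _ => sq_nonneg _))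
  rw [e2]
  have e3 : c * ENNReal.ofReal K ^ q * (ENNReal.ofReal C * (2 * (ENNReal.ofReal (K * ‖x‖)) ^ q))
      = A * ENNReal.ofReal ‖x‖ ^ q := by
    rw [ENNReal.ofReal_mul hK0, ENNReal.mul_rpow_of_nonneg _ _ hq0.le, hA]; ring
  rw [e3] at h
  calc _ ≤ (A * ENNReal.ofReal ‖x‖ ^ q) ^ (1 / q) := ENNReal.rpow_le_rpow h (by positivity)
    _ = A ^ (1 / q) * ENNReal.ofReal ‖x‖ := by
        rw [ENNReal.mul_rpow_of_nonneg _ _ (by positivity), ← ENNReal.rpow_mul, mul_one_div,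
          div_self hq0.ne', ENNReal.rpow_one]
    _ = ENNReal.ofReal ((A ^ (1 / q)).toReal * ‖x‖) := by
        rw [ENNReal.ofReal_mul (by positivity), ENNReal.ofReal_toReal hAt']
    _ ≤ _ := by
        apply ENNReal.ofReal_le_ofReal
        gcongr
        linarith
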